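/- Let K be an infinite finitely generated field of characteristic p > 0, let R ⊆ K be a finitely generated subring, let L/K be a finite Galois extension with Galois group 𝒢 = Gal(L/K), and fix a conjugacy class 𝒞 of 𝒢. Then there exists a nontrivial discrete valuation v on K such that the completion K_v is locally compact, R is contained in the valuation ring 𝒪_v of v, and for any extension w of v to L, the extension of completions L_w/K_v is unramified and its Frobenius automorphism, viewed as an element of Gal(L/K) via the decomposition group at w, belongs to 𝒞. -/

import Mathlib

/-- The ring of `p`-adic integers `ℤ_p` considered as a valuation subring of `ℚ_p`. -/
noncomputable def padicValuationSubring (p : ℕ) [Fact p.Prime] : ValuationSubring ℚ_[p] where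
  toSubring := PadicInt.subring p
  mem_or_inv_mem' := by
    intro x
    rcases le_or_gt ‖x‖ 1 with h | h
    · exact Or.inl h
    · refine Or.inr ?_
      show ‖x⁻¹‖ ≤ 1
      rw [norm_inv]
      exact inv_le_one_of_one_le₀ h.le

variable {K L : Type*} [Field K] [Field L] [Algebra K L]

/-- If `w` is a valuation subring of `L` lying over the valuation subring `v` of `K`, this is
the induced ring homomorphism `v →+* w`. -/
def ValuationSubring.extensionHom (v : ValuationSubring K) (w : ValuationSubring L)
    (h : w.comap (algebraMap K L) = v) : v →+* w where
  toFun x := ⟨algebraMap K L x, by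
    have hx : (x : K) ∈ w.comap (algebraMap K L) := by rw [h]; exact x.2
    exact ValuationSubring.mem_comap.mp hx⟩
  map_one' := by ext; simp
  map_mul' x y := by ext; simp
  map_zero' := by ext; simp
  map_add' x y := by ext; simp

instance ValuationSubring.isLocalHom_extensionHom (v : ValuationSubring K)
    (w : ValuationSubring L) (h : w.comap (algebraMap K L) = v) :
    IsLocalHom (ValuationSubring.extensionHom v w h) := by
  subst h
  constructor
  intro x hx
  rcases hx with ⟨u, hu⟩
  have hval : ((u : w) : L) = algebraMap K L x := congrArg Subtype.val hu
  have hx0 : (x : K) ≠ 0 := by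
    intro h0
    apply u.ne_zero
    have : ((u : w) : L) = 0 := by rw [hval, h0, map_zero]
    exact Subtype.ext this
  have hmul : ((u⁻¹ : wˣ) : w) * (u : w) = 1 := u.inv_mul
  have hmulL : (((u⁻¹ : wˣ) : w) : L) * algebraMap K L x = 1 := by
    rw [← hval]
    exact_mod_cast congrArg Subtype.val hmul
  have hinvL : (((u⁻¹ : wˣ) : w) : L) = algebraMap K L ((x : K)⁻¹) := by
    rw [map_inv₀]
    exact eq_inv_of_mul_eq_one_left hmulL
  have hmem : (x : K)⁻¹ ∈ w.comap (algebraMap K L) :=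
    ValuationSubring.mem_comap.mpr (by rw [← hinvL]; exact ((u⁻¹ : wˣ) : w).2)
  refine IsUnit.of_mul_eq_one (a := x) ⟨(x : K)⁻¹, hmem⟩ (Subtype.ext ?_)
  simp [mul_inv_cancel₀ hx0]

/-- The extension `L_w / K_v` of completions is unramified: the value group is unchanged and
the residue field extension is separable. -/
def ValuationSubring.IsUnramifiedExtension (v : ValuationSubring K) (w : ValuationSubring L)
    (h : w.comap (algebraMap K L) = v) : Prop :=
  (∀ x : L, x ≠ 0 → ∃ y : K, y ≠ 0 ∧ w.valuation x = w.valuation (algebraMap K L y)) ∧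
  (letI := (IsLocalRing.ResidueField.map (ValuationSubring.extensionHom v w h)).toAlgebra
   Algebra.IsSeparable (IsLocalRing.ResidueField ↥v) (IsLocalRing.ResidueField ↥w))

/-- `σ` is the Frobenius automorphism of `L_w/K_v`: it belongs to the decomposition group of `w`
and induces `x ↦ x^q` on the residue field of `w`, where `q` is the cardinality of the residue
field of `v`. -/
def ValuationSubring.IsFrobeniusAt (v : ValuationSubring K) (w : ValuationSubring L)
    (σ : L ≃ₐ[K] L) : Prop :=
  (∀ x : L, x ∈ w ↔ σ x ∈ w) ∧
  (∀ x : L, x ∈ w →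
    w.valuation (σ x - x ^ Nat.card (IsLocalRing.ResidueField ↥v)) < 1)

open Polynomial

section BivariateLinearAlgebra
variable {k : Type*} [Field k]

theorem Polynomial.Bivariate.coeff_coeff_swap (G : k[X][X]) (i j : ℕ) :
    ((Bivariate.swap G).coeff i).coeff j = (G.coeff j).coeff i := by
  induction G using Polynomial.induction_on' with
  | add p q hp hq => simp [hp, hq]
  | monomial n a =>
    induction a using Polynomial.induction_on' with
    | add p q hp hq => simp_all [map_add]
    | monomial m r =>
      rw [Bivariate.swap_monomial_monomial]
      simp only [coeff_monomial]
      split_ifs <;> simp_all [coeff_monomial]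

/-- Bivariate polynomials of degree `< A` in the inner variable and `< B` in the outer one. -/
noncomputable def bivSpace (k : Type*) [Field k] (A B : ℕ) : Submodule k k[X][X] :=
  (degreeLT k[X] B).restrictScalars k ⊓
    ((degreeLT k[X] A).restrictScalars k).comap (Bivariate.swap (R := k)).toLinearMap

theorem mem_bivSpace {A B : ℕ} {G : k[X][X]} :
    G ∈ bivSpace k A B ↔ G.degree < B ∧ (Bivariate.swap G).degree < A := by
  simp [bivSpace, mem_degreeLT]

theorem mem_bivSpace_iff_coeff {A B : ℕ} {G : k[X][X]} :
    G ∈ bivSpace k A B ↔ ∀ i j, (G.coeff j).coeff i ≠ 0 → i < A ∧ j < B := by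
  rw [mem_bivSpace, degree_lt_iff_coeff_zero, degree_lt_iff_coeff_zero]
  constructor
  · rintro ⟨h1, h2⟩ i j hij
    constructor
    · by_contra! hh
      apply hij
      rw [← Bivariate.coeff_coeff_swap, h2 i hh, coeff_zero]
    · by_contra! hh
      apply hij
      rw [h1 j hh, coeff_zero]
  · intro h
    constructor
    · intro j hj
      ext i
      by_contra hc
      exact absurd (h i j hc).2 (by omega)
    · intro i hi
      ext j
      rw [Bivariate.coeff_coeff_swap]
      by_contra hc
      exact absurd (h i j hc).1 (by omega)

theorem bivSpace_mono {A B A' B' : ℕ} (hA : A ≤ A') (hB : B ≤ B') :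
    bivSpace k A B ≤ bivSpace k A' B' := by
  intro G hG
  rw [mem_bivSpace_iff_coeff] at *
  intro i j h
  have := hG i j h
  omega

/-- The bivariate polynomial with prescribed coefficients. -/
noncomputable def bivOfCoeff {R : Type*} [Semiring R] (A B : ℕ) (g : Fin A × Fin B → R) :
    R[X][X] :=
  ∑ q, monomial q.2.1 (monomial q.1.1 (g q))

theorem coeff_bivOfCoeff (A B : ℕ) (g : Fin A × Fin B → k) (i : Fin A) (j : Fin B) :
    ((bivOfCoeff A B g).coeff j).coeff i = g (i, j) := by
  classical
  simp only [bivOfCoeff, finsetSum_coeff]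
  rw [Finset.sum_eq_single (i, j)]
  · simp
  · rintro ⟨a, b⟩ - hab
    by_cases hb : b = j
    · subst hb
      have : a ≠ i := fun h => hab (by rw [h])
      simp [coeff_monomial, Fin.val_inj, this]
    · rw [coeff_monomial, if_neg (fun h => hb (Fin.ext h)), coeff_zero]
  · simp

theorem bivOfCoeff_mem (A B : ℕ) (g : Fin A × Fin B → k) : bivOfCoeff A B g ∈ bivSpace k A B := by
  refine Submodule.sum_mem _ fun q _ => ?_
  rw [mem_bivSpace_iff_coeff]
  intro i j h
  simp only [coeff_monomial] at h
  split_ifs at h with h1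
  · rw [coeff_monomial] at h
    split_ifs at h with h2
    · have := q.1.2; have := q.2.2; omega
    · simp at h
  · simp at h

theorem bivOfCoeff_eq_zero {A B : ℕ} {g : Fin A × Fin B → k} (h : bivOfCoeff A B g = 0) :
    g = 0 := by
  ext ⟨i, j⟩
  rw [← coeff_bivOfCoeff A B g i j, h]
  simp

/-- The coefficients of a polynomial in `bivSpace`, as a linear map. -/
noncomputable def bivSpaceCoeff (A B : ℕ) : bivSpace k A B →ₗ[k] (Fin A × Fin B → k) where
  toFun := fun G q => ((G : k[X][X]).coeff q.2).coeff q.1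
  map_add' := by intros; ext; simp
  map_smul' := by intros; ext; simp

/-- Coefficients identify `bivSpace` with a space of matrices. -/
noncomputable def bivSpaceEquiv (A B : ℕ) : bivSpace k A B ≃ₗ[k] (Fin A × Fin B → k) :=
  LinearEquiv.ofBijective (bivSpaceCoeff A B) (by
    constructor
    · intro G H h
      apply Subtype.ext
      ext j i
      by_cases hij : i < A ∧ j < B
      · exact congrFun h (⟨i, hij.1⟩, ⟨j, hij.2⟩)
      · have h1 := fun hh => hij (mem_bivSpace_iff_coeff.1 G.2 i j hh)
        have h2 := fun hh => hij (mem_bivSpace_iff_coeff.1 H.2 i j hh)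
        rw [not_not.1 h1, not_not.1 h2]
    · intro g
      exact ⟨⟨bivOfCoeff A B g, bivOfCoeff_mem A B g⟩, by
        ext ⟨i, j⟩; exact coeff_bivOfCoeff A B g i j⟩)

theorem bivOfCoeff_coeff {A B : ℕ} {G : k[X][X]} (hG : G ∈ bivSpace k A B) :
    bivOfCoeff A B (fun q => (G.coeff q.2).coeff q.1) = G := by
  have h := (bivSpaceEquiv (k := k) A B).injective
    (a₁ := ⟨_, bivOfCoeff_mem A B (fun q => (G.coeff q.2).coeff q.1)⟩) (a₂ := ⟨G, hG⟩)
    (by ext ⟨i, j⟩; exact coeff_bivOfCoeff A B _ i j)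
  exact congrArg Subtype.val h

theorem map_bivOfCoeff {R S : Type*} [CommSemiring R] [CommSemiring S] (φ : R →+* S) (A B : ℕ)
    (g : Fin A × Fin B → R) :
    (bivOfCoeff A B g).map (mapRingHom φ) = bivOfCoeff A B (fun q => φ (g q)) := by
  simp [bivOfCoeff, Polynomial.map_sum, map_monomial]

instance (A B : ℕ) : FiniteDimensional k (bivSpace k A B) :=
  LinearEquiv.finiteDimensional (bivSpaceEquiv A B).symm

theorem finrank_bivSpace (A B : ℕ) : Module.finrank k (bivSpace k A B) = A * B := by
  rw [(bivSpaceEquiv A B).finrank_eq]; simp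

/-- The degree in the inner variable. -/
noncomputable def degIn (G : k[X][X]) : ℕ := (Bivariate.swap G).natDegree

theorem mul_mem_bivSpace {f G : k[X][X]} {A B : ℕ} (hf : f ≠ 0) (hG : G ∈ bivSpace k A B) :
    f * G ∈ bivSpace k (A + degIn f) (B + f.natDegree) := by
  have hf' : Bivariate.swap f ≠ 0 := by simpa using hf
  rw [mem_bivSpace] at *
  obtain ⟨h1, h2⟩ := hG
  by_cases h0 : G = 0
  · subst h0
    simp [WithBot.bot_lt_iff_ne_bot]
  have hG' : Bivariate.swap G ≠ 0 := by simpa using h0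
  rw [map_mul, degree_mul, degree_mul, degree_eq_natDegree hf, degree_eq_natDegree hf',
    degree_eq_natDegree h0, degree_eq_natDegree hG'] at *
  unfold degIn
  norm_cast at *
  omega

theorem mem_of_mul_mem_bivSpace {f G : k[X][X]} {A B : ℕ} (hf : f ≠ 0)
    (hG : f * G ∈ bivSpace k (A + degIn f) (B + f.natDegree)) : G ∈ bivSpace k A B := by
  have hf' : Bivariate.swap f ≠ 0 := by simpa using hf
  rw [mem_bivSpace] at *
  obtain ⟨h1, h2⟩ := hG
  by_cases h0 : G = 0
  · subst h0
    simp [WithBot.bot_lt_iff_ne_bot]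
  have hG' : Bivariate.swap G ≠ 0 := by simpa using h0
  rw [map_mul, degree_mul, degree_eq_natDegree hf', degree_eq_natDegree hG'] at h2
  rw [degree_mul, degree_eq_natDegree hf, degree_eq_natDegree h0] at h1
  rw [degree_eq_natDegree h0, degree_eq_natDegree hG']
  unfold degIn at h2
  norm_cast at *
  omega

theorem self_mem_bivSpace (f : k[X][X]) : f ∈ bivSpace k (degIn f + 1) (f.natDegree + 1) := by
  rw [mem_bivSpace]
  exact ⟨lt_of_le_of_lt degree_le_natDegree (by norm_cast; omega),
    lt_of_le_of_lt degree_le_natDegree (by unfold degIn; norm_cast; omega)⟩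

theorem finrank_add_le_finrank_sup_add {M : Type*} [AddCommGroup M] [Module k M]
    (f r : M →ₗ[k] M) (hf : Function.Injective f) (hr : Function.Injective r)
    (V₁ V₂ W : Submodule k M) [FiniteDimensional k V₁] [FiniteDimensional k V₂]
    [FiniteDimensional k W]
    (h : ∀ a ∈ V₁, ∀ b ∈ V₂, f a = r b → ∃ c ∈ W, b = f c) :
    Module.finrank k V₁ + Module.finrank k V₂ ≤
      Module.finrank k ↥(V₁.map f ⊔ V₂.map r) + Module.finrank k W := by
  have h1 := Submodule.finrank_sup_add_finrank_inf_eq (V₁.map f) (V₂.map r)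
  rw [← (Submodule.equivMapOfInjective f hf V₁).finrank_eq,
    ← (Submodule.equivMapOfInjective r hr V₂).finrank_eq] at h1
  have h2 : V₁.map f ⊓ V₂.map r ≤ (W.map f).map r := by
    rintro _ ⟨⟨a, ha, rfl⟩, ⟨b, hb, hab⟩⟩
    obtain ⟨c, hc, rfl⟩ := h a ha b hb hab.symm
    exact ⟨_, ⟨c, hc, rfl⟩, hab⟩
  have h3 := Submodule.finrank_mono h2
  have h4 := (Submodule.finrank_map_le r (W.map f)).trans (Submodule.finrank_map_le f W)
  omega

theorem finrank_add_card_le_of_le_ker {M ι : Type*} [AddCommGroup M] [Module k M] [Fintype ι]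
    (e : M →ₗ[k] (ι → k)) (V Z : Submodule k M) [FiniteDimensional k V] (hZV : Z ≤ V)
    (hZ : Z ≤ LinearMap.ker e) (hV : V.map e = ⊤) :
    Module.finrank k Z + Fintype.card ι ≤ Module.finrank k V := by
  have h1 := LinearMap.finrank_range_add_finrank_ker (e.comp V.subtype)
  rw [LinearMap.range_comp, Submodule.range_subtype, hV, finrank_top,
    Module.finrank_fintype_fun_eq_card] at h1
  have hle : Z.comap V.subtype ≤ LinearMap.ker (e.comp V.subtype) := by
    rw [LinearMap.ker_comp]; exact Submodule.comap_mono hZ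
  have h2 := Submodule.finrank_mono hle
  rw [(Submodule.comapSubtypeEquivOfLe hZV).finrank_eq] at h2
  omega

/-- The ideal generated by `f` and `r` has small codimension in spaces of bivariate polynomials. -/
theorem exists_submodule_codim_le {f r : k[X][X]} (hf : Prime f) (hfr : ¬ f ∣ r) (A B : ℕ) :
    ∃ Z : Submodule k k[X][X], (∀ z ∈ Z, ∃ α β, z = α * f + β * r) ∧
      Z ≤ bivSpace k (A + degIn f + degIn r) (B + f.natDegree + r.natDegree) ∧
      (A + degIn f + degIn r) * (B + f.natDegree + r.natDegree) ≤
        Module.finrank k Z + (degIn f * r.natDegree + f.natDegree * degIn r) := by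
  have hr : r ≠ 0 := by rintro rfl; simp at hfr
  have key := finrank_add_le_finrank_sup_add (LinearMap.mulLeft k f) (LinearMap.mulLeft k r)
    (mul_right_injective₀ hf.ne_zero) (mul_right_injective₀ hr)
    (bivSpace k (A + degIn r) (B + r.natDegree)) (bivSpace k (A + degIn f) (B + f.natDegree))
    (bivSpace k A B) (fun a ha b hb hab => by
      rw [LinearMap.mulLeft_apply, LinearMap.mulLeft_apply] at hab
      obtain ⟨γ, rfl⟩ := (hf.dvd_or_dvd ⟨a, hab.symm⟩).resolve_left hfr
      exact ⟨γ, mem_of_mul_mem_bivSpace hf.ne_zero hb, rfl⟩)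
  rw [finrank_bivSpace, finrank_bivSpace, finrank_bivSpace] at key
  refine ⟨(bivSpace k (A + degIn r) (B + r.natDegree)).map (LinearMap.mulLeft k f) ⊔
    (bivSpace k (A + degIn f) (B + f.natDegree)).map (LinearMap.mulLeft k r), ?_, ?_, ?_⟩
  · intro z hz
    obtain ⟨_, ⟨a, -, rfl⟩, _, ⟨b, -, rfl⟩, rfl⟩ := Submodule.mem_sup.1 hz
    exact ⟨a, b, by simp [mul_comm]⟩
  · refine sup_le ?_ ?_
    · rintro _ ⟨a, ha, rfl⟩
      refine bivSpace_mono ?_ ?_ (mul_mem_bivSpace hf.ne_zero ha) <;> omega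
    · rintro _ ⟨a, ha, rfl⟩
      refine bivSpace_mono ?_ ?_ (mul_mem_bivSpace hr ha) <;> omega
  · nlinarith

theorem exists_resultant {f r : k[X][X]} (hf : Prime f) (hfr : ¬ f ∣ r) :
    ∃ R : k[X], R ≠ 0 ∧ R.natDegree ≤ degIn f * r.natDegree + f.natDegree * degIn r ∧
      ∃ α β, C R = α * f + β * r := by
  set e := degIn f * r.natDegree + f.natDegree * degIn r with he
  obtain ⟨Z, hZ, hZV, hdim⟩ := exists_submodule_codim_le hf hfr (e + 1) 1
  rw [← he] at hdim
  set V := bivSpace k (e + 1 + degIn f + degIn r) (1 + f.natDegree + r.natDegree)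
  let W := bivSpace k (e + 1) 1
  have hWV : W ≤ V := bivSpace_mono (by omega) (by omega)
  have hVf : FiniteDimensional k V := inferInstance
  have : FiniteDimensional k Z := Submodule.finiteDimensional_of_le hZV
  have h1 := Submodule.finrank_sup_add_finrank_inf_eq Z W
  have h2 : Module.finrank k ↥(Z ⊔ W) ≤ Module.finrank k V :=
    Submodule.finrank_mono (sup_le hZV hWV)
  rw [finrank_bivSpace] at h2
  have h3 : Module.finrank k W = e + 1 := by rw [finrank_bivSpace]; omega
  have h4 : 0 < Module.finrank k ↥(Z ⊓ W) := by omega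
  have h5 : Z ⊓ W ≠ ⊥ := by
    intro h; rw [h] at h4; simp at h4
  obtain ⟨z, ⟨hz1, hz2⟩, hz0⟩ := Submodule.exists_mem_ne_zero_of_ne_bot h5
  rw [SetLike.mem_coe, mem_bivSpace] at hz2
  have hzC : z = C (z.coeff 0) := by
    ext1 N
    rcases N with _ | N
    · simp
    · rw [coeff_C_succ]
      exact (degree_lt_iff_coeff_zero _ _).1 hz2.1 _ (by omega)
  refine ⟨z.coeff 0, ?_, ?_, ?_⟩
  · intro h; rw [h] at hzC; exact hz0 (by simpa using hzC)
  · rw [natDegree_le_iff_coeff_eq_zero]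
    intro N hN
    have h6 := (degree_lt_iff_coeff_zero _ _).1 hz2.2 N (by omega)
    rw [← Bivariate.coeff_coeff_swap, h6, coeff_zero]
  · rw [← hzC]; exact hZ z hz1

theorem degIn_X_sub_C_C (b : k) : degIn (X - C (C b)) = 0 := by
  unfold degIn
  rw [map_sub, Bivariate.swap_Y, Bivariate.swap_C_C, ← C_sub, natDegree_C]

theorem degIn_C (q : k[X]) : degIn (C q) = q.natDegree := by
  unfold degIn
  rw [Bivariate.swap_C, natDegree_map]

theorem exists_separating_mem_bivSpace (T : Finset (k × k)) (q : k × k) (hq : q ∉ T) :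
    ∃ G ∈ bivSpace k (T.card + 1) (T.card + 1), G.evalEval q.1 q.2 ≠ 0 ∧
      ∀ q' ∈ T, G.evalEval q'.1 q'.2 = 0 := by
  classical
  induction T using Finset.induction_on with
  | empty =>
    exact ⟨1, bivSpace_mono (by simp [degIn]) (by simp) (self_mem_bivSpace (1 : k[X][X])),
      by simp, by simp⟩
  | insert a s ha ih =>
    obtain ⟨G, hG, h1, h2⟩ := ih (fun h => hq (Finset.mem_insert_of_mem h))
    have hF : ∃ F : k[X][X], F ≠ 0 ∧ degIn F ≤ 1 ∧ F.natDegree ≤ 1 ∧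
        F.evalEval q.1 q.2 ≠ 0 ∧ F.evalEval a.1 a.2 = 0 := by
      by_cases h : a.1 = q.1
      · refine ⟨X - C (C a.2), X_sub_C_ne_zero _, by rw [degIn_X_sub_C_C]; omega,
          by rw [natDegree_X_sub_C], ?_, ?_⟩
        · rw [evalEval_sub, evalEval_X, evalEval_CC, sub_ne_zero]
          exact fun h' => hq (Finset.mem_insert.2 (Or.inl (Prod.ext h.symm h')))
        · rw [evalEval_sub, evalEval_X, evalEval_CC, sub_self]
      · refine ⟨C (X - C a.1), C_ne_zero.2 (X_sub_C_ne_zero _),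
          by rw [degIn_C, natDegree_X_sub_C], by rw [natDegree_C]; omega, ?_, ?_⟩
        · rw [evalEval_C, eval_sub, eval_X, eval_C, sub_ne_zero]
          exact fun h' => h h'.symm
        · rw [evalEval_C, eval_sub, eval_X, eval_C, sub_self]
    obtain ⟨F, hF0, hF1, hF2, hF3, hF4⟩ := hF
    refine ⟨F * G, ?_, ?_, ?_⟩
    · rw [Finset.card_insert_of_notMem ha]
      refine bivSpace_mono ?_ ?_ (mul_mem_bivSpace hF0 hG) <;> omega
    · rw [evalEval_mul]; exact mul_ne_zero hF3 h1
    · intro q' hq'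
      rw [evalEval_mul]
      rcases Finset.mem_insert.1 hq' with rfl | h
      · rw [hF4, zero_mul]
      · rw [h2 q' h, mul_zero]

theorem card_commonZeros_le {f r : k[X][X]} (hf : Prime f) (hfr : ¬ f ∣ r)
    (T : Finset (k × k)) (hT : ∀ q ∈ T, f.evalEval q.1 q.2 = 0 ∧ r.evalEval q.1 q.2 = 0) :
    T.card ≤ degIn f * r.natDegree + f.natDegree * degIn r := by
  classical
  obtain ⟨Z, hZ, hZV, hdim⟩ := exists_submodule_codim_le hf hfr (T.card + 1) (T.card + 1)
  set V := bivSpace k (T.card + 1 + degIn f + degIn r) (T.card + 1 + f.natDegree + r.natDegree)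
  let ev : k[X][X] →ₗ[k] (T → k) := LinearMap.pi fun q => (aevalAeval q.1.1 q.1.2).toLinearMap
  have hev : ∀ G q, ev G q = G.evalEval q.1.1 q.1.2 := fun G q => by
    exact congrFun (coe_aevalAeval_eq_evalEval q.1.1 q.1.2) G
  have hsurj : V.map ev = ⊤ := by
    rw [eq_top_iff, ← (Pi.basisFun k T).span_eq, Submodule.span_le]
    rintro _ ⟨q, rfl⟩
    have key : ∃ G ∈ V, G.evalEval q.1.1 q.1.2 ≠ 0 ∧
        ∀ q' ∈ T.erase q.1, G.evalEval q'.1 q'.2 = 0 := by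
      obtain ⟨G, hG, h⟩ := exists_separating_mem_bivSpace (T.erase q.1) q.1
        (Finset.notMem_erase _ _)
      have := Finset.card_erase_le (s := T) (a := q.1)
      exact ⟨G, bivSpace_mono (by omega) (by omega) hG, h⟩
    obtain ⟨G, hG, hG1, hG2⟩ := key
    refine ⟨(G.evalEval q.1.1 q.1.2)⁻¹ • G, Submodule.smul_mem _ _ hG, ?_⟩
    ext q'
    rw [map_smul, Pi.smul_apply, smul_eq_mul, Pi.basisFun_apply, hev]
    by_cases h : q' = q
    · subst h; simp [hG1]
    · rw [hG2 q'.1 (Finset.mem_erase.2 ⟨fun hh => h (Subtype.ext hh), q'.2⟩)]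
      simp [h]
  have hZker : Z ≤ LinearMap.ker ev := by
    intro z hz
    rw [LinearMap.mem_ker]
    ext q
    obtain ⟨α, β, h⟩ := hZ _ hz
    have hq := hT q.1 q.2
    rw [hev, h, evalEval_add, evalEval_mul, evalEval_mul, hq.1, hq.2]
    simp
  have h1 := finrank_add_card_le_of_le_ker ev V Z hZV hZker hsurj
  rw [finrank_bivSpace, Fintype.card_coe] at h1
  omega

end BivariateLinearAlgebra

section Degrees
variable {k : Type*} [Field k]

theorem mem_bivSpace_succ {G : k[X][X]} {A B : ℕ} :
    G ∈ bivSpace k (A + 1) (B + 1) ↔ degIn G ≤ A ∧ G.natDegree ≤ B := by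
  rw [mem_bivSpace, degree_lt_iff_coeff_zero, degree_lt_iff_coeff_zero, degIn,
    natDegree_le_iff_coeff_eq_zero, natDegree_le_iff_coeff_eq_zero, and_comm]
  rfl

theorem degIn_mul_le (F G : k[X][X]) : degIn (F * G) ≤ degIn F + degIn G := by
  unfold degIn; rw [map_mul]; exact natDegree_mul_le

theorem degIn_mul {F G : k[X][X]} (hF : F ≠ 0) (hG : G ≠ 0) :
    degIn (F * G) = degIn F + degIn G := by
  unfold degIn; rw [map_mul]
  exact natDegree_mul (by simpa using hF) (by simpa using hG)

theorem degIn_pow_le (F : k[X][X]) (N : ℕ) : degIn (F ^ N) ≤ N * degIn F := by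
  unfold degIn; rw [map_pow]; exact natDegree_pow_le

theorem degIn_C_mul_X_pow_le (q : k[X]) (j : ℕ) : degIn (C q * X ^ j) ≤ q.natDegree := by
  refine (degIn_mul_le _ _).trans ?_
  have : degIn (X ^ j : k[X][X]) = 0 := by
    unfold degIn; rw [map_pow, Bivariate.swap_Y, ← C_pow, natDegree_C]
  rw [degIn_C, this, add_zero]

theorem degIn_sum_le {ι : Type*} (s : Finset ι) (F : ι → k[X][X]) (N : ℕ)
    (h : ∀ i ∈ s, degIn (F i) ≤ N) : degIn (∑ i ∈ s, F i) ≤ N := by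
  unfold degIn; rw [map_sum]
  exact natDegree_sum_le_of_forall_le s _ h

theorem not_dvd_of_natDegree_lt_monic {f G : k[X][X]} (hf : f.Monic) (hG : G ≠ 0)
    (h : G.natDegree < f.natDegree) : ¬ f ∣ G := by
  rintro ⟨q, rfl⟩
  have hq : q ≠ 0 := by rintro rfl; simp at hG
  rw [hf.natDegree_mul' hq] at h
  omega

end Degrees

section Branch
variable {k : Type*} [Field k]

/-- The power series expansion of bivariate polynomials along a smooth point of a plane curve. -/
theorem exists_branch {f : k[X][X]} (hf : f.Monic) {a η : k} (h0 : f.evalEval a η = 0)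
    (h1 : f.derivative.evalEval a η ≠ 0) :
    ∃ j : k[X][X] →+* PowerSeries k,
      (∀ q : k[X], j (C q) = ((q.comp (X + C a) : k[X]) : PowerSeries k)) ∧ j f = 0 ∧
      ∀ b : k, j (C (C b)) = PowerSeries.C b := by
  let ψ : k[X] →+* PowerSeries k :=
    (Polynomial.coeToPowerSeries.ringHom).comp (compRingHom (X + C a))
  have hψ : ∀ q : k[X], ψ q = ((q.comp (X + C a) : k[X]) : PowerSeries k) := fun q => rfl
  have hc : ∀ G : k[X][X], PowerSeries.constantCoeff ((G.map ψ).eval (PowerSeries.C η)) =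
      G.evalEval a η := by
    intro G
    have : ((PowerSeries.constantCoeff (R := k)).comp
        (eval₂RingHom ψ (PowerSeries.C η))) = evalEvalRingHom a η := by
      ext
      · simp [hψ]
      · simp [hψ]
      · simp
    rw [eval_map]
    exact congrArg (fun g => g G) this
  obtain ⟨y, hy, -⟩ := HenselianRing.is_henselian
    (I := Ideal.span {(PowerSeries.X : PowerSeries k)})
    (f.map ψ) (hf.map ψ) (PowerSeries.C η) (by
      rw [Ideal.mem_span_singleton, PowerSeries.X_dvd_iff, hc, h0]) (by
      rw [derivative_map]
      refine IsUnit.map _ ?_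
      rw [PowerSeries.isUnit_iff_constantCoeff, hc]
      exact isUnit_iff_ne_zero.2 h1)
  refine ⟨eval₂RingHom ψ y, fun q => by simp [hψ], by
    rw [coe_eval₂RingHom, ← eval_map]; exact hy, fun b => by simp [hψ]⟩

theorem le_natDegree_of_X_pow_dvd {q : k[X]} (hq : q ≠ 0) {a : k} {N : ℕ}
    (h : (PowerSeries.X ^ N : PowerSeries k) ∣ ((q.comp (X + C a) : k[X]) : PowerSeries k)) :
    N ≤ q.natDegree := by
  by_contra! hN
  apply hq
  have h1 : q.comp (X + C a) = 0 := by
    ext i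
    rw [coeff_zero]
    by_cases hi : i < N
    · rw [← Polynomial.coeff_coe]
      exact (PowerSeries.X_pow_dvd_iff.1 h) i hi
    · refine coeff_eq_zero_of_natDegree_lt ?_
      rw [natDegree_comp, natDegree_X_add_C]; omega
  have h2 := congrArg (fun g => g.comp (X - C a)) h1
  simp only [comp_assoc, add_comp, X_comp, C_comp, sub_add_cancel, comp_X, zero_comp] at h2
  exact h2

theorem le_of_X_pow_dvd_branch {f E : k[X][X]} (hf : Prime f) (hE : ¬ f ∣ E) {a : k}
    {j : k[X][X] →+* PowerSeries k}
    (hj : ∀ q : k[X], j (C q) = ((q.comp (X + C a) : k[X]) : PowerSeries k)) (hjf : j f = 0)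
    {N : ℕ} (h : (PowerSeries.X ^ N : PowerSeries k) ∣ j E) :
    N ≤ degIn f * E.natDegree + f.natDegree * degIn E := by
  obtain ⟨R, hR, hdeg, α, β, hαβ⟩ := exists_resultant hf hE
  refine le_trans (le_natDegree_of_X_pow_dvd hR (a := a) ?_) hdeg
  rw [← hj, hαβ, map_add, map_mul, map_mul, hjf, mul_zero, zero_add]
  exact Dvd.dvd.mul_left h _

theorem branch_ne_zero {f E : k[X][X]} (hf : Prime f) (hE : ¬ f ∣ E) {a : k}
    {j : k[X][X] →+* PowerSeries k}
    (hj : ∀ q : k[X], j (C q) = ((q.comp (X + C a) : k[X]) : PowerSeries k)) (hjf : j f = 0) :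
    j E ≠ 0 := by
  intro h
  exact absurd (le_of_X_pow_dvd_branch hf hE hj hjf
    (N := degIn f * E.natDegree + f.natDegree * degIn E + 1) (by rw [h]; exact dvd_zero _))
    (by omega)

theorem exists_common_X_pow {ι : Type*} (g : ι → PowerSeries k) (i₀ : ι) (h : g i₀ ≠ 0) :
    ∃ (o : ℕ) (h : ι → PowerSeries k), (∀ i, g i = PowerSeries.X ^ o * h i) ∧
      ∃ i, PowerSeries.constantCoeff (h i) ≠ 0 := by
  classical
  have hex : ∃ o : ℕ, ¬ ∀ i, (PowerSeries.X ^ (o + 1) : PowerSeries k) ∣ g i := by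
    by_contra! hc
    apply h
    ext N
    exact PowerSeries.X_pow_dvd_iff.1 (hc N i₀) N (by omega)
  have h1 : ∀ i, (PowerSeries.X ^ (Nat.find hex) : PowerSeries k) ∣ g i := by
    rcases hN : Nat.find hex with _ | N
    · simp
    · exact not_not.1 (Nat.find_min hex (m := N) (by omega))
  choose h hh using h1
  refine ⟨Nat.find hex, h, hh, ?_⟩
  have h2 := Nat.find_spec hex
  by_contra! hc
  apply h2
  intro i
  rw [hh i, pow_succ]
  exact mul_dvd_mul_left _ (PowerSeries.X_dvd_iff.2 (hc i))

theorem not_dvd_sum_monomial_mul_pow (p ν : ℕ) [Fact p.Prime] [CharP k p] {f : k[X][X]}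
    (hf : Prime f) (hfm : f.Monic) {a η : k} (h0 : f.evalEval a η = 0)
    (h1 : f.derivative.evalEval a η ≠ 0) (l : ℕ)
    (G : Fin (l + 1) × Fin f.natDegree → k[X][X]) (hG : ∀ q, (G q).natDegree < f.natDegree)
    (hG0 : G ≠ 0)
    (hν : degIn f * f.natDegree + f.natDegree * l < p ^ ν) :
    ¬ f ∣ ∑ q, monomial q.2.1 (monomial q.1.1 1) * G q ^ p ^ ν := by
  intro hdvd
  obtain ⟨j, hj, hjf, hjC⟩ := exists_branch hfm h0 h1
  obtain ⟨q₀, hq₀⟩ := Function.ne_iff.1 hG0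
  obtain ⟨o, h, hh, q₁, hq₁⟩ := exists_common_X_pow (fun q => j (G q)) q₀
    (branch_ne_zero hf (not_dvd_of_natDegree_lt_monic hfm hq₀ (hG q₀)) hj hjf)
  have hz : ∑ q, j (monomial q.2.1 (monomial q.1.1 1)) * h q ^ p ^ ν = 0 := by
    have : (PowerSeries.X ^ o : PowerSeries k) ^ p ^ ν *
        ∑ q, j (monomial q.2.1 (monomial q.1.1 1)) * h q ^ p ^ ν = 0 := by
      obtain ⟨w, hw⟩ := hdvd
      have := congrArg j hw
      rw [map_mul, hjf, zero_mul, map_sum] at this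
      rw [← this, Finset.mul_sum]
      refine Finset.sum_congr rfl fun q _ => ?_
      rw [map_mul, map_pow, hh q]; ring
    refine (mul_eq_zero.1 this).resolve_left ?_
    exact pow_ne_zero _ (pow_ne_zero _ PowerSeries.X_ne_zero)
  set E := bivOfCoeff (l + 1) f.natDegree
    (fun q => (PowerSeries.constantCoeff (h q)) ^ p ^ ν) with hE
  have hE0 : E ≠ 0 := by
    intro h'
    have := congrFun (bivOfCoeff_eq_zero h') q₁
    exact hq₁ (pow_eq_zero_iff (pow_ne_zero _ (Fact.out : p.Prime).ne_zero) |>.1 this)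
  have hn : f.natDegree = f.natDegree - 1 + 1 := by
    have := hG q₀; omega
  have hEm := bivOfCoeff_mem (l + 1) f.natDegree
    (fun q => (PowerSeries.constantCoeff (h q)) ^ p ^ ν)
  rw [← hE, hn, mem_bivSpace_succ] at hEm
  have hEn : ¬ f ∣ E := not_dvd_of_natDegree_lt_monic hfm hE0 (by omega)
  have hX : (PowerSeries.X ^ (p ^ ν) : PowerSeries k) ∣ j E := by
    have hch : CharP (PowerSeries k) p := by
      exact charP_of_injective_algebraMap (algebraMap k (PowerSeries k)).injective p
    have : j E = - ∑ q, j (monomial q.2.1 (monomial q.1.1 1)) *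
        (h q - PowerSeries.C (PowerSeries.constantCoeff (h q))) ^ p ^ ν := by
      rw [eq_neg_iff_add_eq_zero, ← hz, hE, bivOfCoeff, map_sum, ← Finset.sum_add_distrib]
      refine Finset.sum_congr rfl fun q _ => ?_
      have hm : j (monomial q.2.1 (monomial q.1.1 (PowerSeries.constantCoeff (h q) ^ p ^ ν))) =
          j (monomial q.2.1 (monomial q.1.1 1)) *
            PowerSeries.C (PowerSeries.constantCoeff (h q)) ^ p ^ ν := by
        rw [← map_pow (PowerSeries.C (R := k)), ← hjC, ← map_mul, monomial_mul_C, monomial_mul_C,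
          one_mul]
      rw [sub_pow_char_pow, mul_sub, hm]; ring
    rw [this, dvd_neg]
    refine Finset.dvd_sum fun q _ => Dvd.dvd.mul_left (pow_dvd_pow_of_dvd ?_ _) _
    rw [PowerSeries.X_dvd_iff]; simp
  have := le_of_X_pow_dvd_branch hf hEn hj hjf hX
  have h3 : degIn f * E.natDegree ≤ degIn f * f.natDegree := Nat.mul_le_mul_left _ (by omega)
  have h4 : f.natDegree * degIn E ≤ f.natDegree * l := Nat.mul_le_mul_left _ hEm.1
  omega

end Branch

section Stepanov
variable {k : Type*} [Field k]

theorem exists_ne_zero_apply_mem_of_finrank_lt {M ι : Type*} [AddCommGroup M] [Module k M]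
    [Fintype ι] (e : (ι → k) →ₗ[k] M) (W U : Submodule k M) [FiniteDimensional k W]
    (hU : U ≤ W) (he : ∀ x, e x ∈ W)
    (h : Module.finrank k W < Fintype.card ι + Module.finrank k U) :
    ∃ x, x ≠ 0 ∧ e x ∈ U := by
  by_contra! hc
  have hinj : Function.Injective e := by
    rw [injective_iff_map_eq_zero]
    intro x hx
    by_contra hx0
    exact hc x hx0 (by rw [hx]; exact U.zero_mem)
  have : FiniteDimensional k U := Submodule.finiteDimensional_of_le hU
  have hr : LinearMap.range e ≤ W := by rintro _ ⟨x, rfl⟩; exact he x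
  have h1 := Submodule.finrank_sup_add_finrank_inf_eq (LinearMap.range e) U
  have h2 : LinearMap.range e ⊓ U = ⊥ := by
    rw [eq_bot_iff]
    rintro _ ⟨⟨x, rfl⟩, hx⟩
    by_cases hx0 : x = 0
    · rw [hx0, map_zero]; exact zero_mem _
    · exact absurd hx (hc x hx0)
  have h3 := Submodule.finrank_mono (sup_le hr hU)
  rw [h2, finrank_bot, LinearMap.finrank_range_of_inj hinj,
    Module.finrank_fintype_fun_eq_card] at h1
  omega

theorem degIn_monomial_le (j i : ℕ) (b : k) : degIn (monomial j (monomial i b)) ≤ i := by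
  rw [← C_mul_X_pow_eq_monomial]
  exact (degIn_C_mul_X_pow_le _ _).trans (natDegree_monomial_le _)

/-- The dimension count in Stepanov's method. -/
theorem exists_stepanov_relation {f v : k[X][X]} {D : k[X]} (hfm : f.Monic) (c P m l : ℕ)
    (hfc : degIn f ≤ c) (hvc : degIn v ≤ c) (hvn : v.natDegree ≤ c) (hD : D.natDegree ≤ c)
    (hn : 1 ≤ f.natDegree)
    (hm1 : P < f.natDegree * (m + 1)) (hm2 : f.natDegree * m ≤ P)
    (hl : c * f.natDegree + c * P + c ^ 2 + c + 1 ≤ l) :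
    ∃ x : (Fin (l + 1) × Fin f.natDegree) × (Fin (m + 1) × Fin f.natDegree) → k, x ≠ 0 ∧
      f ∣ ∑ q, x q • ((monomial q.1.2.1 (monomial q.1.1.1 1)) ^ P *
        (C (X ^ q.2.1.1) * v ^ q.2.2.1 * C D ^ (f.natDegree - 1 - q.2.2.1))) := by
  set n := f.natDegree with hnf
  let g : (Fin (l + 1) × Fin n) × (Fin (m + 1) × Fin n) → k[X][X] := fun q =>
    (monomial q.1.2.1 (monomial q.1.1.1 1)) ^ P *
        (C (X ^ q.2.1.1) * v ^ q.2.2.1 * C D ^ (n - 1 - q.2.2.1))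
  set A := P * l + m + c * n + 1 with hA
  set B := P * n + c * n with hB
  have hg : ∀ q, g q ∈ bivSpace k (A + degIn f) (B + n) := by
    rintro ⟨⟨i, j⟩, ⟨i', j'⟩⟩
    have hj := j.2
    have hj' := j'.2
    have hi := i.2
    have hi' := i'.2
    have e1 : P * (j : ℕ) ≤ P * n := Nat.mul_le_mul_left _ hj.le
    have e2 : (j' : ℕ) * c + (n - 1 - j') * c ≤ c * n := by
      rw [← add_mul, mul_comm]; exact Nat.mul_le_mul_left _ (by omega)
    have e3 : P * (i : ℕ) ≤ P * l := Nat.mul_le_mul_left _ (by omega)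
    refine bivSpace_mono (A := A - 1 + 1) (B := B + 1) (by omega) (by omega)
      (mem_bivSpace_succ.2 ⟨?_, ?_⟩)
    · refine (degIn_mul_le _ _).trans ?_
      have h1 := degIn_pow_le (monomial (j : ℕ) (monomial (i : ℕ) (1 : k))) P
      have h2 : P * degIn (monomial (j : ℕ) (monomial (i : ℕ) (1 : k))) ≤ P * i :=
        Nat.mul_le_mul_left _ (degIn_monomial_le _ _ _)
      have h3 := degIn_mul_le (C (X ^ (i' : ℕ)) * v ^ (j' : ℕ)) (C D ^ (n - 1 - j'))
      have h4 := degIn_mul_le (C (X ^ (i' : ℕ))) (v ^ (j' : ℕ))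
      have h5 : degIn (C (X ^ (i' : ℕ)) : k[X][X]) = i' := by rw [degIn_C, natDegree_X_pow]
      have h6 := (degIn_pow_le v j').trans (Nat.mul_le_mul_left _ hvc)
      have h7 : degIn (C D ^ (n - 1 - j')) ≤ (n - 1 - j') * c :=
        (degIn_pow_le (C D) _).trans (Nat.mul_le_mul_left _ (by rw [degIn_C]; exact hD))
      simp only at *
      omega
    · refine natDegree_mul_le.trans ?_
      have h1 : (monomial (j : ℕ) (monomial (i : ℕ) (1 : k)) ^ P).natDegree ≤ P * j :=
        natDegree_pow_le.trans (Nat.mul_le_mul_left _ (natDegree_monomial_le _))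
      have h3 := natDegree_mul_le (p := C (X ^ (i' : ℕ)) * v ^ (j' : ℕ))
        (q := C D ^ (n - 1 - j'))
      have h4 := natDegree_mul_le (p := C (X ^ (i' : ℕ))) (q := (v ^ (j' : ℕ)))
      have h5 : (C (X ^ (i' : ℕ)) : k[X][X]).natDegree = 0 := natDegree_C _
      have h6 : (v ^ (j' : ℕ)).natDegree ≤ j' * c :=
        natDegree_pow_le.trans (Nat.mul_le_mul_left _ hvn)
      have h7 : (C D ^ (n - 1 - j')).natDegree = 0 := by rw [← C_pow, natDegree_C]
      simp only at *
      omega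
  obtain ⟨x, hx0, ⟨y, -, hy⟩⟩ := exists_ne_zero_apply_mem_of_finrank_lt
    (∑ q, (LinearMap.proj q : _ →ₗ[k] k).smulRight (g q)) (bivSpace k (A + degIn f) (B + n))
    ((bivSpace k A B).map (LinearMap.mulLeft k f)) (by
      rintro _ ⟨a, ha, rfl⟩; exact mul_mem_bivSpace hfm.ne_zero ha) (by
      intro x
      rw [LinearMap.sum_apply]
      exact Submodule.sum_mem _ fun q _ => Submodule.smul_mem _ _ (hg q)) (by
      rw [← (Submodule.equivMapOfInjective (LinearMap.mulLeft k f)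
        (mul_right_injective₀ hfm.ne_zero) (bivSpace k A B)).finrank_eq, finrank_bivSpace,
        finrank_bivSpace]
      simp only [Fintype.card_prod, Fintype.card_fin]
      have h1 : n * (l + 1) * (P + 1) ≤ (l + 1) * n * ((m + 1) * n) := by
        calc n * (l + 1) * (P + 1) ≤ n * (l + 1) * (n * (m + 1)) := Nat.mul_le_mul_left _ hm1
          _ = _ := by ring
      have h2 : degIn f * B ≤ c * B := Nat.mul_le_mul_right _ hfc
      have h3 : degIn f * n ≤ c * n := Nat.mul_le_mul_right _ hfc
      have h4 : (A + degIn f) * (B + n) ≤ A * B + A * n + c * B + c * n := by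
        calc _ = A * B + A * n + degIn f * B + degIn f * n := by ring
          _ ≤ _ := by omega
      have h5 : A * n + c * B + c * n < n * (l + 1) * (P + 1) := by
        have e1 : n * (c * n + c * P + c ^ 2 + c + 1) ≤ n * l := Nat.mul_le_mul_left _ hl
        have e2 : n * m ≤ n * P := Nat.mul_le_mul_left _ (by nlinarith)
        have e3 : A * n + c * B + c * n = n * P * l + n * m + c * n * n + n + c * P * n +
          c * c * n + c * n := by rw [hA, hB]; ring
        have e4 : n * (l + 1) * (P + 1) = n * P * l + n * l + n * P + n := by ring
        rw [e3, e4]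
        ring_nf at e1 ⊢
        omega
      omega)
  refine ⟨x, hx0, ⟨y, ?_⟩⟩
  rw [LinearMap.mulLeft_apply, LinearMap.sum_apply] at hy
  rw [hy]; rfl

theorem evalEval_monomial_monomial (j i : ℕ) (b a η : k) :
    (monomial j (monomial i b)).evalEval a η = b * a ^ i * η ^ j := by
  simp [evalEval, eval_monomial]

theorem evalEval_bivOfCoeff (A B : ℕ) (g : Fin A × Fin B → k) (a η : k) :
    (bivOfCoeff A B g).evalEval a η = ∑ q, g q * a ^ (q.1 : ℕ) * η ^ (q.2 : ℕ) := by
  simp only [bivOfCoeff, evalEval_finsetSum, evalEval_monomial_monomial]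

theorem exists_evalEval_eq_zero [IsAlgClosed k] {f : k[X][X]} (hfm : f.Monic)
    (hn : 1 ≤ f.natDegree) (a : k) : ∃ η, f.evalEval a η = 0 := by
  obtain ⟨η, hη⟩ := IsAlgClosed.exists_root (f.map (evalRingHom a)) (by
    rw [hfm.degree_map, degree_eq_natDegree hfm.ne_zero]
    norm_cast; omega)
  exact ⟨η, by rw [← map_evalRingHom_eval]; exact hη⟩

theorem stepanov_eval_eq_zero (p μ ν : ℕ) [Fact p.Prime] [CharP k p] {f v : k[X][X]} {D : k[X]}
    {n l m : ℕ} (x γ : (Fin (l + 1) × Fin n) × (Fin (m + 1) × Fin n) → k)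
    (hγ : ∀ q, γ q ^ p ^ (ν + μ) = x q)
    (hdvd : f ∣ ∑ q, x q • ((monomial q.1.2.1 (monomial q.1.1.1 1)) ^ p ^ μ *
        (C (X ^ q.2.1.1) * v ^ q.2.2.1 * C D ^ (n - 1 - q.2.2.1))))
    {a η : k} (ha : a ^ p ^ (ν + μ) = a) (h0 : f.evalEval a η = 0) (hD : D.eval a ≠ 0)
    (hv : D.eval a * η ^ p ^ (ν + μ) = v.evalEval a η) :
    (∑ q : Fin (l + 1) × Fin n, monomial q.2.1 (monomial q.1.1 1) *
      (bivOfCoeff (m + 1) n fun b => γ (q, b)) ^ p ^ ν).evalEval a η = 0 := by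
  obtain ⟨w, hw⟩ := hdvd
  have h1 := congrArg (evalEval a η) hw
  rw [evalEval_mul, h0, zero_mul, evalEval_finsetSum, Fintype.sum_prod_type] at h1
  refine (pow_eq_zero_iff (pow_ne_zero μ (Fact.out : p.Prime).ne_zero)).1 ?_
  refine (mul_eq_zero.1 (?_ : D.eval a ^ (n - 1) * _ = 0)).resolve_left (pow_ne_zero _ hD)
  rw [← h1, evalEval_finsetSum, sum_pow_char_pow, Finset.mul_sum]
  refine Finset.sum_congr rfl fun q _ => ?_
  rw [evalEval_mul, evalEval_pow, mul_pow, ← pow_mul, ← pow_add, evalEval_bivOfCoeff,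
    sum_pow_char_pow, mul_left_comm, Finset.mul_sum, Finset.mul_sum]
  refine Finset.sum_congr rfl fun b _ => ?_
  have hb := b.2.2
  have e1 : D.eval a ^ (n - 1) = D.eval a ^ (n - 1 - (b.2 : ℕ)) * D.eval a ^ (b.2 : ℕ) := by
    rw [← pow_add]; congr 1; omega
  rw [evalEval_smul, evalEval_mul, evalEval_pow, evalEval_mul, evalEval_mul, evalEval_pow,
    evalEval_pow, evalEval_C, evalEval_C, ← hv, mul_pow, mul_pow, mul_pow, hγ, ← pow_mul a,
    mul_comm (b.1 : ℕ), pow_mul a, ha, e1, eval_pow, eval_X, smul_eq_mul, ← pow_mul, ← pow_mul,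
    mul_comm (b.2 : ℕ)]
  ring

theorem stepanov_card_le [IsAlgClosed k] (p : ℕ) [Fact p.Prime] [CharP k p] (n c N : ℕ)
    (hn : 1 ≤ n) (hN : 1 ≤ N) :
    ∃ r₀ : ℕ, ∀ r ≥ r₀, ∀ (f v : k[X][X]) (D : k[X]), f.Monic → Prime f → f.natDegree = n →
      degIn f ≤ c → degIn v ≤ c → v.natDegree ≤ c → D.natDegree ≤ c → D ≠ 0 →
      (∃ α β, C D = α * f + β * f.derivative) →
      ∀ T : Finset (k × k), (∀ q ∈ T, q.1 ^ p ^ r = q.1 ∧ f.evalEval q.1 q.2 = 0 ∧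
        D.eval q.1 ≠ 0 ∧ D.eval q.1 * q.2 ^ p ^ r = v.evalEval q.1 q.2) →
      N * T.card ≤ (N + 1) * p ^ r := by
  have hp1 : 1 < p := (Fact.out : p.Prime).one_lt
  set μ := 2 * N * (c * n) with hμ
  have hP : 2 * N * (c * n) ≤ p ^ μ := (Nat.lt_pow_self hp1).le
  set m := p ^ μ / n with hm
  set l := c * n + c * p ^ μ + c ^ 2 + c + 1 with hl
  set ν₀ := 2 * N * (c * n + n * l) + 1
  refine ⟨ν₀ + μ, fun r hr f v D hfm hf hfn hfc hvc hvn hDc hD0 hDα T hT => ?_⟩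
  obtain ⟨ν, rfl⟩ : ∃ ν, r = ν + μ := ⟨r - μ, by omega⟩
  have hν : 2 * N * (c * n + n * l) < p ^ ν :=
    lt_of_lt_of_le (by omega : _ < ν) (Nat.lt_pow_self hp1).le
  subst hfn
  obtain ⟨x, hx0, hdvd⟩ := exists_stepanov_relation (D := D) hfm c (p ^ μ) m l hfc hvc hvn hDc hn
    (by rw [hm]; exact Nat.lt_mul_div_succ _ hn) (Nat.mul_div_le _ _) le_rfl
  have hppos : ∀ e, 0 < p ^ e := fun e => pow_pos (by omega) e
  choose γ hγ using fun q => IsAlgClosed.exists_pow_nat_eq (x q) (hppos (ν + μ))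
  set r := ∑ q, monomial q.2.1 (monomial q.1.1 1) *
      (bivOfCoeff (m + 1) f.natDegree fun b => γ (q, b)) ^ p ^ ν with hr
  obtain ⟨a₀, ha₀⟩ : ∃ a, D.eval a ≠ 0 := by
    by_contra! hc
    exact hD0 (Polynomial.funext (by simpa using hc))
  obtain ⟨η₀, hη₀⟩ := exists_evalEval_eq_zero hfm hn a₀
  have hη₁ : f.derivative.evalEval a₀ η₀ ≠ 0 := by
    obtain ⟨α, β, h⟩ := hDα
    have := congrArg (evalEval a₀ η₀) h
    rw [evalEval_add, evalEval_mul, evalEval_mul, hη₀, mul_zero, zero_add, evalEval_C] at this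
    intro h'
    rw [h', mul_zero] at this
    exact ha₀ this
  have hbm : ∀ q, (bivOfCoeff (m + 1) f.natDegree fun b => γ (q, b)) ∈
      bivSpace k (m + 1) (f.natDegree - 1 + 1) := fun q => by
    have := bivOfCoeff_mem (m + 1) f.natDegree (fun b => γ (q, b))
    rwa [Nat.sub_add_cancel hn]
  have hNl : c * f.natDegree + f.natDegree * l < p ^ ν :=
    lt_of_le_of_lt (Nat.le_mul_of_pos_left _ (by omega)) hν
  have hfr : ¬ f ∣ r := by
    refine not_dvd_sum_monomial_mul_pow p ν hf hfm hη₀ hη₁ l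
      (fun q => bivOfCoeff (m + 1) f.natDegree fun b => γ (q, b)) (fun q => ?_) ?_ ?_
    · have := (mem_bivSpace_succ.1 (hbm q)).2
      omega
    · intro h
      apply hx0
      ext ⟨q, b⟩
      have := congrFun (bivOfCoeff_eq_zero (congrFun h q)) b
      simp only [Pi.zero_apply] at this ⊢
      rw [← hγ, this, zero_pow (hppos _).ne']
    · have : degIn f * f.natDegree ≤ c * f.natDegree := Nat.mul_le_mul_right _ hfc
      omega
  have hcard := card_commonZeros_le hf hfr T (fun q hq => by
    obtain ⟨h1, h2, h3, h4⟩ := hT q hq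
    exact ⟨h2, stepanov_eval_eq_zero p μ ν x γ hγ hdvd h1 h2 h3 h4⟩)
  have hr1 : r.natDegree ≤ f.natDegree + p ^ ν * f.natDegree := by
    refine natDegree_sum_le_of_forall_le _ _ fun q _ => natDegree_mul_le.trans ?_
    refine add_le_add ((natDegree_monomial_le _).trans q.2.2.le) (natDegree_pow_le.trans ?_)
    exact Nat.mul_le_mul_left _ ((mem_bivSpace_succ.1 (hbm q)).2.trans (by omega))
  have hr2 : degIn r ≤ l + p ^ ν * m := by
    refine degIn_sum_le _ _ _ fun q _ => (degIn_mul_le _ _).trans ?_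
    refine add_le_add ((degIn_monomial_le _ _ _).trans (by omega)) ((degIn_pow_le _ _).trans ?_)
    exact Nat.mul_le_mul_left _ (mem_bivSpace_succ.1 (hbm q)).1
  have hnm : f.natDegree * m ≤ p ^ μ := Nat.mul_div_le _ _
  set n := f.natDegree
  have h1 : T.card ≤ c * (n + p ^ ν * n) + n * (l + p ^ ν * m) :=
    hcard.trans (add_le_add (Nat.mul_le_mul hfc hr1) (Nat.mul_le_mul_left _ hr2))
  have h2 : p ^ ν * (n * m) ≤ p ^ ν * p ^ μ := Nat.mul_le_mul_left _ hnm
  have h3 : p ^ ν * (2 * N * (c * n)) ≤ p ^ ν * p ^ μ := Nat.mul_le_mul_left _ hP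
  have h4 : 2 * N * (c * n + n * l) ≤ p ^ ν * p ^ μ :=
    hν.le.trans (Nat.le_mul_of_pos_right _ (hppos _))
  rw [pow_add]
  set Q' := p ^ ν
  set P := p ^ μ
  have h5 : T.card ≤ c * n + n * l + Q' * (c * n) + Q' * P := by nlinarith
  nlinarith

end Stepanov

section BertiniNoether

/-- The difference between `F` and the product of two generic polynomials. -/
noncomputable def genericProductSub {R : Type*} [CommRing R] (A B : ℕ) (F : R[X][X]) :
    (MvPolynomial (Bool × Fin A × Fin B) R)[X][X] :=
  bivOfCoeff A B (fun q => MvPolynomial.X (true, q)) *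
    bivOfCoeff A B (fun q => MvPolynomial.X (false, q)) - F.map (mapRingHom MvPolynomial.C)

theorem map_genericProductSub {R S : Type*} [CommRing R] [CommRing S] (A B : ℕ) (F : R[X][X])
    (Ψ : MvPolynomial (Bool × Fin A × Fin B) R →+* S) :
    (genericProductSub A B F).map (mapRingHom Ψ) =
      bivOfCoeff A B (fun q => Ψ (MvPolynomial.X (true, q))) *
        bivOfCoeff A B (fun q => Ψ (MvPolynomial.X (false, q))) -
          F.map (mapRingHom (Ψ.comp MvPolynomial.C)) := by
  rw [genericProductSub, Polynomial.map_sub, Polynomial.map_mul, map_bivOfCoeff, map_bivOfCoeff,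
    Polynomial.map_map, mapRingHom_comp]

theorem exists_finset_forall_not_mul_eq {E : Type*} [Field E] [IsAlgClosed E] {f : E[X][X]}
    (A B : ℕ) (hf : ∀ g ∈ bivSpace E A B, ∀ h ∈ bivSpace E A B, g * h ≠ f) :
    ∃ s : Finset E, ∀ (R : Type*) [CommRing R] (ι : R →+* E), Function.Injective ι →
      (s : Set E) ⊆ Set.range ι → ∀ F : R[X][X], F.map (mapRingHom ι) = f →
      ∀ (Ω : Type*) [Field Ω] (φ : R →+* Ω), ∀ g ∈ bivSpace Ω A B, ∀ h ∈ bivSpace Ω A B,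
        g * h ≠ F.map (mapRingHom φ) := by
  classical
  let e : ℕ × ℕ → MvPolynomial (Bool × Fin A × Fin B) E :=
    fun q => ((genericProductSub A B f).coeff q.2).coeff q.1
  have htop : Ideal.span (Set.range e) = ⊤ := by
    rw [← Ideal.radical_eq_top, ← MvPolynomial.vanishingIdeal_zeroLocus_eq_radical (K := E),
      MvPolynomial.zeroLocus_span]
    convert MvPolynomial.vanishingIdeal_empty
    rw [Set.eq_empty_iff_forall_notMem]
    intro x hx
    have h0 : (genericProductSub A B f).map (mapRingHom (MvPolynomial.eval x)) = 0 := by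
      ext j i
      have := hx (e (i, j)) ⟨_, rfl⟩
      rw [MvPolynomial.aeval_eq_eval] at this
      simpa [e] using this
    rw [map_genericProductSub, sub_eq_zero] at h0
    refine hf _ (bivOfCoeff_mem _ _ _) _ (bivOfCoeff_mem _ _ _) (h0.trans ?_)
    have : (MvPolynomial.eval x).comp MvPolynomial.C = RingHom.id E := by ext; simp
    rw [this]; simp
  have h1 : (1 : MvPolynomial (Bool × Fin A × Fin B) E) ∈ Ideal.span (Set.range e) := by
    rw [htop]; trivial
  obtain ⟨c, hc⟩ := Finsupp.mem_span_range_iff_exists_finsupp.1 h1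
  refine ⟨c.support.biUnion fun q => (c q).coeffs, fun R _ ι hι hs F hF Ω _ φ g hg h hh hgh => ?_⟩
  have hlift : ∀ q, ∃ b : MvPolynomial (Bool × Fin A × Fin B) R, MvPolynomial.map ι b = c q := by
    intro q
    by_cases hq : q ∈ c.support
    · refine MvPolynomial.mem_range_map_iff_coeffs_subset.2 (subset_trans ?_ hs)
      intro x hx
      exact Finset.mem_coe.2 (Finset.mem_biUnion.2 ⟨q, hq, hx⟩)
    · exact ⟨0, by rw [Finsupp.notMem_support_iff.1 hq, map_zero]⟩
  choose b hb using hlift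
  let e' : ℕ × ℕ → MvPolynomial (Bool × Fin A × Fin B) R :=
    fun q => ((genericProductSub A B F).coeff q.2).coeff q.1
  have he' : ∀ q, MvPolynomial.map ι (e' q) = e q := by
    intro q
    have : (genericProductSub A B F).map (mapRingHom (MvPolynomial.map ι)) =
        genericProductSub A B f := by
      rw [map_genericProductSub, genericProductSub]
      have : (MvPolynomial.map ι).comp (MvPolynomial.C (σ := Bool × Fin A × Fin B)) =
        MvPolynomial.C.comp ι := by ext; simp
      rw [this, ← hF, Polynomial.map_map, mapRingHom_comp]
      simp
    simp only [e', e, ← this, coeff_map, coe_mapRingHom]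
  have h2 : ∑ q ∈ c.support, b q * e' q = 1 := by
    apply MvPolynomial.map_injective ι hι
    rw [map_sum, map_one, ← hc, Finsupp.sum]
    exact Finset.sum_congr rfl fun q _ => by rw [map_mul, hb, he', smul_eq_mul]
  let Ψ : MvPolynomial (Bool × Fin A × Fin B) R →+* Ω := MvPolynomial.eval₂Hom φ
    (fun q => if q.1 then (g.coeff q.2.2).coeff q.2.1 else (h.coeff q.2.2).coeff q.2.1)
  have h3 : (genericProductSub A B F).map (mapRingHom Ψ) = 0 := by
    rw [map_genericProductSub]
    have hΨ : Ψ.comp MvPolynomial.C = φ := by ext; simp [Ψ]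
    have e1 := bivOfCoeff_coeff hg
    have e2 := bivOfCoeff_coeff hh
    simp only [hΨ, Ψ, MvPolynomial.coe_eval₂Hom, MvPolynomial.eval₂_X, if_true]
    rw [e1, ← hgh]
    simp [e2]
  have h4 := congrArg Ψ h2
  rw [map_sum, map_one, Finset.sum_eq_zero] at h4
  · exact zero_ne_one h4
  · intro q _
    have := congrArg (fun G => (G.coeff q.2).coeff q.1) h3
    simp only [coeff_map, coe_mapRingHom, coeff_zero] at this
    rw [map_mul, this, mul_zero]

/-- The Bertini–Noether theorem for monic plane curves. -/
theorem exists_finset_irreducible_map {E : Type*} [Field E] [IsAlgClosed E] {f : E[X][X]}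
    (hfm : f.Monic) (hf : Irreducible f) :
    ∃ s : Finset E, ∀ (R : Type*) [CommRing R] (ι : R →+* E), Function.Injective ι →
      (s : Set E) ⊆ Set.range ι → ∀ F : R[X][X], F.Monic → F.map (mapRingHom ι) = f →
      ∀ (Ω : Type*) [Field Ω] (φ : R →+* Ω), Irreducible (F.map (mapRingHom φ)) := by
  have hn : 1 ≤ f.natDegree := by
    by_contra! h
    rw [hfm.natDegree_eq_zero.1 (by omega)] at hf
    exact not_irreducible_one hf
  obtain ⟨s, hs⟩ := exists_finset_forall_not_mul_eq (f := f) (degIn f + 1) f.natDegree (by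
    intro g hg h hh hgh
    have hn' : f.natDegree = f.natDegree - 1 + 1 := by omega
    rw [hn', mem_bivSpace_succ] at hg hh
    have h0 : g ≠ 0 ∧ h ≠ 0 := by
      constructor <;> rintro rfl <;> simp [hfm.ne_zero.symm] at hgh
    have hd := natDegree_mul h0.1 h0.2
    rw [hgh] at hd
    rcases hf.isUnit_or_isUnit hgh.symm with h1 | h1
    · have := natDegree_eq_zero_of_isUnit h1; omega
    · have := natDegree_eq_zero_of_isUnit h1; omega)
  refine ⟨s, fun R _ ι hι hsR F hFm hF Ω _ φ => ?_⟩
  have hdeg : (F.map (mapRingHom φ)).natDegree = f.natDegree := by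
    rw [hFm.natDegree_map, ← hF, hFm.natDegree_map]
  have hdegIn : degIn (F.map (mapRingHom φ)) ≤ degIn f := by
    refine (mem_bivSpace_succ (B := f.natDegree).1 ?_).1
    rw [mem_bivSpace_iff_coeff]
    intro i j hij
    refine mem_bivSpace_iff_coeff.1 (self_mem_bivSpace f) i j ?_
    intro h0
    apply hij
    rw [← hF, coeff_map, coe_mapRingHom, coeff_map, map_eq_zero_iff ι hι] at h0
    rw [coeff_map, coe_mapRingHom, coeff_map, h0, map_zero]
  have hm := hFm.map (mapRingHom φ)
  rw [hm.irreducible_iff_natDegree']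
  constructor
  · intro h
    rw [h, natDegree_one] at hdeg
    omega
  · intro g h hg hh hgh hmem
    rw [Finset.mem_Ioc, hdeg] at hmem
    have hd := hg.natDegree_mul hh
    have hdi := degIn_mul hg.ne_zero hh.ne_zero
    rw [hgh] at hd hdi
    have hn' : f.natDegree = f.natDegree - 1 + 1 := by omega
    refine hs R ι hι hsR F hF Ω φ g ?_ h ?_ hgh <;>
      (rw [hn', mem_bivSpace_succ]; omega)

end BertiniNoether

section Counting
variable {k : Type*} [Field k]

theorem card_filter_pow_eq_self (p r : ℕ) [Fact p.Prime] [CharP k p] [IsAlgClosed k]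
    (hr : 1 ≤ r) :
    ∃ S : Finset k, (∀ a, a ∈ S ↔ a ^ p ^ r = a) ∧ S.card = p ^ r := by
  classical
  have hp1 : 1 < p := (Fact.out : p.Prime).one_lt
  have hpr : 1 < p ^ r := Nat.one_lt_pow (by omega) hp1
  have hne : (X ^ p ^ r - X : k[X]) ≠ 0 := FiniteField.X_pow_card_sub_X_ne_zero k hpr
  have hsep : (X ^ p ^ r - X : k[X]).Separable :=
    galois_poly_separable p _ (dvd_pow_self p (by omega))
  refine ⟨(X ^ p ^ r - X : k[X]).roots.toFinset, fun a => ?_, ?_⟩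
  · rw [Multiset.mem_toFinset, mem_roots hne]
    simp [sub_eq_zero]
  · rw [Multiset.toFinset_card_of_nodup (nodup_roots hsep),
      ← (IsAlgClosed.splits _).natDegree_eq_card_roots,
      FiniteField.X_pow_card_sub_X_natDegree_eq k hpr]

/-- Few elements of a field with `p ^ r` elements lie in a proper subfield. -/
theorem card_le_of_not_primitive (p r : ℕ) [Fact p.Prime] [CharP k p]
    (S : Finset k) (hS : ∀ a ∈ S, a ^ p ^ r = a ∧ ∃ s, 0 < s ∧ s < r ∧ a ^ p ^ s = a) :
    S.card ≤ 2 * p ^ (r / 2) := by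
  classical
  have hp1 : 1 < p := (Fact.out : p.Prime).one_lt
  have hex : ∀ a ∈ S, ∃ d, 1 ≤ d ∧ d ≤ r / 2 ∧ a ^ p ^ d = a := by
    intro a ha
    obtain ⟨h1, s, hs0, hsr, h2⟩ := hS a ha
    have hper : ∀ s, a ^ p ^ s = a ↔ Function.IsPeriodicPt (frobenius k p) s a := by
      intro s
      rw [Function.IsPeriodicPt, Function.IsFixedPt, iterate_frobenius]
    have hg : a ^ p ^ (r.gcd s) = a := (hper _).2 (((hper _).1 h1).gcd ((hper _).1 h2))
    refine ⟨r.gcd s, Nat.gcd_pos_of_pos_right _ hs0, ?_, hg⟩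
    obtain ⟨m, hm⟩ := Nat.gcd_dvd_left r s
    have hle := Nat.gcd_le_right r hs0
    rw [Nat.le_div_iff_mul_le (by norm_num)]
    have : 2 ≤ m := by
      by_contra! hc
      interval_cases m <;> omega
    calc r.gcd s * 2 ≤ r.gcd s * m := Nat.mul_le_mul_left _ this
      _ = r := hm.symm
  have hsub : S ⊆ (Finset.Icc 1 (r / 2)).biUnion
      fun d => (X ^ p ^ d - X : k[X]).roots.toFinset := by
    intro a ha
    obtain ⟨d, hd1, hd2, hd3⟩ := hex a ha
    refine Finset.mem_biUnion.2 ⟨d, Finset.mem_Icc.2 ⟨hd1, hd2⟩, ?_⟩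
    rw [Multiset.mem_toFinset, mem_roots
      (FiniteField.X_pow_card_sub_X_ne_zero k (Nat.one_lt_pow (by omega) hp1))]
    simp [hd3]
  have hcard : S.card ≤ ∑ d ∈ Finset.Icc 1 (r / 2), p ^ d := by
    refine (Finset.card_le_card hsub).trans (Finset.card_biUnion_le.trans ?_)
    refine Finset.sum_le_sum fun d hd => ?_
    rw [Finset.mem_Icc] at hd
    refine (Multiset.toFinset_card_le _).trans ((card_roots' _).trans ?_)
    rw [FiniteField.X_pow_card_sub_X_natDegree_eq k (Nat.one_lt_pow (by omega) hp1)]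
  refine hcard.trans ?_
  have : ∀ M, ∑ d ∈ Finset.Icc 1 M, p ^ d ≤ 2 * p ^ M := by
    intro M
    induction M with
    | zero => simp
    | succ M ih =>
      rw [Finset.sum_Icc_succ_top (by omega), pow_succ]
      nlinarith [pow_pos (by omega : 0 < p) M]
  exact this _

theorem card_roots_specialization [IsAlgClosed k] {f : k[X][X]} (hfm : f.Monic) {a : k}
    (hsep : ∀ η, f.evalEval a η = 0 → f.derivative.evalEval a η ≠ 0) :
    ∃ S : Finset k, (∀ η, η ∈ S ↔ f.evalEval a η = 0) ∧ S.card = f.natDegree := by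
  classical
  set g := f.map (evalRingHom a) with hg
  have hgm : g.Monic := hfm.map _
  have hev : ∀ η, g.eval η = f.evalEval a η := fun η => map_evalRingHom_eval _ _ _
  have hnd : g.roots.Nodup := by
    rw [Multiset.nodup_iff_count_le_one]
    intro η
    rw [count_roots]
    by_contra! hc
    have h0 : g.IsRoot η ∧ g.derivative.IsRoot η :=
      (one_lt_rootMultiplicity_iff_isRoot hgm.ne_zero).1 hc
    refine hsep η ?_ ?_
    · rw [← hev]; exact h0.1
    · have := h0.2
      rw [hg, derivative_map, IsRoot, map_evalRingHom_eval] at this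
      exact this
  refine ⟨g.roots.toFinset, fun η => ?_, ?_⟩
  · rw [Multiset.mem_toFinset, mem_roots hgm.ne_zero, IsRoot, hev]
  · rw [Multiset.toFinset_card_of_nodup hnd,
      ← (IsAlgClosed.splits _).natDegree_eq_card_roots, hfm.natDegree_map]

/-- Points on a curve over a large finite field with a prescribed Frobenius action and with
primitive abscissa. -/
theorem exists_point_frobenius_eq [IsAlgClosed k] (p : ℕ) [Fact p.Prime] [CharP k p] (n c : ℕ)
    (hn : 1 ≤ n) :
    ∃ r₀ : ℕ, ∀ r ≥ r₀, ∀ (f : k[X][X]) (D : k[X]), f.Monic → Prime f → f.natDegree = n →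
      degIn f ≤ c → D.natDegree ≤ c → D ≠ 0 →
      (∃ α β, C D = α * f + β * f.derivative) →
      ∀ {ι : Type*} (I : Finset ι) (v : ι → k[X][X]), I.card ≤ n →
      (∀ i ∈ I, degIn (v i) ≤ c ∧ (v i).natDegree ≤ c) →
      (∀ a η, a ^ p ^ r = a → f.evalEval a η = 0 → D.eval a ≠ 0 →
        ∃ i ∈ I, D.eval a * η ^ p ^ r = (v i).evalEval a η) →
      ∀ i₀ ∈ I, ∃ a η, a ^ p ^ r = a ∧ f.evalEval a η = 0 ∧ D.eval a ≠ 0 ∧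
        D.eval a * η ^ p ^ r = (v i₀).evalEval a η ∧ ∀ s, 0 < s → a ^ p ^ s = a → r ≤ s := by
  classical
  have hp1 : 1 < p := (Fact.out : p.Prime).one_lt
  obtain ⟨r₁, hr₁⟩ := stepanov_card_le (k := k) p n c (2 * n) hn (by omega)
  set M := 4 * n ^ 2 + 2 * n ^ 2 * c with hM
  refine ⟨max r₁ (2 * M + 2), fun r hr f D hfm hf hfn hfc hDc hD hDα ι I v hI hv hpt i₀ hi₀ => ?_⟩
  have hrr₁ : r₁ ≤ r := le_trans (le_max_left _ _) hr
  have hrM : 2 * M + 2 ≤ r := le_trans (le_max_right _ _) hr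
  obtain ⟨S₀, hS₀, hS₀c⟩ := card_filter_pow_eq_self (k := k) p r (by omega)
  set S := S₀.filter (fun a => D.eval a ≠ 0) with hS
  have hSc : p ^ r ≤ S.card + c := by
    have h1 := Finset.card_filter_add_card_filter_not (s := S₀) (fun a => D.eval a ≠ 0)
    have h2 : (S₀.filter (fun a => ¬ D.eval a ≠ 0)).card ≤ c := by
      refine le_trans (Finset.card_le_card (t := D.roots.toFinset) ?_)
        ((Multiset.toFinset_card_le _).trans ((card_roots' _).trans hDc))
      intro a ha
      rw [Finset.mem_filter] at ha
      rw [Multiset.mem_toFinset, mem_roots hD]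
      exact not_not.1 ha.2
    rw [← hS] at h1
    omega
  have hSmem : ∀ a, a ∈ S ↔ a ^ p ^ r = a ∧ D.eval a ≠ 0 := by
    intro a; rw [hS, Finset.mem_filter, hS₀]
  have hsep : ∀ a ∈ S, ∀ η, f.evalEval a η = 0 → f.derivative.evalEval a η ≠ 0 := by
    intro a ha η h0 h1
    obtain ⟨α, β, h⟩ := hDα
    have := congrArg (evalEval a η) h
    rw [evalEval_add, evalEval_mul, evalEval_mul, h0, h1, mul_zero, mul_zero, zero_add,
      evalEval_C] at this
    exact ((hSmem a).1 ha).2 this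
  have hR : ∀ a, ∃ Z : Finset k, (a ∈ S → (∀ η, η ∈ Z ↔ f.evalEval a η = 0) ∧ Z.card = n) := by
    intro a
    by_cases ha : a ∈ S
    · obtain ⟨Z, hZ⟩ := card_roots_specialization hfm (hsep a ha)
      exact ⟨Z, fun _ => ⟨hZ.1, hZ.2.trans hfn⟩⟩
    · exact ⟨∅, fun h => absurd h ha⟩
  choose Z hZ using hR
  let T : Finset (k × k) := S.biUnion fun a => (Z a).image fun η => (a, η)
  have hTmem : ∀ q, q ∈ T ↔ q.1 ∈ S ∧ f.evalEval q.1 q.2 = 0 := by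
    rintro ⟨a, η⟩
    simp only [T, Finset.mem_biUnion, Finset.mem_image, Prod.mk.injEq]
    constructor
    · rintro ⟨b, hb, ζ, hζ, rfl, rfl⟩
      exact ⟨hb, ((hZ b hb).1 _).1 hζ⟩
    · rintro ⟨h1, h2⟩
      exact ⟨a, h1, η, ((hZ a h1).1 _).2 h2, rfl, rfl⟩
  have hTc : T.card = S.card * n := by
    rw [Finset.card_biUnion]
    · rw [Finset.sum_congr rfl fun a ha => by
        rw [Finset.card_image_of_injective _ (Prod.mk_right_injective a), (hZ a ha).2],
        Finset.sum_const, smul_eq_mul]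
    · intro a _ b _ hab
      rw [Function.onFun, Finset.disjoint_left]
      rintro ⟨u, w⟩ h1 h2
      simp only [Finset.mem_image, Prod.mk.injEq] at h1 h2
      obtain ⟨_, _, rfl, _⟩ := h1
      obtain ⟨_, _, rfl, _⟩ := h2
      exact hab rfl
  let Ti : ι → Finset (k × k) := fun i =>
    T.filter fun q => D.eval q.1 * q.2 ^ p ^ r = (v i).evalEval q.1 q.2
  have hTi : ∀ i ∈ I, 2 * n * (Ti i).card ≤ (2 * n + 1) * p ^ r := by
    intro i hi
    refine hr₁ r hrr₁ f (v i) D hfm hf hfn hfc (hv i hi).1 (hv i hi).2 hDc hD hDα (Ti i) ?_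
    intro q hq
    rw [Finset.mem_filter, hTmem, hSmem] at hq
    exact ⟨hq.1.1.1, hq.1.2, hq.1.1.2, hq.2⟩
  have hcover : T ⊆ Ti i₀ ∪ (I.erase i₀).biUnion Ti := by
    intro q hq
    have hq' := (hTmem q).1 hq
    have hq'' := (hSmem _).1 hq'.1
    obtain ⟨i, hi, h⟩ := hpt q.1 q.2 hq''.1 hq'.2 hq''.2
    by_cases hii : i = i₀
    · subst hii
      exact Finset.mem_union_left _ (Finset.mem_filter.2 ⟨hq, h⟩)
    · refine Finset.mem_union_right _ (Finset.mem_biUnion.2 ⟨i, ?_, ?_⟩)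
      · exact Finset.mem_erase.2 ⟨hii, hi⟩
      · exact Finset.mem_filter.2 ⟨hq, h⟩
  have hsum : 2 * n * ((I.erase i₀).biUnion Ti).card ≤ (n - 1) * ((2 * n + 1) * p ^ r) := by
    calc _ ≤ 2 * n * ∑ i ∈ I.erase i₀, (Ti i).card := Nat.mul_le_mul_left _ Finset.card_biUnion_le
      _ = ∑ i ∈ I.erase i₀, 2 * n * (Ti i).card := Finset.mul_sum _ _ _
      _ ≤ ∑ i ∈ I.erase i₀, (2 * n + 1) * p ^ r :=
        Finset.sum_le_sum fun i hi => hTi i (Finset.mem_of_mem_erase hi)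
      _ = (I.card - 1) * ((2 * n + 1) * p ^ r) := by
        rw [Finset.sum_const, Finset.card_erase_of_mem hi₀, smul_eq_mul]
      _ ≤ _ := Nat.mul_le_mul_right _ (by omega)
  have hTle := (Finset.card_le_card hcover).trans (Finset.card_union_le _ _)
  by_contra! hcon
  have hproj : (Ti i₀).card ≤ n * (2 * p ^ (r / 2)) := by
    set S' := S.filter (fun a => ∃ s, 0 < s ∧ s < r ∧ a ^ p ^ s = a) with hS'
    have hS'c : S'.card ≤ 2 * p ^ (r / 2) := by
      refine card_le_of_not_primitive p r S' fun a ha => ?_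
      rw [hS', Finset.mem_filter, hSmem] at ha
      exact ⟨ha.1.1, ha.2⟩
    have hsub : Ti i₀ ⊆ S'.biUnion fun a => (Z a).image fun η => (a, η) := by
      rintro ⟨a, η⟩ hq
      rw [Finset.mem_filter, hTmem] at hq
      obtain ⟨⟨h1, h2⟩, h3⟩ := hq
      have h4 := (hSmem _).1 h1
      obtain ⟨s, hs⟩ := hcon a η h4.1 h2 h4.2 h3
      refine Finset.mem_biUnion.2 ⟨a, Finset.mem_filter.2 ⟨h1, s, hs.1, hs.2.2, hs.2.1⟩, ?_⟩
      exact Finset.mem_image.2 ⟨η, ((hZ a h1).1 _).2 h2, rfl⟩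
    calc _ ≤ _ := Finset.card_le_card hsub
      _ ≤ ∑ a ∈ S', ((Z a).image fun η => (a, η)).card := Finset.card_biUnion_le
      _ ≤ ∑ a ∈ S', n := Finset.sum_le_sum fun a ha => Finset.card_image_le.trans
          (hZ a (Finset.mem_of_mem_filter a ha)).2.le
      _ = S'.card * n := by rw [Finset.sum_const, smul_eq_mul]
      _ ≤ _ := by rw [mul_comm]; exact Nat.mul_le_mul_left _ hS'c
  have hbig : M < p ^ (r / 2) := lt_of_lt_of_le (by omega : M < r / 2) (Nat.lt_pow_self hp1).le
  have hsq : p ^ (r / 2) * p ^ (r / 2) ≤ p ^ r := by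
    rw [← pow_add]; exact Nat.pow_le_pow_right (by omega) (by omega)
  rw [hTc] at hTle
  obtain ⟨n', rfl⟩ : ∃ n', n = n' + 1 := ⟨n - 1, by omega⟩
  rw [Nat.add_sub_cancel] at hsum
  set Q := p ^ r
  set H := p ^ (r / 2)
  have h1 : 2 * (n' + 1) * (S.card * (n' + 1)) ≤
      2 * (n' + 1) * (Ti i₀).card + n' * ((2 * (n' + 1) + 1) * Q) := by
    calc _ ≤ 2 * (n' + 1) * ((Ti i₀).card + ((I.erase i₀).biUnion Ti).card) :=
          Nat.mul_le_mul_left _ hTle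
      _ ≤ _ := by rw [mul_add]; exact Nat.add_le_add_left hsum _
  have h2 : 2 * (n' + 1) * (Ti i₀).card ≤ 2 * (n' + 1) * ((n' + 1) * (2 * H)) :=
    Nat.mul_le_mul_left _ hproj
  have h3 : 2 * (n' + 1) * ((n' + 1) * Q) ≤ 2 * (n' + 1) * ((n' + 1) * (S.card + c)) :=
    Nat.mul_le_mul_left _ (Nat.mul_le_mul_left _ hSc)
  have hH : 0 < H := lt_of_le_of_lt (Nat.zero_le _) hbig
  have h4 : M * H < H * H := Nat.mul_lt_mul_of_pos_right hbig hH
  have h5 : 2 * (n' + 1) ^ 2 * c * 1 ≤ 2 * (n' + 1) ^ 2 * c * H :=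
    Nat.mul_le_mul_left _ hH
  have h6 : 0 ≤ n' * Q := Nat.zero_le _
  rw [hM] at h4
  nlinarith

end Counting

section BivariateEvaluation

/-- Two ring homomorphisms `π`, `θ` to fields with `ker π ≤ ker θ` induce a homomorphism on a
subring of the first field, defined on all quotients whose denominator is not killed by `θ`. -/
theorem exists_subring_hom {A U Ω : Type*} [CommRing A] [Field U] [Field Ω] (π : A →+* U)
    (θ : A →+* Ω) (h : ∀ g, π g = 0 → θ g = 0) :
    ∃ (B : Subring U) (φ : B →+* Ω), ∀ g s, θ s ≠ 0 →
      ∃ h : π g / π s ∈ B, φ ⟨_, h⟩ = θ g / θ s := by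
  set M : Submonoid A := (nonZeroDivisors Ω).comap θ with hM
  have hMθ : ∀ s : M, IsUnit (θ s) := fun s => IsUnit.mk0 _ (nonZeroDivisors.ne_zero s.2)
  have hMπ : ∀ s : M, IsUnit (π s) := fun s =>
    IsUnit.mk0 _ fun h0 => nonZeroDivisors.ne_zero s.2 (h _ h0)
  set π' : Localization M →+* U := IsLocalization.lift hMπ
  set θ' : Localization M →+* Ω := IsLocalization.lift hMθ
  have hπ' : ∀ g (s : M), π' (IsLocalization.mk' _ g s) = π g / π s := fun g s => by
    rw [eq_div_iff (hMπ s).ne_zero, ← IsLocalization.lift_eq (S := Localization M) hMπ (s : A),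
      ← map_mul,
      IsLocalization.mk'_spec, IsLocalization.lift_eq]
  have hθ' : ∀ g (s : M), θ' (IsLocalization.mk' _ g s) = θ g / θ s := fun g s => by
    rw [eq_div_iff (hMθ s).ne_zero, ← IsLocalization.lift_eq (S := Localization M) hMθ (s : A),
      ← map_mul,
      IsLocalization.mk'_spec, IsLocalization.lift_eq]
  have hker : RingHom.ker π'.rangeRestrict ≤ RingHom.ker θ' := by
    intro x hx
    rw [RingHom.ker_rangeRestrict, RingHom.mem_ker] at hx
    obtain ⟨g, s, rfl⟩ := IsLocalization.exists_mk'_eq M x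
    rw [hπ', div_eq_zero_iff, or_iff_left (hMπ s).ne_zero] at hx
    rw [RingHom.mem_ker, hθ', h g hx, zero_div]
  refine ⟨π'.range, RingHom.liftOfSurjective π'.rangeRestrict π'.rangeRestrict_surjective
    ⟨θ', hker⟩, fun g s hs => ?_⟩
  have hsM : s ∈ M := mem_nonZeroDivisors_iff_ne_zero.2 hs
  have h1 := hπ' g ⟨s, hsM⟩
  refine ⟨⟨_, h1⟩, ?_⟩
  have h2 : (⟨π g / π s, ⟨_, h1⟩⟩ : π'.range) =
      π'.rangeRestrict (IsLocalization.mk' _ g ⟨s, hsM⟩) := Subtype.ext h1.symm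
  rw [h2, RingHom.liftOfSurjective_comp_apply]
  exact hθ' g ⟨s, hsM⟩

/-- Evaluation of a bivariate polynomial along a homomorphism of coefficient rings: the
inner variable is sent to `t`, the outer one to `y`. -/
noncomputable def biEval {R S : Type*} [CommRing R] [CommRing S] (ι : R →+* S) (t y : S) :
    R[X][X] →+* S := eval₂RingHom (eval₂RingHom ι t) y

variable {R S T : Type*} [CommRing R] [CommRing S] [CommRing T]

@[simp] theorem biEval_C (ι : R →+* S) (t y : S) (q : R[X]) :
    biEval ι t y (C q) = q.eval₂ ι t := by simp [biEval]

@[simp] theorem biEval_X (ι : R →+* S) (t y : S) : biEval ι t y X = y := by simp [biEval]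

theorem biEval_eq (ι : R →+* S) (t y : S) (G : R[X][X]) :
    biEval ι t y G = (G.map (eval₂RingHom ι t)).eval y := by
  rw [eval_map]; rfl

theorem biEval_map (ι : R →+* S) (t y : S) (φ : T →+* R) (G : T[X][X]) :
    biEval ι t y (G.map (mapRingHom φ)) = biEval (ι.comp φ) t y G := by
  have : (biEval ι t y).comp (mapRingHom (mapRingHom φ)) = biEval (ι.comp φ) t y := by
    ext <;> simp [biEval]
  exact RingHom.congr_fun this G

theorem map_biEval (ι : R →+* S) (t y : S) (σ : S →+* T) (G : R[X][X]) :
    σ (biEval ι t y G) = biEval (σ.comp ι) (σ t) (σ y) G := by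
  have : σ.comp (biEval ι t y) = biEval (σ.comp ι) (σ t) (σ y) := by
    ext <;> simp [biEval]
  exact RingHom.congr_fun this G

theorem biEval_id (a η : R) (G : R[X][X]) : biEval (RingHom.id R) a η G = G.evalEval a η := by
  have : biEval (RingHom.id R) a η = evalEvalRingHom a η := by
    ext <;> simp [biEval]
  exact RingHom.congr_fun this G

theorem biEval_eq_evalEval (φ : R →+* S) (a η : S) (G : R[X][X]) :
    biEval φ a η G = (G.map (mapRingHom φ)).evalEval a η := by
  rw [← biEval_id, biEval_map, RingHom.id_comp]

end BivariateEvaluation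

/-- The ideal of a point `(t, y)` with `t` transcendental and `y` integral over `E[t]` is
generated by an irreducible monic polynomial. -/
theorem exists_monic_prime_biEval {E U : Type*} [Field E] [Field U] {ι : E →+* U} {t y : U}
    (ht : ∀ q : E[X], q.eval₂ ι t = 0 → q = 0) {g : E[X][X]} (hg : g.Monic)
    (hgy : biEval ι t y g = 0) :
    ∃ f : E[X][X], f.Monic ∧ Prime f ∧ biEval ι t y f = 0 ∧
      ∀ G, biEval ι t y G = 0 → f ∣ G := by
  classical
  have hex : ∃ n, ∃ f : E[X][X], f.Monic ∧ biEval ι t y f = 0 ∧ f.natDegree = n :=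
    ⟨_, g, hg, hgy, rfl⟩
  obtain ⟨f, hfm, hfy, hfn⟩ := Nat.find_spec hex
  have hmin : ∀ h : E[X][X], h.Monic → biEval ι t y h = 0 → f.natDegree ≤ h.natDegree :=
    fun h h1 h2 => hfn.le.trans (Nat.find_min' hex ⟨h, h1, h2, rfl⟩)
  have hirr : Irreducible f := by
    rw [hfm.irreducible_iff_natDegree']
    refine ⟨fun h1 => by simp [h1] at hfy, fun a b ha hb hab hmem => ?_⟩
    rw [Finset.mem_Ioc] at hmem
    have hdeg : a.natDegree + b.natDegree = f.natDegree := by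
      rw [← hab, ha.natDegree_mul hb]
    rw [← hab, map_mul, mul_eq_zero] at hfy
    rcases hfy with h | h
    · have := hmin a ha h; omega
    · have := hmin b hb h; omega
  refine ⟨f, hfm, hirr.prime, hfy, fun G hG => ?_⟩
  by_contra hdvd
  obtain ⟨R, hR, -, α, β, h⟩ := exists_resultant hirr.prime hdvd
  refine hR (ht R ?_)
  rw [← biEval_C (y := y), h, map_add, map_mul, map_mul, hfy, hG]
  simp

/-- A set `C` of elements of a field has Frobenius points for the self-map `σ` if every finite
subset of `C` can be specialized, so that `σ` specializes to arbitrarily large powers of the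
Frobenius. -/
def FrobeniusPoints (p : ℕ) (Ω : Type*) [Field Ω] {U : Type*} [Field U] (σ : U → U)
    (C : Set U) : Prop :=
  ∀ X : Finset U, (X : Set U) ⊆ C → ∀ N, ∃ r ≥ N, ∃ (B : Subring U) (φ : B →+* Ω)
    (hX : ∀ x ∈ X, x ∈ B), ∀ x (hx : x ∈ X) (hσ : σ x ∈ X),
      φ ⟨σ x, hX _ hσ⟩ = φ ⟨x, hX _ hx⟩ ^ p ^ r

theorem exists_mem_bivSpace {k : Type*} [Field k] (P : k[X][X]) :
    ∃ A, ∀ A' ≥ A, P ∈ bivSpace k (A' + 1) (A' + 1) :=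
  ⟨max (degIn P) P.natDegree, fun _ h => mem_bivSpace_succ.2
    ⟨(le_max_left _ _).trans h, (le_max_right _ _).trans h⟩⟩

section Reduction
variable {E Ω : Type*} [Field E] [Field Ω]

theorem exists_map_subtype_eq {R : Subring E} {P : E[X][X]}
    (h : ∀ i j, (P.coeff j).coeff i ∈ R) :
    ∃ P' : R[X][X], P'.map (mapRingHom R.subtype) = P := by
  obtain ⟨A, hA⟩ := exists_mem_bivSpace P
  refine ⟨bivOfCoeff (A + 1) (A + 1) fun q => ⟨_, h q.1 q.2⟩, ?_⟩
  rw [map_bivOfCoeff]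
  exact bivOfCoeff_coeff (hA A le_rfl)

theorem coeff_coeff_map {R S : Type*} [CommRing R] [CommRing S] (φ : R →+* S) (P : R[X][X])
    (i j : ℕ) :
    ((P.map (mapRingHom φ)).coeff j).coeff i = φ ((P.coeff j).coeff i) := by
  simp

theorem map_mapRingHom_injective {R S : Type*} [CommRing R] [CommRing S] {φ : R →+* S}
    (hφ : Function.Injective φ) :
    Function.Injective (Polynomial.map (mapRingHom φ)) :=
  map_injective _ (map_injective _ hφ)

theorem map_mem_bivSpace {R : Subring E} (φ : R →+* Ω) {P : R[X][X]} {A B : ℕ}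
    (h : P.map (mapRingHom R.subtype) ∈ bivSpace E A B) :
    P.map (mapRingHom φ) ∈ bivSpace Ω A B := by
  rw [mem_bivSpace_iff_coeff] at *
  intro i j hij
  refine h i j fun h0 => hij ?_
  rw [coeff_coeff_map] at h0 ⊢
  rw [Subtype.ext (a1 := (P.coeff j).coeff i) (a2 := 0) h0, map_zero]

theorem FrobeniusPoints.exists_reduction {p : ℕ} [Fact p.Prime] [CharP Ω p] {τ : E →+* E}
    (hE : FrobeniusPoints p Ω τ Set.univ) (X₀ : Finset E) (Ps : Finset E[X][X]) (N : ℕ) :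
    ∃ r ≥ N, ∃ (R : Subring E) (φ : R →+* Ω), (∀ x ∈ X₀, x ∈ R) ∧ ∀ P ∈ Ps,
      ∃ P₁ P₂ : R[X][X], P₁.map (mapRingHom R.subtype) = P ∧
        P₂.map (mapRingHom R.subtype) = P.map (mapRingHom τ) ∧
        P₂.map (mapRingHom φ) =
          (P₁.map (mapRingHom φ)).map (mapRingHom (iterateFrobenius Ω p r)) := by
  classical
  set X₁ : Finset E := Ps.biUnion fun P => insert 0 (P.support.biUnion fun j =>
    (P.coeff j).support.image (P.coeff j).coeff) with hX₁
  have hmem : ∀ P ∈ Ps, ∀ i j, (P.coeff j).coeff i ∈ X₁ := by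
    intro P hP i j
    refine Finset.mem_biUnion.2 ⟨P, hP, ?_⟩
    by_cases h0 : (P.coeff j).coeff i = 0
    · rw [h0]; exact Finset.mem_insert_self _ _
    · refine Finset.mem_insert_of_mem (Finset.mem_biUnion.2 ⟨j, ?_, ?_⟩)
      · rw [mem_support_iff]; rintro h; rw [h] at h0; simp at h0
      · exact Finset.mem_image.2 ⟨i, mem_support_iff.2 h0, rfl⟩
  obtain ⟨r, hr, R, φ, hR, hφ⟩ := hE (X₀ ∪ (X₁ ∪ X₁.image τ)) (Set.subset_univ _) N
  refine ⟨r, hr, R, φ, fun x hx => hR x (Finset.mem_union_left _ hx), fun P hP => ?_⟩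
  have h1 : ∀ x ∈ X₁, x ∈ X₀ ∪ (X₁ ∪ X₁.image τ) := fun x hx =>
    Finset.mem_union_right _ (Finset.mem_union_left _ hx)
  have h2 : ∀ x ∈ X₁, τ x ∈ X₀ ∪ (X₁ ∪ X₁.image τ) := fun x hx =>
    Finset.mem_union_right _ (Finset.mem_union_right _ (Finset.mem_image_of_mem _ hx))
  obtain ⟨P₁, hP₁⟩ := exists_map_subtype_eq (R := R) (P := P) fun i j => hR _ (h1 _ (hmem P hP i j))
  obtain ⟨P₂, hP₂⟩ := exists_map_subtype_eq (R := R) (P := P.map (mapRingHom τ)) fun i j => by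
    rw [coeff_coeff_map]; exact hR _ (h2 _ (hmem P hP i j))
  refine ⟨P₁, P₂, hP₁, hP₂, ?_⟩
  ext j i
  rw [coeff_coeff_map, coeff_coeff_map, coeff_coeff_map, iterateFrobenius_def]
  have e1 : (P₁.coeff j).coeff i = ⟨(P.coeff j).coeff i, hR _ (h1 _ (hmem P hP i j))⟩ := by
    refine Subtype.ext ?_
    refine Eq.trans ?_ (congrArg (fun F : E[X][X] => (F.coeff j).coeff i) hP₁)
    exact (coeff_coeff_map R.subtype P₁ i j).symm
  have e2 : (P₂.coeff j).coeff i = ⟨τ ((P.coeff j).coeff i), hR _ (h2 _ (hmem P hP i j))⟩ := by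
    refine Subtype.ext ?_
    refine Eq.trans ?_ ((congrArg (fun F : E[X][X] => (F.coeff j).coeff i) hP₂).trans
      (coeff_coeff_map τ P i j))
    exact (coeff_coeff_map R.subtype P₂ i j).symm
  rw [e1, e2]
  exact hφ _ (h1 _ (hmem P hP i j)) (h2 _ (hmem P hP i j))

end Reduction

theorem exists_mem_bivSpace_finset {k : Type*} [Field k] (Ps : Finset k[X][X]) :
    ∃ c, ∀ P ∈ Ps, P ∈ bivSpace k (c + 1) (c + 1) := by
  choose A hA using fun P : k[X][X] => exists_mem_bivSpace P
  exact ⟨Ps.sup A, fun P hP => hA P _ (Finset.le_sup hP)⟩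

theorem evalEval_map_iterateFrobenius {k : Type*} [Field k] (p r : ℕ) [Fact p.Prime] [CharP k p]
    (G : k[X][X]) (a η : k) :
    (G.map (mapRingHom (iterateFrobenius k p r))).evalEval (a ^ p ^ r) (η ^ p ^ r) =
      G.evalEval a η ^ p ^ r := by
  have h := map_biEval (RingHom.id k) a η (iterateFrobenius k p r) G
  rw [RingHom.comp_id, biEval_id, biEval_eq_evalEval] at h
  simpa only [iterateFrobenius_def] using h.symm

theorem exists_subring_hom_of_dvd {E U Ω : Type*} [Field E] [Field U] [Field Ω] {ι : E →+* U}
    {t y : U} {R : Subring E} {φ₁ : R →+* Ω} {f : R[X][X]} (hfm : f.Monic)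
    (hf : ∀ G, biEval ι t y G = 0 → f.map (mapRingHom R.subtype) ∣ G)
    {a η : Ω} (hη : biEval φ₁ a η f = 0) :
    ∃ (B : Subring U) (φ : B →+* Ω) (j : R →+* B), B.subtype.comp j = ι.comp R.subtype ∧
      φ.comp j = φ₁ ∧ (∃ h : t ∈ B, φ ⟨t, h⟩ = a) ∧ (∃ h : y ∈ B, φ ⟨y, h⟩ = η) ∧
      ∀ G s : R[X][X], biEval φ₁ a η s ≠ 0 → ∀ z,
        biEval (ι.comp R.subtype) t y s * z = biEval (ι.comp R.subtype) t y G →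
        ∃ h : z ∈ B, biEval φ₁ a η s * φ ⟨z, h⟩ = biEval φ₁ a η G := by
  have hinj : Function.Injective (mapRingHom R.subtype) := map_injective _ R.subtype_injective
  have hker : ∀ G, biEval (ι.comp R.subtype) t y G = 0 → biEval φ₁ a η G = 0 := by
    intro G hG
    rw [← biEval_map] at hG
    have := hf _ hG
    rw [map_dvd_map _ hinj hfm] at this
    obtain ⟨H, rfl⟩ := this
    rw [map_mul, hη, zero_mul]
  obtain ⟨B, φ, hB⟩ := exists_subring_hom _ _ hker
  have hone : biEval φ₁ a η 1 ≠ 0 := by simp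
  have hc : ∀ c : R, ∃ h : ι c ∈ B, φ ⟨_, h⟩ = φ₁ c := by
    intro c
    have := hB (C (C c)) 1 hone
    simpa using this
  refine ⟨B, φ, (ι.comp R.subtype).codRestrict B fun c => (hc c).1, rfl, ?_, ?_, ?_, ?_⟩
  · ext c; exact (hc c).2
  · simpa using hB (C X) 1 hone
  · simpa using hB X 1 hone
  · intro G s hs z hz
    obtain ⟨h1, h2⟩ := hB G s hs
    have hs' : biEval (ι.comp R.subtype) t y s ≠ 0 := fun h => hs (hker s h)
    have h3 : biEval (ι.comp R.subtype) t y G / biEval (ι.comp R.subtype) t y s = z := by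
      rw [div_eq_iff hs', ← hz, mul_comm]
    refine ⟨h3 ▸ h1, ?_⟩
    have h4 : (⟨z, h3 ▸ h1⟩ : B) = ⟨_, h1⟩ := Subtype.ext h3.symm
    rw [h4, h2, mul_div_cancel₀ _ hs]

/-- Frobenius points of the constants of a curve extend to Frobenius points of the curve, with
primitive abscissa. -/
theorem FrobeniusPoints.exists_of_curve (p : ℕ) [Fact p.Prime] {E U Ω : Type*} [Field E]
    [Field U] [Field Ω] [IsAlgClosed E] [IsAlgClosed Ω] [CharP Ω p] {ι : E →+* U} {τ : E →+* E}
    {σ : U →+* U} (hσι : σ.comp ι = ι.comp τ) (hE : FrobeniusPoints p Ω τ Set.univ)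
    {t y : U} (ht : ∀ q : E[X], q.eval₂ ι t = 0 → q = 0) (hσt : σ t = t)
    {g : E[X][X]} (hg : g.Monic) (hgτ : g.map (mapRingHom τ) = g) (hgy : biEval ι t y g = 0)
    (hgy' : biEval ι t y g.derivative ≠ 0) (hsplit : (g.map (eval₂RingHom ι t)).Splits)
    {D : E[X]} (hD : D ≠ 0) (S : Finset U) (hS : ∀ z, biEval ι t z g = 0 → z ∈ S)
    (u : U → E[X][X]) (hu : ∀ z ∈ S, D.eval₂ ι t * z = biEval ι t y (u z)) (N : ℕ) :
    ∃ r ≥ N, ∃ (B : Subring U) (φ : B →+* Ω) (hB : ∀ x ∈ S, x ∈ B) (htB : t ∈ B),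
      (∀ x (hx : x ∈ S) (hσ : σ x ∈ S), φ ⟨σ x, hB _ hσ⟩ = φ ⟨x, hB _ hx⟩ ^ p ^ r) ∧
      φ ⟨t, htB⟩ ^ p ^ r = φ ⟨t, htB⟩ ∧
      ∀ s, 0 < s → φ ⟨t, htB⟩ ^ p ^ s = φ ⟨t, htB⟩ → r ≤ s := by
  classical
  obtain ⟨f, hfm, hfp, hfy, hf⟩ := exists_monic_prime_biEval ht hg hgy
  have hfg := hf g hgy
  have hfτg : f.map (mapRingHom τ) ∣ g := by
    rw [← hgτ]; exact Polynomial.map_dvd _ hfg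
  have hfy' : ¬ f ∣ f.derivative := by
    intro h
    obtain ⟨q, hq⟩ := hfg
    obtain ⟨q', hq'⟩ := h
    apply hgy'
    rw [hq, derivative_mul, hq', map_add, map_mul, map_mul, map_mul, hfy]
    simp
  obtain ⟨D₀, hD₀, -, α, β, hα⟩ := exists_resultant hfp hfy'
  have hn : 1 ≤ f.natDegree := by
    rw [Nat.one_le_iff_ne_zero]
    intro h0
    rw [hfm.natDegree_eq_zero.1 h0] at hfp
    exact hfp.not_isUnit isUnit_one
  have hD' : D₀ * D ≠ 0 := mul_ne_zero hD₀ hD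
  -- the conjugates of `y` with respect to the twisted equation
  set m := ((f.map (mapRingHom τ)).map (eval₂RingHom ι t)).roots with hm
  have hfτm : ((f.map (mapRingHom τ)).map (eval₂RingHom ι t)).Monic := (hfm.map _).map _
  have hfτs : ((f.map (mapRingHom τ)).map (eval₂RingHom ι t)).Splits :=
    hsplit.of_dvd (hg.map _).ne_zero (Polynomial.map_dvd _ hfτg)
  have hprod : (f.map (mapRingHom τ)).map (eval₂RingHom ι t) =
      (m.map fun z => X - C z).prod := by
    have := hfτs.eq_prod_roots
    rwa [hfτm.leadingCoeff, C_1, one_mul] at this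
  have hmcard : m.card = f.natDegree := by
    rw [hm, ← hfτs.natDegree_eq_card_roots, (hfm.map _).natDegree_map, hfm.natDegree_map]
  have hmem : ∀ z, z ∈ m ↔ biEval ι t z (f.map (mapRingHom τ)) = 0 := by
    intro z
    rw [hm, mem_roots hfτm.ne_zero, IsRoot, biEval_eq]
  have hmS : ∀ z ∈ m, z ∈ S := by
    intro z hz
    rw [hmem] at hz
    apply hS
    obtain ⟨q, hq⟩ := hfτg
    rw [hq, map_mul, hz, zero_mul]
  have hσb : ∀ G, σ (biEval ι t y G) = biEval ι t (σ y) (G.map (mapRingHom τ)) := by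
    intro G
    rw [map_biEval, hσι, hσt, biEval_map]
  have hσy : σ y ∈ m := by rw [hmem, ← hσb, hfy, map_zero]
  have hyS : y ∈ S := hS y hgy
  -- reduction of constants
  obtain ⟨s, hs⟩ := exists_finset_irreducible_map hfm hfp.irreducible
  set Ps : Finset E[X][X] := {f, C (D₀ * D), C D * α, C D * β} ∪ S.image fun z => C D₀ * u z
  obtain ⟨c, hc⟩ := exists_mem_bivSpace_finset Ps
  obtain ⟨r₀, hr₀⟩ := exists_point_frobenius_eq (k := Ω) p f.natDegree c hn
  obtain ⟨r, hr, R, φ₁, hR, hred⟩ :=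
    hE.exists_reduction (insert (D₀ * D).leadingCoeff⁻¹ s) Ps (max N r₀)
  have hfPs : f ∈ Ps := by simp [Ps]
  have hDPs : C (D₀ * D) ∈ Ps := by simp [Ps]
  have hαPs : C D * α ∈ Ps := by simp [Ps]
  have hβPs : C D * β ∈ Ps := by simp [Ps]
  have huPs : ∀ z ∈ S, C D₀ * u z ∈ Ps := fun z hz => by
    refine Finset.mem_union_right _ (Finset.mem_image_of_mem (fun z => C D₀ * u z) hz)
  clear_value Ps
  choose! P₁ P₂ hP₁ hP₂ hP using hred
  have hinj := R.subtype_injective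
  have hinj' : Function.Injective (mapRingHom R.subtype) := map_injective _ hinj
  have hfm₁ : (P₁ f).Monic := by
    apply hinj'.monic_map_iff.2
    rw [hP₁ f hfPs]; exact hfm
  have hPC : P₁ (C (D₀ * D)) = C ((P₁ (C (D₀ * D))).coeff 0) := by
    apply map_mapRingHom_injective hinj
    rw [map_C]
    have := hP₁ _ hDPs
    have h2 : (map (mapRingHom R.subtype) (P₁ (C (D₀ * D)))).coeff 0 = D₀ * D := by
      rw [this, coeff_C_zero]
    rw [coeff_map] at h2
    rw [h2, this]
  set D₁ := (P₁ (C (D₀ * D))).coeff 0 with hD₁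
  have hD₁m : D₁.map R.subtype = D₀ * D := by
    have := hP₁ _ hDPs
    rw [hPC, map_C] at this
    exact C_injective this
  have hD₁ne : D₁.map φ₁ ≠ 0 := by
    intro h0
    have hlc : R.subtype D₁.leadingCoeff = (D₀ * D).leadingCoeff := by
      rw [← hD₁m, leadingCoeff_map_of_injective hinj]
    have h1 : D₁.leadingCoeff * ⟨_, hR _ (Finset.mem_insert_self _ _)⟩ = 1 := by
      apply hinj
      rw [map_mul, hlc, map_one]
      exact mul_inv_cancel₀ (leadingCoeff_ne_zero.2 hD')
    have h2 := congrArg φ₁ h1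
    rw [map_mul, map_one, leadingCoeff, ← coeff_map, h0, coeff_zero, zero_mul] at h2
    exact zero_ne_one h2
  have hdeg : ∀ P ∈ Ps, degIn ((P₁ P).map (mapRingHom φ₁)) ≤ c ∧
      ((P₁ P).map (mapRingHom φ₁)).natDegree ≤ c := by
    intro P hPP
    refine mem_bivSpace_succ.1 (map_mem_bivSpace φ₁ ?_)
    rw [hP₁ P hPP]; exact hc P hPP
  have hfp₁ : Prime ((P₁ f).map (mapRingHom φ₁)) := by
    refine (hs R R.subtype hinj ?_ (P₁ f) hfm₁ (hP₁ f hfPs) Ω φ₁).prime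
    intro x hx
    exact ⟨⟨x, hR x (Finset.mem_insert_of_mem hx)⟩, rfl⟩
  have hαβ : C (D₁.map φ₁) = (P₁ (C D * α)).map (mapRingHom φ₁) * (P₁ f).map (mapRingHom φ₁) +
      (P₁ (C D * β)).map (mapRingHom φ₁) * ((P₁ f).map (mapRingHom φ₁)).derivative := by
    have h1 : C D₁ = P₁ (C D * α) * P₁ f + P₁ (C D * β) * (P₁ f).derivative := by
      apply map_mapRingHom_injective hinj
      rw [Polynomial.map_add, Polynomial.map_mul, Polynomial.map_mul, ← derivative_map,
        hP₁ _ hfPs, hP₁ _ hαPs, hP₁ _ hβPs, map_C, coe_mapRingHom, hD₁m, mul_comm D₀, C_mul, hα]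
      ring
    have h2 := congrArg (Polynomial.map (mapRingHom φ₁)) h1
    rwa [Polynomial.map_add, Polynomial.map_mul, Polynomial.map_mul, ← derivative_map,
      map_C, coe_mapRingHom] at h2
  have hcomp : ∀ P ∈ Ps, ∀ a η : Ω, a ^ p ^ r = a →
      biEval φ₁ a (η ^ p ^ r) (P₂ P) = biEval φ₁ a η (P₁ P) ^ p ^ r := by
    intro P hPP a η ha
    rw [biEval_eq_evalEval, hP P hPP, biEval_eq_evalEval, ← evalEval_map_iterateFrobenius, ha]
  have hDev : ∀ a η : Ω, biEval φ₁ a η (P₁ (C (D₀ * D))) = (D₁.map φ₁).eval a := by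
    intro a η
    rw [hPC, biEval_C, eval_map]
  have hP₁t : ∀ P ∈ Ps, ∀ z, biEval (ι.comp R.subtype) t z (P₁ P) = biEval ι t z P := by
    intro P hPP z
    rw [← biEval_map, hP₁ P hPP]
  have hP₂t : ∀ P ∈ Ps, ∀ z, biEval (ι.comp R.subtype) t z (P₂ P) =
      biEval ι t z (P.map (mapRingHom τ)) := by
    intro P hPP z
    rw [← biEval_map, hP₂ P hPP]
  have huD : ∀ z ∈ S, biEval ι t y (C (D₀ * D)) * z = biEval ι t y (C D₀ * u z) := by
    intro z hz
    rw [C_mul, map_mul, map_mul, biEval_C (q := D), mul_assoc, hu z hz]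
  have key : ∀ a η : Ω, a ^ p ^ r = a → ((P₁ f).map (mapRingHom φ₁)).evalEval a η = 0 →
      (D₁.map φ₁).eval a ≠ 0 →
      ∃ (B : Subring U) (φ : B →+* Ω) (j : R →+* B), B.subtype.comp j = ι.comp R.subtype ∧
        φ.comp j = φ₁ ∧ ∃ (htB : t ∈ B) (hB : ∀ z ∈ S, z ∈ B), φ ⟨t, htB⟩ = a ∧
        φ ⟨y, hB y hyS⟩ = η ∧
        (∀ z (hz : z ∈ S), (D₁.map φ₁).eval a * φ ⟨z, hB z hz⟩ =
          ((P₁ (C D₀ * u z)).map (mapRingHom φ₁)).evalEval a η) ∧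
        ∃ z, ∃ (hz : z ∈ m), η ^ p ^ r = φ ⟨z, hB z (hmS z hz)⟩ := by
    intro a η ha hη hDa
    rw [← biEval_eq_evalEval] at hη
    obtain ⟨B, φ, j, hj, hφj, ⟨htB, hta⟩, ⟨hyB, hyη⟩, hBG⟩ :=
      exists_subring_hom_of_dvd (ι := ι) (t := t) (y := y) hfm₁
        (by rw [hP₁ f hfPs]; exact hf) hη
    have hBz : ∀ z ∈ S, ∃ h : z ∈ B, (D₁.map φ₁).eval a * φ ⟨z, h⟩ =
          ((P₁ (C D₀ * u z)).map (mapRingHom φ₁)).evalEval a η := by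
      intro z hz
      have := hBG (P₁ (C D₀ * u z)) (P₁ (C (D₀ * D))) (by rwa [hDev]) z
        (by rw [hP₁t _ (huPs z hz), hP₁t _ hDPs, huD z hz])
      rwa [hDev, biEval_eq_evalEval] at this
    refine ⟨B, φ, j, hj, hφj, htB, fun z hz => (hBz z hz).1, hta, hyη,
      fun z hz => (hBz z hz).2, ?_⟩
    set zB : U → B := fun z => if h : z ∈ B then ⟨z, h⟩ else 0 with hzB
    have hzB' : ∀ z ∈ S, B.subtype (zB z) = z := by
      intro z hz
      rw [hzB]; simp only; rw [dif_pos (hBz z hz).1]; rfl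
    have hPB : (P₂ f).map (eval₂RingHom j ⟨t, htB⟩) = (m.map fun z => X - C (zB z)).prod := by
      apply map_injective _ B.subtype_injective
      rw [Polynomial.map_multiset_prod, Multiset.map_map, Polynomial.map_map]
      have e1 : B.subtype.comp (eval₂RingHom j ⟨t, htB⟩) =
          (eval₂RingHom ι t).comp (mapRingHom R.subtype) := by
        ext x
        · simpa using RingHom.congr_fun hj x
        · simp
      rw [e1, ← Polynomial.map_map, hP₂ f hfPs, hprod]
      congr 1
      refine Multiset.map_congr rfl fun z hz => ?_
      simp [hzB' z (hmS z hz)]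
    have h1 := congrArg (fun F : B[X] => (F.map φ).eval (η ^ p ^ r)) hPB
    have e2 : φ.comp (eval₂RingHom j ⟨t, htB⟩) = eval₂RingHom φ₁ a := by
      ext x
      · simpa using RingHom.congr_fun hφj x
      · simpa using hta
    simp only [Polynomial.map_map, e2] at h1
    rw [← biEval_eq, hcomp f hfPs a η ha, hη, zero_pow (pow_pos (Fact.out : p.Prime).pos r).ne',
      Polynomial.map_multiset_prod, eval_multiset_prod, Multiset.map_map, Multiset.map_map] at h1
    obtain ⟨z, hz, hz0⟩ := Multiset.mem_map.1 (Multiset.prod_eq_zero_iff.1 h1.symm)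
    refine ⟨z, hz, ?_⟩
    simp only [Function.comp_apply, Polynomial.map_sub, map_X, map_C, eval_sub, eval_X, eval_C,
      sub_eq_zero] at hz0
    rw [hz0]
    congr 1
    exact Subtype.ext (hzB' z (hmS z hz))
  obtain ⟨a, η, ha, hη, hDa, hση, hprim⟩ := hr₀ r ((le_max_right _ _).trans hr)
    ((P₁ f).map (mapRingHom φ₁)) (D₁.map φ₁) (hfm₁.map _) hfp₁
    (by rw [hfm₁.natDegree_map, ← hP₁ f hfPs, hfm₁.natDegree_map, hP₁ f hfPs]) (hdeg f hfPs).1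
    (by
      have := (hdeg _ hDPs).1
      rwa [hPC, map_C, degIn_C] at this)
    hD₁ne ⟨_, _, hαβ⟩ m.toFinset (fun z => (P₁ (C D₀ * u z)).map (mapRingHom φ₁))
    ((Multiset.toFinset_card_le m).trans hmcard.le)
    (fun z hz => hdeg _ (huPs z (hmS z (Multiset.mem_toFinset.1 hz))))
    (by
      intro a η ha hη hDa
      obtain ⟨B, φ, j, hj, hφj, htB, hB, hta, hyη, hz, z, hzm, hzη⟩ := key a η ha hη hDa
      exact ⟨z, Multiset.mem_toFinset.2 hzm, by
        rw [hzη]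
        exact hz z (hmS z hzm)⟩)
    (σ y) (Multiset.mem_toFinset.2 hσy)
  obtain ⟨B, φ, j, hj, hφj, htB, hB, hta, hyη, hz, -⟩ := key a η ha hη hDa
  refine ⟨r, (le_max_left _ _).trans hr, B, φ, hB, htB, fun x hx hσx => ?_, by rw [hta, ha],
    by rwa [hta]⟩
  have hσyη : φ ⟨σ y, hB _ (hmS _ hσy)⟩ = η ^ p ^ r :=
    mul_left_cancel₀ hDa ((hz _ (hmS _ hσy)).trans hση.symm)
  have hUB : ∀ P ∈ Ps, (biEval j ⟨t, htB⟩ ⟨σ y, hB _ (hmS _ hσy)⟩ (P₂ P) : U) =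
      σ (biEval ι t y P) := by
    intro P hPP
    rw [hσb, ← hP₂t P hPP, ← hj]
    exact map_biEval j _ _ B.subtype _
  have hφB : ∀ P ∈ Ps, φ (biEval j ⟨t, htB⟩ ⟨σ y, hB _ (hmS _ hσy)⟩ (P₂ P)) =
      biEval φ₁ a η (P₁ P) ^ p ^ r := by
    intro P hPP
    rw [map_biEval, hφj, hta, hσyη, hcomp P hPP a η ha]
  have h1 : biEval j ⟨t, htB⟩ ⟨σ y, hB _ (hmS _ hσy)⟩ (P₂ (C (D₀ * D))) * ⟨σ x, hB _ hσx⟩ =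
      biEval j ⟨t, htB⟩ ⟨σ y, hB _ (hmS _ hσy)⟩ (P₂ (C D₀ * u x)) := by
    apply Subtype.ext
    rw [Subring.coe_mul, hUB _ hDPs, hUB _ (huPs x hx), ← map_mul, huD x hx]
  have h2 := congrArg φ h1
  rw [map_mul, hφB _ hDPs, hφB _ (huPs x hx), hDev, biEval_eq_evalEval φ₁, ← hz x hx,
    mul_pow] at h2
  exact mul_left_cancel₀ (pow_ne_zero _ hDa) h2

section Primitive
variable {A K U : Type*} [CommRing A] [IsDomain A] [Field K] [Field U] [Algebra A K]
  [IsFractionRing A K] [Algebra K U] [Algebra A U] [IsScalarTower A K U]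

open scoped IntermediateField in
/-- Finitely many separable elements lie in a Galois extension generated by a single integral
element. -/
theorem exists_integral_primitive [IsAlgClosed U] (X : Finset U)
    (hX : ∀ x ∈ X, IsSeparable K x) :
    ∃ y : U, IsSeparable K y ∧ IsIntegral A y ∧ (∀ x ∈ X, x ∈ K⟮y⟯) ∧
      ∀ z, aeval z (minpoly K y) = 0 → z ∈ K⟮y⟯ := by
  classical
  set P : K[X] := ∏ x ∈ X, minpoly K x with hP
  have hP0 : P ≠ 0 := Finset.prod_ne_zero_iff.2 fun x hx => minpoly.ne_zero (hX x hx).isIntegral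
  set F := IntermediateField.adjoin K (P.rootSet U) with hF
  have hsf : IsSplittingField K F P :=
    IntermediateField.adjoin_rootSet_isSplittingField (IsAlgClosed.splits _)
  have hnormal : Normal K F := Normal.of_isSplittingField P
  have hfd : FiniteDimensional K F := IsSplittingField.finiteDimensional F P
  have hsep : Algebra.IsSeparable K F := by
    rw [IntermediateField.isSeparable_adjoin_iff_isSeparable]
    intro z hz
    rw [mem_rootSet, hP, map_prod, Finset.prod_eq_zero_iff] at hz
    obtain ⟨-, x, hx, hxz⟩ := hz
    exact (hX x hx).of_dvd (minpoly.dvd _ _ hxz)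
  have hXF : ∀ x ∈ X, x ∈ F := by
    intro x hx
    refine IntermediateField.subset_adjoin _ _ ?_
    rw [mem_rootSet]
    refine ⟨hP0, ?_⟩
    rw [hP, map_prod, Finset.prod_eq_zero_iff]
    exact ⟨x, hx, minpoly.aeval _ _⟩
  obtain ⟨α, hα⟩ := Field.exists_primitive_element K F
  have hαalg : IsAlgebraic A (α : U) := by
    rw [IsFractionRing.isAlgebraic_iff A K U]
    exact ((Algebra.IsSeparable.isSeparable K α).isIntegral.isAlgebraic).algebraMap
  obtain ⟨a, ha, h_int⟩ := hαalg.exists_integral_multiple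
  have ha' : algebraMap A K a ≠ 0 := by
    rwa [Ne, IsFractionRing.to_map_eq_zero_iff]
  have hFα : K⟮(α : U)⟯ = F := by
    rw [← IntermediateField.lift_adjoin_simple, hα, IntermediateField.lift_top]
  have hFy : K⟮a • (α : U)⟯ = F := by
    refine Eq.trans ?_ hFα
    have h1 : a • (α : U) = algebraMap A K a • (α : U) := by rw [algebraMap_smul]
    rw [h1]
    apply le_antisymm
    · rw [IntermediateField.adjoin_simple_le_iff]
      exact IntermediateField.smul_mem _ (IntermediateField.mem_adjoin_simple_self K _)
    · rw [IntermediateField.adjoin_simple_le_iff]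
      have := IntermediateField.smul_mem _
        (IntermediateField.mem_adjoin_simple_self K (algebraMap A K a • (α : U)))
        (x := (algebraMap A K a)⁻¹)
      rwa [smul_smul, inv_mul_cancel₀ ha', one_smul] at this
  have hyF : a • (α : U) ∈ F :=
    hFy.le (IntermediateField.mem_adjoin_simple_self K _)
  refine ⟨a • (α : U), ?_, h_int, fun x hx => hFy.ge (hXF x hx), fun z hz => ?_⟩
  · have h2 := Algebra.IsSeparable.isSeparable K (⟨_, hyF⟩ : F)
    rw [IsSeparable, ← minpoly.algHom_eq F.val F.val.injective] at h2
    exact h2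
  · refine hFy.ge ?_
    have h2 := Normal.splits hnormal (⟨_, hyF⟩ : F)
    have h3 : minpoly K (⟨_, hyF⟩ : F) = minpoly K (a • (α : U)) :=
      (minpoly.algHom_eq F.val F.val.injective ⟨_, hyF⟩).symm
    rw [h3, IntermediateField.splits_iff_mem (IsAlgClosed.splits _)] at h2
    refine h2 z ?_
    rw [mem_rootSet]
    refine ⟨fun h0 => ?_, hz⟩
    rw [← h3] at h0
    exact minpoly.ne_zero (Algebra.IsSeparable.isSeparable K (⟨_, hyF⟩ : F)).isIntegral h0

open scoped IntermediateField in
theorem exists_denominator {y : U} (hy : IsAlgebraic K y) {z : U} (hz : z ∈ K⟮y⟯) :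
    ∃ D : A, D ≠ 0 ∧ ∃ u : A[X], algebraMap A U D * z = aeval y u := by
  rw [← IntermediateField.mem_toSubalgebra,
    IntermediateField.adjoin_simple_toSubalgebra_of_isAlgebraic hy,
    Algebra.adjoin_singleton_eq_range_aeval] at hz
  obtain ⟨P, rfl⟩ := hz
  obtain ⟨b, hb, h⟩ := IsLocalization.integerNormalization_spec (nonZeroDivisors A) P
  refine ⟨b, nonZeroDivisors.ne_zero hb, IsLocalization.integerNormalization (nonZeroDivisors A) P,
    ?_⟩
  rw [← aeval_map_algebraMap K, h]
  rw [← algebraMap_smul K b P, map_smul, Algebra.smul_def, IsScalarTower.algebraMap_apply A K U]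
  rfl

theorem exists_common_denominator {y : U} (S : Finset U)
    (hS : ∀ z ∈ S, ∃ D : A, D ≠ 0 ∧ ∃ u : A[X], algebraMap A U D * z = aeval y u) :
    ∃ D : A, D ≠ 0 ∧ ∀ z ∈ S, ∃ u : A[X], algebraMap A U D * z = aeval y u := by
  classical
  induction S using Finset.induction_on with
  | empty => exact ⟨1, one_ne_zero, by simp⟩
  | insert x S hx ih =>
    obtain ⟨D, hD, h⟩ := ih fun z hz => hS z (Finset.mem_insert_of_mem hz)
    obtain ⟨D', hD', u', hu'⟩ := hS x (Finset.mem_insert_self _ _)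
    refine ⟨D * D', mul_ne_zero hD hD', fun z hz => ?_⟩
    rcases Finset.mem_insert.1 hz with rfl | hz
    · exact ⟨C D * u', by rw [map_mul, map_mul, aeval_C, mul_assoc, hu']⟩
    · obtain ⟨u, hu⟩ := h z hz
      exact ⟨C D' * u, by rw [map_mul, map_mul, aeval_C, ← hu]; ring⟩

end Primitive

theorem biEval_algebraMap {k U : Type*} [Field k] [Field U] [Algebra k U] [Algebra k[X] U]
    [IsScalarTower k k[X] U] (y : U) (G : k[X][X]) :
    biEval (algebraMap k U) (algebraMap k[X] U X) y G = aeval y G := by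
  have h : eval₂RingHom (algebraMap k U) (algebraMap k[X] U X) = algebraMap k[X] U := by
    ext x
    · simp [IsScalarTower.algebraMap_apply k k[X] U]
    · simp
  rw [biEval, h]
  rfl

theorem FrobeniusPoints.comap {p : ℕ} {E U Ω : Type*} [Field E] [Field U] [Field Ω]
    (ι : E →+* U) {σ : U → U} {τ : E → E} (hστ : ∀ e, σ (ι e) = ι (τ e)) {C : Set U}
    (h : FrobeniusPoints p Ω σ C) : FrobeniusPoints p Ω τ (ι ⁻¹' C) := by
  classical
  intro X hX N
  obtain ⟨r, hr, B, φ, hB, hφ⟩ := h (X.image ι) (by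
    intro x hx
    obtain ⟨e, he, rfl⟩ := Finset.mem_image.1 (Finset.mem_coe.1 hx)
    exact hX he) N
  refine ⟨r, hr, B.comap ι, φ.comp (ι.restrict (B.comap ι) B fun x hx => hx),
    fun x hx => hB _ (Finset.mem_image_of_mem _ hx), fun x hx hτ => ?_⟩
  have := hφ (ι x) (Finset.mem_image_of_mem _ hx) (by
    rw [hστ]; exact Finset.mem_image_of_mem _ hτ)
  simp only [hστ] at this
  exact this

section SeparableExtension
variable {k K U Ω : Type*} [Field k] [Field K] [Field U] [Field Ω] [Algebra k U] [Algebra K U]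
  [Algebra k[X] K] [IsFractionRing k[X] K] [Algebra k[X] U] [IsScalarTower k[X] K U]
  [IsScalarTower k k[X] U] [IsAlgClosed U] [IsAlgClosed Ω]

theorem FrobeniusPoints.exists_of_isSeparable (p : ℕ) [Fact p.Prime] [CharP Ω p]
    {σ : U →+* U} (hσ : ∀ a : K, σ (algebraMap K U a) = algebraMap K U a)
    (hE : FrobeniusPoints p Ω σ {x | IsAlgebraic k x}) (X₀ : Finset U)
    (hX : ∀ x ∈ X₀, IsSeparable K x) (N : ℕ) :
    ∃ r ≥ N, ∃ (B : Subring U) (φ : B →+* Ω) (hB : ∀ x ∈ X₀, x ∈ B)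
      (htB : algebraMap k[X] U X ∈ B),
      (∀ x (hx : x ∈ X₀) (hσ : σ x ∈ X₀), φ ⟨σ x, hB _ hσ⟩ = φ ⟨x, hB _ hx⟩ ^ p ^ r) ∧
      φ ⟨_, htB⟩ ^ p ^ r = φ ⟨_, htB⟩ ∧
      ∀ s, 0 < s → φ ⟨_, htB⟩ ^ p ^ s = φ ⟨_, htB⟩ → r ≤ s := by
  classical
  set t : U := algebraMap k[X] U X with ht
  have hinj : Function.Injective (algebraMap k[X] U) := by
    rw [IsScalarTower.algebraMap_eq k[X] K U]
    exact (algebraMap K U).injective.comp (IsFractionRing.injective _ _)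
  have : FaithfulSMul k[X] U := (faithfulSMul_iff_algebraMap_injective _ _).2 hinj
  have hσA : ∀ a : k[X], σ (algebraMap k[X] U a) = algebraMap k[X] U a := fun a => by
    rw [IsScalarTower.algebraMap_apply k[X] K U, hσ]
  have hσk : ∀ a : k, σ (algebraMap k U a) = algebraMap k U a := fun a => by
    rw [IsScalarTower.algebraMap_apply k k[X] U, hσA]
  obtain ⟨y, hys, hyi, hyX, hyn⟩ := exists_integral_primitive (A := k[X]) (K := K) X₀ hX
  have hya : IsAlgebraic K y := hys.isIntegral.isAlgebraic
  set g := minpoly k[X] y with hg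
  have hgK : minpoly K y = g.map (algebraMap k[X] K) :=
    minpoly.isIntegrallyClosed_eq_field_fractions' K hyi
  set S := X₀ ∪ (g.rootSet U).toFinset with hS
  have hSy : ∀ z ∈ S, ∃ D : k[X], D ≠ 0 ∧ ∃ u : k[X][X], algebraMap k[X] U D * z = aeval y u := by
    intro z hz
    refine exists_denominator hya ?_
    rcases Finset.mem_union.1 hz with h | h
    · exact hyX z h
    · rw [Set.mem_toFinset, mem_rootSet] at h
      refine hyn z ?_
      rw [hgK, aeval_map_algebraMap]
      exact h.2
  obtain ⟨D, hD, hDS⟩ := exists_common_denominator S hSy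
  choose! u hu using hDS
  let E := algebraicClosure k U
  let ι : E →+* U := algebraMap E U
  have : IsAlgClosed E := IsAlgClosure.isAlgClosed k
  have hσE : ∀ e : E, σ e ∈ E := by
    intro e
    obtain ⟨q, hq, hqe⟩ := mem_algebraicClosure_iff.1 e.2
    refine mem_algebraicClosure_iff.2 ⟨q, hq, ?_⟩
    rw [aeval_def] at hqe ⊢
    have h1 : algebraMap k U = σ.comp (algebraMap k U) := by ext a; exact (hσk a).symm
    rw [h1, ← hom_eval₂, hqe, map_zero]
  let τ : E →+* E := (σ.comp ι).codRestrict E hσE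
  have hστ : σ.comp ι = ι.comp τ := rfl
  have hEτ : FrobeniusPoints p Ω τ Set.univ := by
    have h1 := hE.comap (τ := τ) ι fun e => rfl
    have h2 : ι ⁻¹' {x | IsAlgebraic k x} = Set.univ :=
      Set.eq_univ_of_forall fun e => mem_algebraicClosure_iff.1 e.2
    rwa [h2] at h1
  have hιk : ι.comp (algebraMap k E) = algebraMap k U := rfl
  have hb : ∀ (z : U) (G : k[X][X]), biEval ι t z (G.map (mapRingHom (algebraMap k E))) =
      aeval z G := by
    intro z G
    rw [biEval_map, hιk, biEval_algebraMap]
  have htr : Transcendental k t := by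
    rw [transcendental_iff]
    intro q hq
    have h1 : aeval t q = algebraMap k[X] U q := by
      rw [ht, aeval_algebraMap_apply, aeval_X_left_apply]
    rw [h1] at hq
    exact hinj (hq.trans (map_zero _).symm)
  have htE : Transcendental E t := htr.extendScalars E
  have hgm : g.Monic := minpoly.monic hyi
  obtain ⟨r, hr, B, φ, hB, htB, h1, h2, h3⟩ := FrobeniusPoints.exists_of_curve (Ω := Ω) p hστ hEτ
    (t := t) (y := y) (g := g.map (mapRingHom (algebraMap k E)))
    (fun q hq => (transcendental_iff.1 htE) q hq) (hσA X) (hgm.map _)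
    (by
      have h0 : τ.comp (algebraMap k E) = algebraMap k E :=
        RingHom.ext fun a => Subtype.ext (hσk a)
      rw [Polynomial.map_map, mapRingHom_comp, h0])
    (by rw [hb]; exact minpoly.aeval _ _)
    (by
      rw [derivative_map, hb]
      have h4 := hys.aeval_derivative_ne_zero (minpoly.aeval K y)
      rwa [hgK, derivative_map, aeval_map_algebraMap] at h4)
    (IsAlgClosed.splits _) (D := D.map (algebraMap k E))
    ((Polynomial.map_ne_zero_iff (algebraMap k E).injective).2 hD) S
    (fun z hz => by
      rw [hb] at hz
      refine Finset.mem_union_right _ ?_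
      rw [Set.mem_toFinset, mem_rootSet]
      exact ⟨hgm.ne_zero, hz⟩)
    (fun z => (u z).map (mapRingHom (algebraMap k E)))
    (fun z hz => by
      rw [hb, ← hu z hz]
      congr 1
      have := hb 0 (C D)
      rwa [map_C, biEval_C, aeval_C] at this) N
  exact ⟨r, hr, B, φ, fun x hx => hB x (Finset.mem_union_left _ hx), htB,
    fun x hx hσx => h1 x (Finset.mem_union_left _ hx) (Finset.mem_union_left _ hσx), h2, h3⟩

omit [IsAlgClosed U] in
theorem exists_isSeparable_pow (p : ℕ) [Fact p.Prime] [CharP K p] {x : U}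
    (hx : IsAlgebraic K x) : ∃ n, ∀ m ≥ n, IsSeparable K (x ^ p ^ m) := by
  obtain ⟨g, h1, n, h2⟩ := (minpoly.irreducible hx.isIntegral).hasSeparableContraction p
  have h3 : IsSeparable K (x ^ p ^ n) := h1.of_dvd <| minpoly.dvd K _ <| by
    simpa only [expand_aeval, minpoly.aeval] using congr_arg (aeval x) h2
  refine ⟨n, fun m hm => ?_⟩
  obtain ⟨d, rfl⟩ := Nat.exists_eq_add_of_le hm
  rw [pow_add, pow_mul]
  exact mem_separableClosure_iff.1 (pow_mem (mem_separableClosure_iff.2 h3) _)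

/-- Frobenius points of the algebraic closure of `k` extend to the algebraic closure of `k(t)`,
with primitive image of `t`. -/
theorem FrobeniusPoints.exists_of_isAlgebraic (p : ℕ) [Fact p.Prime] [CharP Ω p] [CharP U p]
    {σ : U →+* U} (hσ : ∀ a : K, σ (algebraMap K U a) = algebraMap K U a)
    (hE : FrobeniusPoints p Ω σ {x | IsAlgebraic k x}) (X₀ : Finset U)
    (hX : ∀ x ∈ X₀, IsAlgebraic K x) (N : ℕ) :
    ∃ r ≥ N, ∃ (B : Subring U) (φ : B →+* Ω) (hB : ∀ x ∈ X₀, x ∈ B)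
      (htB : algebraMap k[X] U X ∈ B),
      (∀ x (hx : x ∈ X₀) (hσ : σ x ∈ X₀), φ ⟨σ x, hB _ hσ⟩ = φ ⟨x, hB _ hx⟩ ^ p ^ r) ∧
      φ ⟨_, htB⟩ ^ p ^ r = φ ⟨_, htB⟩ ∧
      ∀ s, 0 < s → φ ⟨_, htB⟩ ^ p ^ s = φ ⟨_, htB⟩ → r ≤ s := by
  classical
  have : CharP K p := (algebraMap K U).charP (algebraMap K U).injective p
  choose! n hn using fun (x : U) (hx : IsAlgebraic K x) => exists_isSeparable_pow (K := K) p hx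
  set m := X₀.sup n
  obtain ⟨r, hr, B, φ, hB, htB, h1, h2, h3⟩ := hE.exists_of_isSeparable (K := K) p hσ
    (X₀.image fun x => x ^ p ^ m) (by
      intro x hx
      obtain ⟨x', hx', rfl⟩ := Finset.mem_image.1 hx
      exact hn x' (hX x' hx') _ (Finset.le_sup hx')) N
  set e := (iterateFrobeniusEquiv Ω p m).symm
  have he : ∀ x, e (x ^ p ^ m) = x := fun x => by
    rw [← iterateFrobenius_def, ← coe_iterateFrobeniusEquiv]
    exact (iterateFrobeniusEquiv Ω p m).symm_apply_apply x
  set F := iterateFrobenius U p m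
  have hF : ∀ x, F x = x ^ p ^ m := fun x => iterateFrobenius_def p m x
  have htB' : algebraMap k[X] U X ∈ B.comap F := by
    rw [Subring.mem_comap, hF]; exact pow_mem htB _
  have hB' : ∀ x ∈ X₀, x ^ p ^ m ∈ B := fun x hx => hB _ (Finset.mem_image_of_mem _ hx)
  set ψ : B.comap F →+* Ω :=
    (e : Ω →+* Ω).comp (φ.comp (F.restrict (B.comap F) B fun x hx => hx)) with hψ
  have hψφ : ∀ (x : U) (h : x ∈ B.comap F) (h' : x ^ p ^ m ∈ B), ψ ⟨x, h⟩ = e (φ ⟨_, h'⟩) :=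
    fun x h h' => by
      rw [hψ]
      refine congrArg (fun z => e (φ z)) (Subtype.ext (hF x))
  have hψt : ψ ⟨_, htB'⟩ = φ ⟨_, htB⟩ := by
    rw [hψφ _ _ (pow_mem htB _), ← he (φ ⟨_, htB⟩), ← map_pow φ]
    rfl
  refine ⟨r, hr, B.comap F, ψ, fun x hx => by
    rw [Subring.mem_comap, hF]; exact hB' x hx, htB', fun x hx hσx => ?_, by rw [hψt, h2],
    by rwa [hψt]⟩
  rw [hψφ _ _ (hB' x hx), hψφ _ _ (hB' _ hσx), ← map_pow e]
  congr 1
  have h5 := h1 (x ^ p ^ m) (Finset.mem_image_of_mem _ hx) (by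
    rw [map_pow]; exact Finset.mem_image_of_mem _ hσx)
  simp only [map_pow] at h5
  exact h5

end SeparableExtension

section Transcendental
variable {k U Ω : Type*} [Field k] [Field U] [Field Ω] [Algebra k U] [IsAlgClosed U]
  [IsAlgClosed Ω]

open scoped IntermediateField IntermediateField.algebraAdjoinAdjoin in
theorem FrobeniusPoints.exists_of_transcendental (p : ℕ) [Fact p.Prime] [CharP Ω p] [CharP U p]
    {σ : U →+* U} (hσ : ∀ a : k, σ (algebraMap k U a) = algebraMap k U a) {t : U}
    (ht : Transcendental k t) (hσt : σ t = t)
    (hE : FrobeniusPoints p Ω σ {x | IsAlgebraic k x}) (X₀ : Finset U)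
    (hX : ∀ x ∈ X₀, IsAlgebraic k⟮t⟯ x) (N : ℕ) :
    ∃ r ≥ N, ∃ (B : Subring U) (φ : B →+* Ω) (hB : ∀ x ∈ X₀, x ∈ B) (htB : t ∈ B),
      (∀ x (hx : x ∈ X₀) (hσ : σ x ∈ X₀), φ ⟨σ x, hB _ hσ⟩ = φ ⟨x, hB _ hx⟩ ^ p ^ r) ∧
      φ ⟨_, htB⟩ ^ p ^ r = φ ⟨_, htB⟩ ∧
      ∀ s, 0 < s → φ ⟨_, htB⟩ ^ p ^ s = φ ⟨_, htB⟩ → r ≤ s := by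
  have hinj : Function.Injective (aeval (R := k) t) := transcendental_iff_injective.1 ht
  let _ : Algebra k[X] U := (aeval (R := k) t).toAlgebra
  have : IsScalarTower k k[X] U := .of_algebraMap_eq fun x => (aeval_C t x).symm
  have hinj' : Function.Injective (algebraMap k[X] U) := hinj
  let _ : Algebra (FractionRing k[X]) U := (IsFractionRing.lift hinj').toAlgebra
  have : IsScalarTower k[X] (FractionRing k[X]) U :=
    .of_algebraMap_eq fun x => (IsFractionRing.lift_algebraMap hinj' x).symm
  have htX : algebraMap k[X] U X = t := aeval_X t
  have hσA : ∀ a : k[X], σ (algebraMap k[X] U a) = algebraMap k[X] U a := by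
    intro a
    have h : σ.comp (algebraMap k[X] U) = algebraMap k[X] U := by
      ext a
      · exact (congrArg σ (aeval_C t a)).trans ((hσ a).trans (aeval_C t a).symm)
      · simp [htX, hσt]
    exact RingHom.congr_fun h a
  obtain ⟨r, hr, B, φ, hB, htB, h1, h2, h3⟩ := hE.exists_of_isAlgebraic (K := FractionRing k[X])
    (σ := σ) p (by
      intro a
      obtain ⟨x, y, hy, rfl⟩ := IsFractionRing.div_surjective (A := k[X]) a
      rw [map_div₀, map_div₀, ← IsScalarTower.algebraMap_apply, ← IsScalarTower.algebraMap_apply,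
        hσA, hσA]) X₀ (by
      intro x hx
      have h1 := (IsFractionRing.isAlgebraic_iff (Algebra.adjoin k {t}) k⟮t⟯ U).2 (hX x hx)
      rw [← IsFractionRing.isAlgebraic_iff k[X]]
      have hmem : ∀ a : k[X], aeval t a ∈ Algebra.adjoin k {t} := fun a => by
        rw [Algebra.adjoin_singleton_eq_range_aeval]; exact ⟨a, rfl⟩
      refine IsAlgebraic.of_ringHom_of_comp_eq
        ((aeval (R := k) t).toRingHom.codRestrict (Algebra.adjoin k {t}) hmem)
        (RingHom.id U) h1 ?_ Function.injective_id rfl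
      rintro ⟨b, hb⟩
      rw [Algebra.adjoin_singleton_eq_range_aeval] at hb
      obtain ⟨a, rfl⟩ := hb
      exact ⟨a, rfl⟩) N
  simp only [htX] at htB
  refine ⟨r, hr, B, φ, hB, htB, h1, ?_, ?_⟩
  · simpa only [htX] using h2
  · simpa only [htX] using h3

end Transcendental

section Induction
variable (p : ℕ) [Fact p.Prime] {U Ω : Type*} [Field U] [Field Ω] [Algebra (ZMod p) U]
  [CharP Ω p] [CharP U p] [IsAlgClosed Ω]

omit [CharP U p] in
theorem exists_eq_pow_of_isAlgebraic (σ : U →+* U) [IsAlgClosed U] (X : Finset U)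
    (hX : ∀ x ∈ X, IsAlgebraic (ZMod p) x) (N : ℕ) : ∃ r ≥ N, ∀ x ∈ X, σ x = x ^ p ^ r := by
  let M := IntermediateField.adjoin (ZMod p) (X : Set U)
  have hfd : FiniteDimensional (ZMod p) M :=
    IntermediateField.finiteDimensional_adjoin fun x hx => (hX x hx).isIntegral
  have : Finite M := Module.finite_of_finite (ZMod p)
  have : Fintype M := Fintype.ofFinite M
  let σ' : U →ₐ[ZMod p] U := { σ with
    commutes' := fun r => RingHom.congr_fun
      (Subsingleton.elim (σ.comp (algebraMap (ZMod p) U)) (algebraMap (ZMod p) U)) r }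
  obtain ⟨n, hn⟩ := (FiniteField.bijective_frobeniusAlgHom_pow (ZMod p) M).2 (σ'.restrictNormal M)
  have hd : 0 < Module.finrank (ZMod p) M := Module.finrank_pos
  refine ⟨n + Module.finrank (ZMod p) M * N, ?_, fun x hx => ?_⟩
  · exact (Nat.le_mul_of_pos_left N hd).trans (Nat.le_add_left _ _)
  · have hxM : x ∈ M := IntermediateField.subset_adjoin _ _ hx
    have h0 : FiniteField.frobeniusAlgHom (ZMod p) M ^ (n + Module.finrank (ZMod p) M * N) =
        σ'.restrictNormal M := by
      have h := pow_orderOf_eq_one (FiniteField.frobeniusAlgHom (ZMod p) M)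
      rw [FiniteField.orderOf_frobeniusAlgHom] at h
      rw [pow_add, pow_mul, h, one_pow, mul_one, ← hn]
    have h1 := σ'.restrictNormal_commutes M ⟨x, hxM⟩
    rw [← h0, AlgHom.coe_pow, FiniteField.coe_frobeniusAlgHom, pow_iterate, ZMod.card] at h1
    exact h1.symm

omit [CharP U p] in
theorem frobeniusPoints_isAlgebraic (σ : U →+* U) [IsAlgClosed U] :
    FrobeniusPoints p Ω σ {x | IsAlgebraic (ZMod p) x} := by
  intro X hX N
  obtain ⟨r, hr, h⟩ := exists_eq_pow_of_isAlgebraic p σ X hX N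
  let _ : Algebra (ZMod p) Ω := ZMod.algebra Ω p
  let E := algebraicClosure (ZMod p) U
  let φ : E →ₐ[ZMod p] Ω := IsAlgClosed.lift
  refine ⟨r, hr, E.toSubring, φ.toRingHom, fun x hx => mem_algebraicClosure_iff.2 (hX hx),
    fun x hx hσ => ?_⟩
  rw [← map_pow]
  exact congrArg φ (Subtype.ext (h x hx))

open scoped IntermediateField.algebraAdjoinAdjoin in
theorem AlgebraicIndepOn.transcendental_adjoin {F : Type*} [Field F] [Algebra F U] {s : Set U}
    {t : U} (ht : t ∉ s) (h : AlgebraicIndepOn F id (insert t s)) :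
    AlgebraicIndepOn F id s ∧ Transcendental (IntermediateField.adjoin F s) t := by
  obtain ⟨h0, h1⟩ := (AlgebraicIndepOn.insert_iff ht).1 h
  rw [Set.image_id, Transcendental,
    IsFractionRing.isAlgebraic_iff (Algebra.adjoin F s) (IntermediateField.adjoin F s) U] at h1
  exact ⟨h0, h1⟩

theorem FrobeniusPoints.exists_of_insert (σ : U →+* U) [IsAlgClosed U] {s : Set U} {t : U}
    (ht : t ∉ s) (hs : AlgebraicIndepOn (ZMod p) id (insert t s)) (hσ : ∀ x ∈ insert t s, σ x = x)
    (hE : FrobeniusPoints p Ω σ {x | IsAlgebraic (IntermediateField.adjoin (ZMod p) s) x})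
    (X₀ : Finset U)
    (hX : ∀ x ∈ X₀, IsAlgebraic (IntermediateField.adjoin (ZMod p) (insert t s)) x) (N : ℕ) :
    ∃ r ≥ N, ∃ (B : Subring U) (φ : B →+* Ω) (hB : ∀ x ∈ X₀, x ∈ B) (htB : t ∈ B),
      (∀ x (hx : x ∈ X₀) (hσ : σ x ∈ X₀), φ ⟨σ x, hB _ hσ⟩ = φ ⟨x, hB _ hx⟩ ^ p ^ r) ∧
      φ ⟨_, htB⟩ ^ p ^ r = φ ⟨_, htB⟩ ∧
      ∀ s, 0 < s → φ ⟨_, htB⟩ ^ p ^ s = φ ⟨_, htB⟩ → r ≤ s := by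
  refine FrobeniusPoints.exists_of_transcendental p (fun a => ?_) (hs.transcendental_adjoin ht).2
    (hσ t (Set.mem_insert _ _)) hE X₀ (fun x hx => ?_) N
  · let σ' : U →ₐ[ZMod p] U := { σ with
      commutes' := fun r => RingHom.congr_fun
        (Subsingleton.elim (σ.comp (algebraMap (ZMod p) U)) (algebraMap (ZMod p) U)) r }
    have h : IntermediateField.adjoin (ZMod p) s ≤
        (AlgHom.equalizer σ' (AlgHom.id (ZMod p) U)).toIntermediateField fun x hx => by
          rw [AlgHom.mem_equalizer] at hx ⊢
          rw [map_inv₀, hx, map_inv₀] :=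
      IntermediateField.adjoin_le_iff.2 fun x hx => hσ x (Set.mem_insert_of_mem _ hx)
    exact h a.2
  · have h := hX x hx
    rw [Set.insert_eq, Set.union_comm, ← IntermediateField.adjoin_adjoin_left] at h
    exact h

theorem frobeniusPoints_adjoin (σ : U →+* U) [IsAlgClosed U] (s : Finset U)
    (hs : AlgebraicIndepOn (ZMod p) id (s : Set U)) (hσ : ∀ x ∈ s, σ x = x) :
    FrobeniusPoints p Ω σ
      {x | IsAlgebraic (IntermediateField.adjoin (ZMod p) (s : Set U)) x} := by
  classical
  induction s using Finset.induction_on with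
  | empty =>
    have h : {x : U | IsAlgebraic (IntermediateField.adjoin (ZMod p) ((∅ : Finset U) : Set U)) x} =
        {x | IsAlgebraic (ZMod p) x} := by
      ext x
      have : Algebra.IsAlgebraic (ZMod p)
          (IntermediateField.adjoin (ZMod p) ((∅ : Finset U) : Set U)) := by
        rw [Finset.coe_empty, IntermediateField.adjoin_empty]
        infer_instance
      exact ⟨fun h => h.restrictScalars (ZMod p), fun h => h.extendScalars
        (algebraMap (ZMod p) _).injective⟩
    rw [h]
    exact frobeniusPoints_isAlgebraic p σ
  | insert t s ht ih =>
    rw [Finset.coe_insert] at hs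
    have ht' : t ∉ (s : Set U) := ht
    intro X hX N
    obtain ⟨r, hr, B, φ, hB, -, h, -⟩ := FrobeniusPoints.exists_of_insert p σ ht' hs
      (fun x hx => hσ x (by simpa using hx)) (Ω := Ω)
      (ih (hs.transcendental_adjoin ht').1 fun x hx => hσ x (Finset.mem_insert_of_mem hx)) X
      (fun x hx => by
        have h := hX hx
        rw [Finset.coe_insert] at h
        exact h) N
    exact ⟨r, hr, B, φ, hB, h⟩

/-- Frobenius points of the algebraic closure of `𝔽_p(t, s)`, with primitive image of `t`. -/
theorem exists_frobenius_point (σ : U →+* U) [IsAlgClosed U] (s : Finset U) {t : U}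
    (ht : t ∉ s) (hs : AlgebraicIndepOn (ZMod p) id (insert t (s : Set U))) (hσt : σ t = t)
    (hσ : ∀ x ∈ s, σ x = x) (X₀ : Finset U)
    (hX : ∀ x ∈ X₀, IsAlgebraic (IntermediateField.adjoin (ZMod p) (insert t (s : Set U))) x) :
    ∃ (r : ℕ) (B : Subring U) (φ : B →+* Ω) (hB : ∀ x ∈ X₀, x ∈ B) (htB : t ∈ B), 0 < r ∧
      (∀ x (hx : x ∈ X₀) (hσ : σ x ∈ X₀), φ ⟨σ x, hB _ hσ⟩ = φ ⟨x, hB _ hx⟩ ^ p ^ r) ∧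
      φ ⟨_, htB⟩ ^ p ^ r = φ ⟨_, htB⟩ ∧
      ∀ s, 0 < s → φ ⟨_, htB⟩ ^ p ^ s = φ ⟨_, htB⟩ → r ≤ s := by
  have ht' : t ∉ (s : Set U) := ht
  obtain ⟨r, hr, B, φ, hB, htB, h⟩ := FrobeniusPoints.exists_of_insert p σ ht' hs
    (fun x hx => by
      rcases hx with rfl | hx
      exacts [hσt, hσ x hx]) (Ω := Ω)
    (frobeniusPoints_adjoin p σ s (hs.transcendental_adjoin ht').1 hσ) X₀ hX 1
  exact ⟨r, B, φ, hB, htB, hr, h⟩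

end Induction

theorem ValuationSubring.isUnit_coe_iff {w : ValuationSubring L} {x : L} :
    (x ∈ w ∧ x ∉ w.nonunits) ↔ w.valuation x = 1 := by
  rw [mem_nonunits_iff, ← valuation_le_one_iff, not_lt]
  exact le_antisymm_iff.symm

section Conjugation

/-- If `A` is a Dedekind domain with fraction field `K` contained in `w`, then every element of `w`
is a fraction of integral elements with denominator a unit of `w`. -/
theorem ValuationSubring.exists_integral_mul_eq (A : Type*) [CommRing A] [IsDedekindDomain A]
    [Algebra A K] [IsFractionRing A K] [Algebra A L] [IsScalarTower A K L]
    [FiniteDimensional K L] [Algebra.IsSeparable K L] (w : ValuationSubring L)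
    (hw : ∀ b : integralClosure A L, (b : L) ∈ w) {z : L} (hz : z ∈ w) :
    ∃ a s : integralClosure A L, (s : L) ∉ w.nonunits ∧ (s : L) * z = a := by
  set B := integralClosure A L
  have : IsFractionRing B L := integralClosure.isFractionRing_of_finite_extension K L
  have : IsDedekindDomain B := integralClosure.isDedekindDomain A K L
  let f : B →+* w := (algebraMap B L).codRestrict w hw
  let m : Ideal B := (IsLocalRing.maximalIdeal w).comap f
  have hm : ∀ b : B, b ∈ m ↔ (b : L) ∈ w.nonunits := fun b =>
    (coe_mem_nonunits_iff (a := f b)).symm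
  have hmp : m.IsPrime := Ideal.comap_isPrime _ _
  obtain ⟨a, b, hb, rfl⟩ := IsFractionRing.div_surjective (A := B) z
  have hb0 : algebraMap B L b ≠ 0 := by
    simpa using nonZeroDivisors.ne_zero hb
  by_cases hbot : m = ⊥
  · refine ⟨a, b, ?_, mul_div_cancel₀ _ hb0⟩
    rw [← hm, hbot, Ideal.mem_bot]
    exact nonZeroDivisors.ne_zero hb
  have := IsLocalization.AtPrime.isDiscreteValuationRing_of_dedekind_domain B hbot
    (Localization.AtPrime m)
  have hinj : Function.Injective (algebraMap B (Localization.AtPrime m)) :=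
    IsLocalization.injective _ m.primeCompl_le_nonZeroDivisors
  obtain ⟨c, hc⟩ := ValuationRing.cond (algebraMap B (Localization.AtPrime m) a)
    (algebraMap B (Localization.AtPrime m) b)
  obtain ⟨⟨x, s⟩, hxs⟩ := IsLocalization.surj m.primeCompl c
  have hs : (s : B) ∉ m := s.2
  dsimp only at hxs
  rcases hc with hc | hc
  · have h1 : a * x = b * s := hinj (by rw [map_mul, map_mul, ← hxs, ← hc]; ring)
    have h2 : (x : L) * (algebraMap B L a / algebraMap B L b) = (s : B) := by
      rw [mul_div_assoc', div_eq_iff hb0]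
      have := congrArg (algebraMap B L) h1
      rw [map_mul, map_mul] at this
      rw [mul_comm]
      exact this.trans (mul_comm _ _)
    refine ⟨s, x, fun hx => hs ?_, h2⟩
    rw [hm, ← h2, mem_nonunits_iff, map_mul]
    exact mul_lt_one_of_lt_of_le hx ((valuation_le_one_iff _ _).2 hz)
  · have h1 : b * x = a * s := hinj (by rw [map_mul, map_mul, ← hxs, ← hc]; ring)
    refine ⟨x, s, by rwa [← hm], ?_⟩
    rw [mul_div_assoc', div_eq_iff hb0]
    have := congrArg (algebraMap B L) h1
    rw [map_mul, map_mul] at this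
    exact (mul_comm _ _).trans (this.symm.trans (mul_comm _ _))

theorem ValuationSubring.eq_of_nonunits_iff (A : Type*) [CommRing A] [IsDedekindDomain A]
    [Algebra A K] [IsFractionRing A K] [Algebra A L] [IsScalarTower A K L]
    [FiniteDimensional K L] [Algebra.IsSeparable K L] (w₁ w₂ : ValuationSubring L)
    (h₁ : ∀ b : integralClosure A L, (b : L) ∈ w₁) (h₂ : ∀ b : integralClosure A L, (b : L) ∈ w₂)
    (h : ∀ b : integralClosure A L, (b : L) ∈ w₁.nonunits ↔ (b : L) ∈ w₂.nonunits) :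
    w₁ = w₂ := by
  have key : ∀ w₁ w₂ : ValuationSubring L, (∀ b : integralClosure A L, (b : L) ∈ w₁) →
      (∀ b : integralClosure A L, (b : L) ∈ w₂) →
      (∀ b : integralClosure A L, (b : L) ∈ w₁.nonunits ↔ (b : L) ∈ w₂.nonunits) → w₁ ≤ w₂ := by
    intro w₁ w₂ h₁ h₂ h z hz
    obtain ⟨a, s, hs, hz⟩ := w₁.exists_integral_mul_eq (K := K) A h₁ hz
    rw [h] at hs
    have h3 := isUnit_coe_iff.1 ⟨h₂ s, hs⟩
    have h4 := (valuation_le_one_iff w₂ _).2 (h₂ a)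
    rw [← hz, map_mul, h3, one_mul] at h4
    exact (valuation_le_one_iff w₂ _).1 h4
  exact le_antisymm (key _ _ h₁ h₂ h) (key _ _ h₂ h₁ fun b => (h b).symm)

/-- The extensions of a discrete valuation ring to a finite Galois extension are conjugate. -/
theorem ValuationSubring.exists_comap_eq_of_comap_eq [FiniteDimensional K L] [IsGalois K L]
    (v : ValuationSubring K) [IsDiscreteValuationRing v] (w w₀ : ValuationSubring L)
    (hw : w.comap (algebraMap K L) = v) (hw₀ : w₀.comap (algebraMap K L) = v) :
    ∃ g : L ≃ₐ[K] L, w₀.comap (g : L →+* L) = w := by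
  have h_int : ∀ w : ValuationSubring L, w.comap (algebraMap K L) = v →
      ∀ b : integralClosure v L, (b : L) ∈ w := by
    intro w hw b
    obtain ⟨P, hP, hb⟩ := b.2
    have h1 : ∀ a : v, algebraMap v L a ∈ w := fun a => by
      have : (a : K) ∈ w.comap (algebraMap K L) := by rw [hw]; exact a.2
      exact this
    have : IsIntegral w (b : L) := by
      refine ⟨P.map ((algebraMap v L).codRestrict w h1), hP.map _, ?_⟩
      rw [Polynomial.eval₂_map]
      exact hb
    obtain ⟨y, hy⟩ := IsIntegrallyClosed.isIntegral_iff.1 this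
    rw [← hy]
    exact y.2
  have hnon : ∀ w : ValuationSubring L, w.comap (algebraMap K L) = v →
      ∀ a : v, algebraMap v L a ∈ w.nonunits ↔ (a : K) ∈ v.nonunits := by
    rintro w rfl a
    rw [mem_nonunits_iff_or, mem_nonunits_iff_or, mem_comap, map_inv₀]
    change algebraMap K L a = 0 ∨ _ ↔ _
    rw [map_eq_zero]
    rfl
  have : IsFractionRing (integralClosure v L) L :=
    integralClosure.isFractionRing_of_finite_extension K L
  let _ := IsIntegralClosure.MulSemiringAction v K L (integralClosure v L)
  have := Algebra.isInvariant_of_isGalois v K L (integralClosure v L)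
  let f (w : ValuationSubring L) (hw : w.comap (algebraMap K L) = v) : integralClosure v L →+* w :=
    (algebraMap (integralClosure v L) L).codRestrict w (h_int w hw)
  let m (w : ValuationSubring L) (hw : w.comap (algebraMap K L) = v) :
    Ideal (integralClosure v L) :=
    (IsLocalRing.maximalIdeal w).comap (f w hw)
  have hm : ∀ w hw b, b ∈ m w hw ↔ (b : L) ∈ w.nonunits := fun w hw b =>
    (coe_mem_nonunits_iff (a := f w hw b)).symm
  have hmp : ∀ w hw, (m w hw).IsPrime := fun w hw => Ideal.comap_isPrime _ _
  have := hmp w hw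
  have := hmp w₀ hw₀
  have : SMulCommClass (L ≃ₐ[K] L) v (integralClosure v L) :=
    ⟨fun g a b => map_smul (galRestrict v K L (integralClosure v L) g) a b⟩
  obtain ⟨g, hg⟩ := Algebra.IsInvariant.exists_smul_of_under_eq v (integralClosure v L)
    (L ≃ₐ[K] L) (m w hw) (m w₀ hw₀) (by
      ext a
      exact ((hm w hw _).trans (hnon w hw a)).trans
        ((hm w₀ hw₀ _).trans (hnon w₀ hw₀ a)).symm)
  have hcomap : (w₀.comap (g : L →+* L)).comap (algebraMap K L) = v := by
    rw [comap_comap, ← hw₀]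
    congr 1
    ext x
    exact g.commutes x
  refine ⟨g, eq_of_nonunits_iff (K := K) v _ _ (h_int _ hcomap) (h_int w hw) fun b => ?_⟩
  have h1 : ((g • b : integralClosure v L) : L) = g b :=
    algebraMap_galRestrict_apply v g b
  rw [← hm w hw, ← Ideal.smul_mem_pointwise_smul_iff (a := g), ← hg, hm w₀ hw₀, h1,
    mem_nonunits_iff_or,
    mem_nonunits_iff_or, mem_comap]
  simp
end Conjugation

section Place
namespace ValuationSubring

variable {Ω : Type*} [Field Ω]

theorem mem_nonunits_of_inv_notMem {w : ValuationSubring L} {x : L} (h : x ∉ w) :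
    x⁻¹ ∈ w.nonunits := by
  rw [mem_nonunits_iff_or, inv_inv]
  exact Or.inr h

theorem isFrobeniusAt_of_place (v : ValuationSubring K) (w : ValuationSubring L) (ev : w →+* Ω)
    (hev : ∀ z, ev z = 0 ↔ (z : L) ∈ w.nonunits) (σ : L ≃ₐ[K] L)
    (hv : Nat.card (IsLocalRing.ResidueField v) ≠ 0)
    (hσ : ∀ z (hz : z ∈ w), ∃ h : σ z ∈ w,
      ev ⟨σ z, h⟩ = ev ⟨z, hz⟩ ^ Nat.card (IsLocalRing.ResidueField v)) :
    v.IsFrobeniusAt w σ := by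
  refine ⟨fun x => ⟨fun hx => (hσ x hx).1, fun hx => ?_⟩, fun x hx => ?_⟩
  · by_contra hx'
    have h1 := mem_nonunits_of_inv_notMem hx'
    have h2 := w.nonunits_subset h1
    obtain ⟨h3, h4⟩ := hσ _ h2
    rw [(hev ⟨_, h2⟩).2 h1, zero_pow hv, hev] at h4
    change σ x⁻¹ ∈ w.nonunits at h4
    rw [map_inv₀] at h4
    rcases (mem_nonunits_iff_or _).1 h4 with h5 | h5
    · rw [inv_eq_zero, map_eq_zero] at h5
      exact hx' (h5 ▸ w.zero_mem)
    · exact h5 (by rwa [inv_inv])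
  · obtain ⟨h1, h2⟩ := hσ x hx
    rw [← mem_nonunits_iff]
    refine (hev (⟨σ x, h1⟩ - ⟨x, hx⟩ ^ Nat.card (IsLocalRing.ResidueField v))).1 ?_
    rw [map_sub, map_pow, h2, sub_self]

theorem isUnramifiedExtension_of_place (v : ValuationSubring K) (w : ValuationSubring L)
    (hw : w.comap (algebraMap K L) = v) (ev : w →+* Ω)
    (hev : ∀ z, ev z = 0 ↔ (z : L) ∈ w.nonunits) (hΩ : ∀ c : Ω, ∃ n, 1 < n ∧ c ^ n = c)
    [Finite (IsLocalRing.ResidueField v)] {π : K} (hπ : π ≠ 0)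
    (hval : ∀ z : L, z ≠ 0 → ∃ n : ℤ, w.valuation z = w.valuation (algebraMap K L π) ^ n) :
    v.IsUnramifiedExtension w hw := by
  refine ⟨fun x hx => ?_, ?_⟩
  · obtain ⟨n, hn⟩ := hval x hx
    exact ⟨π ^ n, zpow_ne_zero _ hπ, by rw [hn, map_zpow₀, map_zpow₀]⟩
  · let _ := (IsLocalRing.ResidueField.map (extensionHom v w hw)).toAlgebra
    have : Algebra.IsAlgebraic (IsLocalRing.ResidueField v) (IsLocalRing.ResidueField w) := by
      refine ⟨fun x => ?_⟩
      obtain ⟨z, rfl⟩ := IsLocalRing.residue_surjective x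
      obtain ⟨n, hn, hc⟩ := hΩ (ev z)
      refine ⟨Polynomial.X ^ n - Polynomial.X, FiniteField.X_pow_card_sub_X_ne_zero _ hn, ?_⟩
      rw [map_sub, map_pow, Polynomial.aeval_X, ← map_pow, ← map_sub,
        IsLocalRing.residue_eq_zero_iff, ← coe_mem_nonunits_iff, ← hev, map_sub, map_pow, hc,
        sub_self]
    change Algebra.IsSeparable _ _
    infer_instance

theorem isDiscreteValuationRing_of_zpow (w : ValuationSubring L) {π : K} (hπ : π ≠ 0)
    (hπw : algebraMap K L π ∈ w.nonunits)
    (hval : ∀ z : L, z ≠ 0 → ∃ n : ℤ, w.valuation z = w.valuation (algebraMap K L π) ^ n) :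
    IsDiscreteValuationRing (w.comap (algebraMap K L)) := by
  set v := w.comap (algebraMap K L)
  set q := w.valuation (algebraMap K L π) with hq
  have hq0 : 0 < q := by
    rw [zero_lt_iff, hq, Valuation.ne_zero_iff]
    simpa using hπ
  have hq1 : q < 1 := hπw
  have hπv : π ∈ v := w.nonunits_subset hπw
  have hunit : ∀ a : v, w.valuation (algebraMap K L a) = 1 → IsUnit a := by
    intro a ha
    have h1 : (a : K)⁻¹ ∈ v := by
      change algebraMap K L _ ∈ w
      rw [← valuation_le_one_iff, map_inv₀, map_inv₀, ha, inv_one]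
    have h2 : (a : K) ≠ 0 := by
      intro h
      simp [h] at ha
    exact IsUnit.of_mul_eq_one ⟨_, h1⟩ (Subtype.ext (mul_inv_cancel₀ h2))
  have hnat : ∀ a : v, a ≠ 0 → ∃ n : ℕ, w.valuation (algebraMap K L a) = q ^ n := by
    intro a ha
    obtain ⟨n, hn⟩ := hval (algebraMap K L a) (by simpa using ha)
    have h1 : q ^ n ≤ q ^ (0 : ℤ) := by
      rw [← hn, zpow_zero]
      exact (valuation_le_one_iff _ _).2 a.2
    rw [zpow_le_zpow_iff_right_of_lt_one₀ hq0 hq1] at h1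
    obtain ⟨m, rfl⟩ := Int.eq_ofNat_of_zero_le h1
    exact ⟨m, by rw [hn]; simp⟩
  refine IsDiscreteValuationRing.ofHasUnitMulPowIrreducibleFactorization ⟨⟨π, hπv⟩, ⟨?_, ?_⟩, ?_⟩
  · intro h
    obtain ⟨b, hb⟩ := h.exists_right_inv
    have hb' : π * (b : K) = 1 := congrArg Subtype.val hb
    have h1 : q * w.valuation (algebraMap K L b) = 1 := by
      rw [hq, ← map_mul, ← map_mul, hb', map_one, map_one]
    exact (mul_lt_one_of_lt_of_le hq1 ((valuation_le_one_iff _ _).2 b.2)).ne h1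
  · intro a b hab
    have hab' : π = (a : K) * b := congrArg Subtype.val hab
    have ha : a ≠ 0 := by
      rintro rfl
      exact hπ (by simpa using hab')
    have hb : b ≠ 0 := by
      rintro rfl
      exact hπ (by simpa using hab')
    obtain ⟨m, hm⟩ := hnat a ha
    obtain ⟨n, hn⟩ := hnat b hb
    have h1 : q ^ 1 = q ^ (m + n) := by
      rw [pow_add, ← hm, ← hn, ← map_mul, ← map_mul, ← hab', pow_one]
    have h2 := (pow_right_strictAnti₀ hq0 hq1).injective h1
    have h3 : m = 0 ∨ n = 0 := by omega
    rcases h3 with rfl | rfl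
    · exact Or.inl (hunit a (by simpa using hm))
    · exact Or.inr (hunit b (by simpa using hn))
  · intro x hx
    obtain ⟨n, hn⟩ := hnat x hx
    have h1 : w.valuation (algebraMap K L (x / π ^ n)) = 1 := by
      rw [map_div₀, map_div₀, hn, map_pow, map_pow]
      exact div_self (pow_ne_zero _ hq0.ne')
    have h2 : x / π ^ n ∈ v := (valuation_le_one_iff w _).1 h1.le
    obtain ⟨u, hu⟩ := hunit ⟨_, h2⟩ h1
    refine ⟨n, u, Subtype.ext ?_⟩
    rw [hu]
    exact mul_div_cancel₀ _ (pow_ne_zero _ hπ)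

theorem card_residueField_of_place (p r : ℕ) [Fact p.Prime] [CharP Ω p] (hr : 0 < r)
    (v : ValuationSubring K) (ev : v →+* Ω) (hev : ∀ z, ev z = 0 ↔ (z : K) ∈ v.nonunits)
    (h : ∀ z, ev z ^ p ^ r = ev z) (t : v) (ht : ∀ s, 0 < s → ev t ^ p ^ s = ev t → r ≤ s) :
    Finite (IsLocalRing.ResidueField v) ∧ Nat.card (IsLocalRing.ResidueField v) = p ^ r := by
  classical
  have hloc : IsLocalHom ev := by
    refine ⟨fun a ha => ?_⟩
    by_contra hna
    exact ha.ne_zero ((hev a).2 (coe_mem_nonunits_iff.2 hna))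
  let f : IsLocalRing.ResidueField v →+* Ω := IsLocalRing.ResidueField.lift ev
  have hf : ∀ x, f x ^ p ^ r = f x := by
    intro x
    obtain ⟨z, rfl⟩ := IsLocalRing.residue_surjective x
    exact h z
  have hp := Fact.out (p := p.Prime)
  have hP : (Polynomial.X ^ p ^ r - Polynomial.X : Polynomial Ω) ≠ 0 :=
    FiniteField.X_pow_card_pow_sub_X_ne_zero _ hr.ne' hp.one_lt
  have hroot : ∀ x, f x ∈ (Polynomial.X ^ p ^ r - Polynomial.X : Polynomial Ω).roots.toFinset := by
    intro x
    rw [Multiset.mem_toFinset, Polynomial.mem_roots hP]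
    simp [hf]
  let F : IsLocalRing.ResidueField v →
      (Polynomial.X ^ p ^ r - Polynomial.X : Polynomial Ω).roots.toFinset := fun x => ⟨f x, hroot x⟩
  have hF : Function.Injective F := fun x y hxy => f.injective (congrArg Subtype.val hxy)
  have hfin := Finite.of_injective F hF
  refine ⟨hfin, le_antisymm ?_ ?_⟩
  · refine (Nat.card_le_card_of_injective F hF).trans ?_
    rw [Nat.card_eq_fintype_card, Fintype.card_coe]
    refine (Multiset.toFinset_card_le _).trans ((Polynomial.card_roots' _).trans ?_)
    rw [FiniteField.X_pow_card_pow_sub_X_natDegree_eq _ hr.ne' hp.one_lt]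
  · have := Fintype.ofFinite (IsLocalRing.ResidueField v)
    have : CharP (IsLocalRing.ResidueField v) p := (f.charP_iff f.injective p).2 ‹_›
    obtain ⟨n, -, hn⟩ := FiniteField.card (IsLocalRing.ResidueField v) p
    rw [Nat.card_eq_fintype_card, hn]
    refine Nat.pow_le_pow_right hp.pos (ht n n.pos ?_)
    rw [← hn]
    have := FiniteField.pow_card (IsLocalRing.residue v t)
    exact (map_pow f _ _).symm.trans (congrArg f this)

theorem of_place [FiniteDimensional K L] [IsGalois K L] (p r : ℕ) [Fact p.Prime] [CharP Ω p]
    (hr : 0 < r) (hΩ : ∀ c : Ω, ∃ n, 1 < n ∧ c ^ n = c) (w₀ : ValuationSubring L) (ev : w₀ →+* Ω)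
    (hev : ∀ z, ev z = 0 ↔ (z : L) ∈ w₀.nonunits) {π : K} (hπ : π ≠ 0)
    (hπw : algebraMap K L π ∈ w₀.nonunits)
    (hval : ∀ z : L, z ≠ 0 → ∃ n : ℤ, w₀.valuation z = w₀.valuation (algebraMap K L π) ^ n)
    (σ : L ≃ₐ[K] L)
    (hσ : ∀ z (hz : z ∈ w₀), ∃ h : σ z ∈ w₀, ev ⟨σ z, h⟩ = ev ⟨z, hz⟩ ^ p ^ r)
    (t : K) (ht : algebraMap K L t ∈ w₀)
    (hts : ∀ s, 0 < s → ev ⟨_, ht⟩ ^ p ^ s = ev ⟨_, ht⟩ → r ≤ s)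
    (v : ValuationSubring K) (hv : w₀.comap (algebraMap K L) = v) :
    v ≠ ⊤ ∧ IsDiscreteValuationRing v ∧ Finite (IsLocalRing.ResidueField v) ∧
      ∀ (w : ValuationSubring L) (hw : w.comap (algebraMap K L) = v),
        v.IsUnramifiedExtension w hw ∧ ∃ σ', IsConj σ σ' ∧ v.IsFrobeniusAt w σ' := by
  have hdvr : IsDiscreteValuationRing v := hv ▸ isDiscreteValuationRing_of_zpow w₀ hπ hπw hval
  obtain ⟨hfin, hcard⟩ := card_residueField_of_place p r hr v (ev.comp (extensionHom v w₀ hv))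
    (fun z => by
      subst hv
      refine (hev _).trans ?_
      rw [mem_nonunits_iff_or, mem_nonunits_iff_or, mem_comap, map_inv₀]
      change algebraMap K L z = 0 ∨ _ ↔ _
      rw [map_eq_zero]
      rfl)
    (fun z => by
      obtain ⟨h1, h2⟩ := hσ _ (extensionHom v w₀ hv z).2
      refine h2.symm.trans (congrArg ev (Subtype.ext ?_))
      exact σ.commutes _)
    ⟨t, by rw [← hv]; exact ht⟩ hts
  have hp := Fact.out (p := p.Prime)
  refine ⟨?_, hdvr, hfin, fun w hw => ?_⟩
  · rintro rfl
    have h1 : π⁻¹ ∈ w₀.comap (algebraMap K L) := by rw [hv]; exact mem_top _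
    rw [mem_comap, map_inv₀] at h1
    rcases (mem_nonunits_iff_or _).1 hπw with h2 | h2
    · exact hπ (by simpa using h2)
    · exact h2 h1
  · obtain ⟨g, rfl⟩ := exists_comap_eq_of_comap_eq v w w₀ hw hv
    let e : w₀.comap (g : L →+* L) →+* w₀ :=
      ((g : L →+* L).comp (w₀.comap (g : L →+* L)).subtype).codRestrict w₀ fun z => z.2
    have hnon : ∀ z : L, z ∈ (w₀.comap (g : L →+* L)).nonunits ↔ g z ∈ w₀.nonunits := fun z => by
      rw [mem_nonunits_iff_or, mem_nonunits_iff_or, mem_comap]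
      simp
    have hev' : ∀ z, (ev.comp e) z = 0 ↔ (z : L) ∈ (w₀.comap (g : L →+* L)).nonunits := fun z =>
      (hev _).trans (hnon z).symm
    refine ⟨isUnramifiedExtension_of_place v _ hw (ev.comp e) hev' hΩ hπ fun z hz => ?_,
      g⁻¹ * σ * g, isConj_iff.2 ⟨g⁻¹, by rw [inv_inv]⟩,
      isFrobeniusAt_of_place v _ (ev.comp e) hev' _ ?_ fun z hz => ?_⟩
    · obtain ⟨n, hn⟩ := hval (g z) (by simpa using hz)
      refine ⟨n, ?_⟩
      have h1 : w₀.valuation (g (z / algebraMap K L π ^ n)) = 1 := by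
        rw [map_div₀, map_zpow₀, g.commutes, map_div₀, hn, map_zpow₀]
        refine div_self (zpow_ne_zero _ ?_)
        rw [Valuation.ne_zero_iff]
        simpa using hπ
      rw [← isUnit_coe_iff, ← hnon] at h1
      have h2 := isUnit_coe_iff.1 (show _ ∈ w₀.comap (g : L →+* L) ∧ _ from h1)
      rw [map_div₀, map_zpow₀] at h2
      exact eq_of_div_eq_one h2
    · rw [hcard]
      exact pow_ne_zero _ hp.ne_zero
    · obtain ⟨h1, h2⟩ := hσ (g z) hz
      have h3 : g ((g⁻¹ * σ * g) z) = σ (g z) := by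
        change g (g⁻¹ (σ (g z))) = _
        exact g.apply_symm_apply _
      refine ⟨?_, ?_⟩
      · rw [mem_comap]
        exact h3 ▸ h1
      · rw [hcard]
        exact (congrArg ev (Subtype.ext h3)).trans h2

end ValuationSubring
end Place

section Lift

theorem PowerSeries.eq_of_eval_eq_zero {Ω : Type*} [Field Ω] {P : (PowerSeries Ω)[X]}
    {g h : PowerSeries Ω} (hg : P.eval g = 0) (hh : P.eval h = 0)
    (hgh : constantCoeff g = constantCoeff h) (hd : constantCoeff (P.derivative.eval g) ≠ 0) :
    g = h := by
  obtain ⟨k, hk⟩ := P.binomExpansion g (h - g)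
  rw [add_sub_cancel, hh, hg, zero_add] at hk
  have h1 : (P.derivative.eval g + k * (h - g)) * (h - g) = 0 := by rw [hk]; ring
  rcases mul_eq_zero.1 h1 with h2 | h2
  · refine absurd ?_ hd
    have := congrArg constantCoeff h2
    simpa [hgh] using this
  · exact (sub_eq_zero.1 h2).symm

theorem PowerSeries.exists_eval_eq_zero {Ω : Type*} [Field Ω] {P : (PowerSeries Ω)[X]}
    (hP : P.Monic) {η : Ω} (h0 : constantCoeff (P.eval (C η)) = 0)
    (h1 : constantCoeff (P.derivative.eval (C η)) ≠ 0) :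
    ∃ g, P.eval g = 0 ∧ constantCoeff g = η := by
  obtain ⟨y, hy, hyη⟩ := HenselianRing.is_henselian (I := Ideal.span {(X : PowerSeries Ω)})
    P hP (C η) (by rwa [Ideal.mem_span_singleton, X_dvd_iff]) (by
      refine IsUnit.map _ ?_
      rw [isUnit_iff_constantCoeff]
      exact isUnit_iff_ne_zero.2 h1)
  refine ⟨y, hy, ?_⟩
  rw [Ideal.mem_span_singleton, X_dvd_iff, map_sub, constantCoeff_C, sub_eq_zero] at hyη
  exact hyη

variable {R₀ k₀ L : Type*} [CommRing R₀] [IsDomain R₀] [Field k₀] [Field L] [Algebra R₀ k₀]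
  [IsFractionRing R₀ k₀] [Algebra k₀ L] [Algebra R₀ L] [IsScalarTower R₀ k₀ L]

variable (R₀ k₀ L) in
open scoped IntermediateField in
theorem exists_isIntegral_adjoin_eq_top [FiniteDimensional k₀ L] [Algebra.IsSeparable k₀ L] :
    ∃ γ : L, IsIntegral R₀ γ ∧ k₀⟮γ⟯ = ⊤ := by
  obtain ⟨α, hα⟩ := Field.exists_primitive_element k₀ L
  have hαalg : IsAlgebraic R₀ α := by
    rw [IsFractionRing.isAlgebraic_iff R₀ k₀ L]
    exact Algebra.IsAlgebraic.isAlgebraic α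
  obtain ⟨a, ha, h_int⟩ := hαalg.exists_integral_multiple
  have ha' : algebraMap R₀ k₀ a ≠ 0 := by
    rwa [Ne, IsFractionRing.to_map_eq_zero_iff]
  refine ⟨_, h_int, ?_⟩
  rw [← top_le_iff, ← hα, IntermediateField.adjoin_simple_le_iff]
  have := IntermediateField.smul_mem _
    (IntermediateField.mem_adjoin_simple_self k₀ (algebraMap R₀ k₀ a • α))
    (x := (algebraMap R₀ k₀ a)⁻¹)
  rw [smul_smul, inv_mul_cancel₀ ha', one_smul] at this
  rwa [← algebraMap_smul k₀ a α]

omit [IsDomain R₀] in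
theorem coe_eval₂_codRestrict (B : Subring L) (hR : ∀ b : R₀, algebraMap R₀ L b ∈ B) {x : L}
    (hx : x ∈ B) (u : R₀[X]) :
    ((u.eval₂ ((algebraMap R₀ L).codRestrict B hR) ⟨x, hx⟩ : B) : L) = aeval x u := by
  rw [aeval_def]
  exact hom_eval₂ u _ B.subtype _

variable {Ω M : Type*} [Field Ω] [Field M] [Algebra (PowerSeries Ω) M]
  [IsFractionRing (PowerSeries Ω) M]

omit [IsDomain R₀] [Algebra k₀ L] [IsScalarTower R₀ k₀ L] in
theorem eqOn_of_denominator {h₁ h₂ : L →+* M} {γ : L}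
    (h : ∀ b : R₀, h₁ (algebraMap R₀ L b) = h₂ (algebraMap R₀ L b)) (hγ : h₁ γ = h₂ γ)
    {z : L} {D : R₀} (hD : algebraMap R₀ L D ≠ 0) {u : R₀[X]}
    (hz : algebraMap R₀ L D * z = aeval γ u) : h₁ z = h₂ z := by
  have key : ∀ h : L →+* M, h (aeval γ u) = u.eval₂ (h.comp (algebraMap R₀ L)) (h γ) := fun h => by
    rw [aeval_def, hom_eval₂]
  have h1 : h₁ (aeval γ u) = h₂ (aeval γ u) := by
    rw [key, key, hγ]
    congr 1
    ext b
    exact h b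
  rw [← hz, map_mul, map_mul, ← h] at h1
  exact mul_left_cancel₀ (by simpa using hD) h1

/-- Hensel lifting: a Frobenius point of `L` deforms to a formal curve on which `σ` acts as the
coefficientwise Frobenius. -/
theorem exists_powerSeries_embedding [IsIntegrallyClosed R₀] [FiniteDimensional k₀ L]
    [Algebra.IsSeparable k₀ L] (p : ℕ) [Fact p.Prime] [CharP Ω p] (σ : L →ₐ[R₀] L)
    (G : Finset L) :
    ∃ X₀ : Finset L, ∀ (r : ℕ) (B : Subring L) (φ : B →+* Ω)
      (hR : ∀ b : R₀, algebraMap R₀ L b ∈ B) (hB : ∀ x ∈ X₀, x ∈ B)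
      (_ : ∀ x (hx : x ∈ X₀) (hσ : σ x ∈ X₀), φ ⟨σ x, hB _ hσ⟩ = φ ⟨x, hB _ hx⟩ ^ p ^ r)
      (j : R₀ →+* PowerSeries Ω) (_ : Function.Injective j)
      (_ : ∀ b, PowerSeries.constantCoeff (j b) = φ ⟨_, hR b⟩)
      (_ : ∀ b, PowerSeries.map (iterateFrobenius Ω p r) (j b) = j b) (Fr : M →+* M)
      (_ : ∀ h, Fr (algebraMap _ M h) =
        algebraMap _ M (PowerSeries.map (iterateFrobenius Ω p r) h)),
      ∃ ι : L →+* M, (∀ b, ι (algebraMap R₀ L b) = algebraMap _ M (j b)) ∧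
        (∀ z, ι (σ z) = Fr (ι z)) ∧ ∀ z ∈ G, ∃ h, ι z = algebraMap (PowerSeries Ω) M h := by
  classical
  obtain ⟨γ, h_int, hγ⟩ := exists_isIntegral_adjoin_eq_top R₀ k₀ L
  have hRinj : Function.Injective (algebraMap R₀ L) := by
    rw [IsScalarTower.algebraMap_eq R₀ k₀ L]
    exact (algebraMap k₀ L).injective.comp (IsFractionRing.injective R₀ k₀)
  set f := minpoly R₀ γ with hf
  have hfk : minpoly k₀ γ = f.map (algebraMap R₀ k₀) :=
    minpoly.isIntegrallyClosed_eq_field_fractions' k₀ h_int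
  have hfγ : aeval γ f = 0 := minpoly.aeval _ _
  have hfd : aeval γ (derivative f) ≠ 0 := by
    have h1 := (Algebra.IsSeparable.isSeparable k₀ γ).aeval_derivative_ne_zero (minpoly.aeval k₀ γ)
    rwa [hfk, derivative_map, aeval_map_algebraMap] at h1
  have hden : ∀ z : L, ∃ D : R₀, D ≠ 0 ∧ ∃ u : R₀[X], algebraMap R₀ L D * z = aeval γ u :=
    fun z => exists_denominator (K := k₀) (Algebra.IsAlgebraic.isAlgebraic γ) (by rw [hγ]; trivial)
  obtain ⟨D, hD, hDu⟩ := exists_common_denominator (A := R₀) (insert (σ γ) G) fun z _ => hden z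
  refine ⟨{γ, σ γ, (aeval γ (derivative f))⁻¹, (algebraMap R₀ L D)⁻¹}, ?_⟩
  intro r B φ hR hB hφ j hj hjφ hjF Fr hFr
  have hγB : γ ∈ B := hB _ (by simp)
  have hσB : σ γ ∈ B := hB _ (by simp)
  have hdB : (aeval γ (derivative f))⁻¹ ∈ B := hB _ (by simp)
  have hDB : (algebraMap R₀ L D)⁻¹ ∈ B := hB _ (by simp)
  set η := φ ⟨γ, hγB⟩ with hη
  have hησ : φ ⟨σ γ, hσB⟩ = η ^ p ^ r := hφ γ (by simp) (by simp)
  set cj : R₀ →+* Ω := (PowerSeries.constantCoeff (R := Ω)).comp j with hcj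
  have hcjφ : cj = φ.comp ((algebraMap R₀ L).codRestrict B hR) := RingHom.ext hjφ
  have hcc : ∀ (u : R₀[X]) (y : PowerSeries Ω),
      PowerSeries.constantCoeff (u.eval₂ j y) = u.eval₂ cj (PowerSeries.constantCoeff y) :=
    fun u y => hom_eval₂ _ _ _ _
  have hev : ∀ (u : R₀[X]) (x : L) (hx : x ∈ B) (hu : aeval x u ∈ B),
      u.eval₂ cj (φ ⟨x, hx⟩) = φ ⟨_, hu⟩ := by
    intro u x hx hu
    rw [hcjφ, ← hom_eval₂]
    exact congrArg φ (Subtype.ext (coe_eval₂_codRestrict B hR hx u))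
  have haevB : ∀ u : R₀[X], aeval γ u ∈ B := fun u => by
    rw [← coe_eval₂_codRestrict B hR hγB u]
    exact Subtype.property _
  have hne : ∀ (x : L) (hx : x ∈ B), x⁻¹ ∈ B → x ≠ 0 → φ ⟨x, hx⟩ ≠ 0 := by
    intro x hx hx' hx0 h0
    have : (⟨x, hx⟩ : B) * ⟨x⁻¹, hx'⟩ = 1 := Subtype.ext (mul_inv_cancel₀ hx0)
    have := congrArg φ this
    rw [map_mul, h0, zero_mul, map_one] at this
    exact zero_ne_one this
  have hdη : (derivative f).eval₂ cj η ≠ 0 := by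
    rw [hev _ _ _ (haevB _)]
    exact hne _ _ hdB hfd
  obtain ⟨g, hg, hgη⟩ := PowerSeries.exists_eval_eq_zero (P := f.map j) (η := η)
    ((minpoly.monic h_int).map j) (by
      rw [eval_map, hcc, PowerSeries.constantCoeff_C, hev _ _ _ (haevB _)]
      exact (congrArg φ (Subtype.ext hfγ)).trans (map_zero φ)) (by
      rwa [derivative_map, eval_map, hcc, PowerSeries.constantCoeff_C])
  rw [eval_map] at hg
  have hjM : Function.Injective ((algebraMap (PowerSeries Ω) M).comp j) :=
    (IsFractionRing.injective _ _).comp hj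
  let _ : Algebra k₀ M := (IsFractionRing.lift hjM : k₀ →+* M).toAlgebra
  have hkM : ∀ b : R₀, algebraMap k₀ M (algebraMap R₀ k₀ b) = algebraMap _ M (j b) := fun b =>
    IsFractionRing.lift_algebraMap hjM b
  let pb := PowerBasis.ofAdjoinEqTop (Algebra.IsIntegral.isIntegral (R := k₀) γ) (by
    rw [← IntermediateField.adjoin_simple_toSubalgebra_of_isAlgebraic
      (Algebra.IsAlgebraic.isAlgebraic γ), hγ, IntermediateField.top_toSubalgebra])
  have hpb : pb.gen = γ := PowerBasis.ofAdjoinEqTop_gen _ _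
  have hgM : aeval (algebraMap _ M g) (minpoly k₀ pb.gen) = 0 := by
    rw [hpb, hfk, aeval_def, eval₂_map]
    have h1 : (algebraMap k₀ M).comp (algebraMap R₀ k₀) = (algebraMap (PowerSeries Ω) M).comp j :=
      RingHom.ext hkM
    rw [h1, ← hom_eval₂, hg, map_zero]
  let ι : L →ₐ[k₀] M := pb.lift (algebraMap _ M g) hgM
  have hιγ : ι γ = algebraMap _ M g := by
    have := pb.lift_gen (algebraMap _ M g) hgM
    rwa [hpb] at this
  have hιR : ∀ b, ι (algebraMap R₀ L b) = algebraMap _ M (j b) := fun b => by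
    rw [IsScalarTower.algebraMap_apply R₀ k₀ L, ι.commutes, hkM]
  have hιu : ∀ u : R₀[X], ι (aeval γ u) = algebraMap _ M (u.eval₂ j g) := by
    intro u
    rw [aeval_def]
    refine (hom_eval₂ u (algebraMap R₀ L) (ι : L →+* M) γ).trans ?_
    rw [hom_eval₂]
    congr 1
    exact RingHom.ext hιR
  have hDL : algebraMap R₀ L D ≠ 0 := fun h => hD (hRinj (by rw [h, map_zero]))
  have hDφ := hne _ (hR D) hDB hDL
  have hDunit : IsUnit (j D) := by
    rw [PowerSeries.isUnit_iff_constantCoeff, hjφ]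
    exact isUnit_iff_ne_zero.2 hDφ
  have hgood : ∀ z ∈ insert (σ γ) G, ∃ h, ι z = algebraMap (PowerSeries Ω) M h ∧
      ∀ hz : z ∈ B, PowerSeries.constantCoeff h = φ ⟨z, hz⟩ := by
    intro z hz
    obtain ⟨u, hu⟩ := hDu z hz
    obtain ⟨d, hd⟩ := hDunit.exists_right_inv
    have h0 : algebraMap _ M (j D) * ι z = algebraMap _ M (u.eval₂ j g) := by
      rw [← hιu, ← hu, map_mul, hιR]
    refine ⟨d * u.eval₂ j g, ?_, fun hzB => ?_⟩
    · rw [map_mul, ← h0, ← mul_assoc, ← map_mul, mul_comm d, hd, map_one, one_mul]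
    · have h1 : PowerSeries.constantCoeff (u.eval₂ j g) =
          PowerSeries.constantCoeff (j D) * φ ⟨z, hzB⟩ := by
        rw [hcc, hgη, hev _ _ _ (haevB _), hjφ, ← map_mul]
        exact congrArg φ (Subtype.ext hu.symm)
      rw [map_mul, h1, ← mul_assoc, ← map_mul, mul_comm d, hd, map_one, one_mul]
  obtain ⟨h, hh, hhφ⟩ := hgood _ (Finset.mem_insert_self _ _)
  have hroot : ∀ y : L, aeval y f = 0 → ∀ h, ι y = algebraMap _ M h → f.eval₂ j h = 0 := by
    intro y hy h hh
    apply IsFractionRing.injective (PowerSeries Ω) M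
    rw [map_zero, hom_eval₂, ← hh]
    have h1 : (algebraMap (PowerSeries Ω) M).comp j = (ι : L →+* M).comp (algebraMap R₀ L) :=
      RingHom.ext fun b => (hιR b).symm
    rw [h1]
    refine (hom_eval₂ f (algebraMap R₀ L) (ι : L →+* M) y).symm.trans ?_
    rw [← aeval_def, hy, map_zero]
  have hfr : (PowerSeries.map (iterateFrobenius Ω p r)).comp j = j := RingHom.ext hjF
  have hmapcc : ∀ h : PowerSeries Ω, PowerSeries.constantCoeff
      (PowerSeries.map (iterateFrobenius Ω p r) h) =
        iterateFrobenius Ω p r (PowerSeries.constantCoeff h) := fun h => by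
    rw [← PowerSeries.coeff_zero_eq_constantCoeff_apply, PowerSeries.coeff_map,
      PowerSeries.coeff_zero_eq_constantCoeff_apply]
  have hcfr : (iterateFrobenius Ω p r).comp cj = cj := by
    ext b
    have := congrArg PowerSeries.constantCoeff (hjF b)
    rwa [hmapcc] at this
  have hσγ : ι (σ γ) = Fr (ι γ) := by
    rw [hιγ, hFr, hh]
    congr 1
    have hgF : PowerSeries.constantCoeff (PowerSeries.map (iterateFrobenius Ω p r) g) =
        η ^ p ^ r := by
      rw [hmapcc, hgη, iterateFrobenius_def]
    refine (PowerSeries.eq_of_eval_eq_zero (P := f.map j) ?_ ?_ ?_ ?_).symm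
    · have := hom_eval₂ f j (PowerSeries.map (iterateFrobenius Ω p r)) g
      rw [eval_map]
      rw [hg, map_zero, hfr] at this
      exact this.symm
    · rw [eval_map]
      exact hroot _ (by rw [aeval_algHom_apply, hfγ, map_zero]) _ hh
    · rw [hhφ hσB, hησ, hgF]
    · rw [derivative_map, eval_map, hcc, hgF]
      have := hom_eval₂ (derivative f) cj (iterateFrobenius Ω p r) η
      rw [hcfr, iterateFrobenius_def, iterateFrobenius_def] at this
      rw [← this]
      exact pow_ne_zero _ hdη
  refine ⟨ι, hιR, fun z => ?_, fun z hz => ?_⟩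
  · obtain ⟨D', hD', u, hu⟩ := hden z
    refine eqOn_of_denominator (h₁ := (ι : L →+* M).comp (σ : L →+* L))
      (h₂ := Fr.comp (ι : L →+* M)) (fun b => ?_) hσγ
      (fun h => hD' (hRinj (by rw [h, map_zero]))) hu
    change ι (σ (algebraMap R₀ L b)) = Fr (ι (algebraMap R₀ L b))
    rw [σ.commutes, hιR, hFr, hjF]
  · obtain ⟨h, hh, -⟩ := hgood z (Finset.mem_insert_of_mem hz)
    exact ⟨h, hh⟩
end Lift

section Curve

theorem Algebra.countable_adjoin (F : Type*) {A : Type*} [CommRing F] [CommRing A] [Algebra F A]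
    [Countable F] {S : Set A} (hS : S.Countable) : Countable (Algebra.adjoin F S) := by
  have := hS.to_subtype
  rw [Algebra.adjoin_eq_range]
  have : Countable (MvPolynomial S F) := by
    rw [← Cardinal.mk_le_aleph0_iff]
    simpa using MvPolynomial.cardinalMk_le_max_lift (σ := S) (R := F)
  exact Set.countable_coe_iff.2 (Set.countable_range _)

theorem PowerSeries.exists_transcendental (F : Type*) {Ω : Type*} [Field F] [Countable F] [Field Ω]
    [Algebra F Ω] {S : Set (PowerSeries Ω)} (hS : S.Countable) (a : Ω) :
    ∃ c : ℕ → F, Transcendental (Algebra.adjoin F S)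
      (C a + X * (1 + X * mk fun n => algebraMap F Ω (c n))) := by
  by_contra! h
  simp only [Transcendental, not_not] at h
  have := Algebra.countable_adjoin F hS
  have h1 := Algebraic.countable (Algebra.adjoin F S) (PowerSeries Ω)
  let e : (ℕ → F) → {x : PowerSeries Ω | IsAlgebraic (Algebra.adjoin F S) x} := fun c => ⟨_, h c⟩
  have he : Function.Injective e := by
    intro c d hcd
    have h2 := add_left_cancel (congrArg Subtype.val hcd)
    have h3 := mul_left_cancel₀ X_ne_zero (add_left_cancel (mul_left_cancel₀ X_ne_zero h2))
    funext n
    have h4 := congrArg (coeff n) h3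
    rw [coeff_mk, coeff_mk] at h4
    exact (algebraMap F Ω).injective h4
  have := h1.to_subtype
  have h5 : Countable (ℕ → F) := he.countable
  obtain ⟨f, hf⟩ := exists_surjective_nat (ℕ → F)
  obtain ⟨m, hm⟩ := hf fun n => f n n + 1
  simpa using congrFun hm m

/-- A general formal arc over `𝔽_q` through a given `𝔽_q`-point of affine space. -/
theorem PowerSeries.exists_algebraicIndepOn (p r : ℕ) [Fact p.Prime] {U Ω : Type*} [Field Ω]
    [CharP Ω p] [Algebra (ZMod p) Ω] (a : U → Ω) (S : Finset U)
    (ha : ∀ i ∈ S, a i ^ p ^ r = a i) :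
    ∃ τ : U → PowerSeries Ω, (∀ i ∈ S, constantCoeff (τ i) = a i ∧
      coeff 1 (τ i) = 1 ∧ map (iterateFrobenius Ω p r) (τ i) = τ i) ∧
      AlgebraicIndepOn (ZMod p) τ (S : Set U) := by
  classical
  induction S using Finset.induction_on with
  | empty =>
    refine ⟨0, by simp, ?_⟩
    rw [Finset.coe_empty, AlgebraicIndepOn, algebraicIndependent_empty_type_iff]
    exact (algebraMap (ZMod p) (PowerSeries Ω)).injective
  | insert t S ht ih =>
    obtain ⟨τ, hτ, hind⟩ := ih fun i hi => ha i (Finset.mem_insert_of_mem hi)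
    obtain ⟨c, hc⟩ := exists_transcendental (ZMod p) (S := τ '' S)
      (S.countable_toSet.image τ) (a t)
    refine ⟨Function.update τ t
      (C (a t) + X * (1 + X * mk fun n => algebraMap (ZMod p) Ω (c n))), fun i hi => ?_, ?_⟩
    · rcases eq_or_ne i t with rfl | hit
      · rw [Function.update_self]
        refine ⟨by simp, ?_, ?_⟩
        · rw [map_add, show (1 : ℕ) = 0 + 1 from rfl, coeff_succ_X_mul]
          simp
        · have h1 : map (iterateFrobenius Ω p r) (mk fun n => algebraMap (ZMod p) Ω (c n)) =
              mk fun n => algebraMap (ZMod p) Ω (c n) := by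
            ext n
            rw [coeff_map, coeff_mk, iterateFrobenius_def, ← map_pow, ZMod.pow_card_pow]
          rw [map_add, map_mul, map_add, map_mul, h1, map_one, map_X, map_C,
            iterateFrobenius_def, ha i hi]
      · rw [Function.update_of_ne hit]
        exact hτ i (Finset.mem_of_mem_insert_of_ne hi hit)
    · rw [Finset.coe_insert]
      have hS : ∀ i ∈ (S : Set U), Function.update τ t
          (C (a t) + X * (1 + X * mk fun n => algebraMap (ZMod p) Ω (c n))) i = τ i := by
        intro i hi
        exact Function.update_of_ne (by rintro rfl; exact ht hi) _ _
      refine AlgebraicIndepOn.insert ?_ ?_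
      · have h1 : (fun i : (S : Set U) => Function.update τ t
            (C (a t) + X * (1 + X * mk fun n => algebraMap (ZMod p) Ω (c n))) i) =
            fun i : (S : Set U) => τ i := funext fun i => hS i i.2
        rw [AlgebraicIndepOn, h1]
        exact hind
      · rw [Function.update_self, Set.image_congr hS]
        exact hc
end Curve

section Arc

theorem AlgebraicIndepOn.image_algHom {F L U : Type*} [CommRing F] [CommRing L] [CommRing U]
    [Algebra F L] [Algebra F U] {S : Set L} (hS : AlgebraicIndepOn F id S) (f : L →ₐ[F] U)
    (hf : Function.Injective f) : AlgebraicIndepOn F id (f '' S) := by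
  have h1 : AlgebraicIndependent F (f ∘ fun i : S => id (i : L)) := hS.map' hf
  have h2 := h1.coe_range
  have h3 : Set.range (f ∘ fun i : S => id (i : L)) = f '' S := by
    rw [Set.range_comp]
    congr 1
    exact Subtype.range_coe
  rwa [h3] at h2

theorem AlgebraicIndepOn.exists_adjoin_hom {F L A : Type*} [CommRing F] [CommRing L] [CommRing A]
    [Algebra F L] [Algebra F A] {S : Set L} (hS : AlgebraicIndepOn F id S) {τ : L → A}
    (hτ : AlgebraicIndepOn F τ S) :
    ∃ j : Algebra.adjoin F S →ₐ[F] A, Function.Injective j ∧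
      ∀ i (hi : i ∈ S), j ⟨i, Algebra.subset_adjoin hi⟩ = τ i := by
  have key : ∀ T, Set.range (fun i : S => (i : L)) = T → ∃ j : Algebra.adjoin F T →ₐ[F] A,
      Function.Injective j ∧ ∀ i (hi : i ∈ S) (hi' : i ∈ Algebra.adjoin F T), j ⟨i, hi'⟩ = τ i := by
    rintro _ rfl
    have hS : AlgebraicIndependent F (fun i : S => (i : L)) := hS
    have hτ : Function.Injective (MvPolynomial.aeval (R := F) fun i : S => τ i) := hτ
    refine ⟨(MvPolynomial.aeval fun i : S => τ i).comp hS.aevalEquiv.symm.toAlgHom,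
      hτ.comp hS.aevalEquiv.symm.injective, fun i hi hi' => ?_⟩
    have h1 : hS.aevalEquiv (MvPolynomial.X ⟨i, hi⟩) = ⟨i, hi'⟩ := Subtype.ext (by simp)
    have h2 : hS.aevalEquiv.symm ⟨i, hi'⟩ = MvPolynomial.X ⟨i, hi⟩ := by
      rw [← h1, AlgEquiv.symm_apply_apply]
    change MvPolynomial.aeval _ (hS.aevalEquiv.symm ⟨i, hi'⟩) = _
    rw [h2, MvPolynomial.aeval_X]
  obtain ⟨j, hj, h⟩ := key S Subtype.range_coe
  exact ⟨j, hj, fun i hi => h i hi _⟩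

theorem AlgebraicIndepOn.isIntegrallyClosed_adjoin {F L : Type*} [Field F] [CommRing L]
    [Algebra F L] {S : Set L} (hS : AlgebraicIndepOn F id S) :
    IsIntegrallyClosed (Algebra.adjoin F S) := by
  have key : ∀ T, Set.range (fun i : S => (i : L)) = T →
      IsIntegrallyClosed (Algebra.adjoin F T) := by
    rintro _ rfl
    have hS : AlgebraicIndependent F (fun i : S => (i : L)) := hS
    exact IsIntegrallyClosed.of_equiv hS.aevalEquiv.toRingEquiv
  exact key S Subtype.range_coe

theorem adjoin_zmod_ringHom_ext {p : ℕ} {L T : Type*} [CommRing L] [Semiring T]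
    [Algebra (ZMod p) L] {S : Set L} {f g : Algebra.adjoin (ZMod p) S →+* T}
    (h : ∀ i (hi : i ∈ S), f ⟨i, Algebra.subset_adjoin hi⟩ = g ⟨i, Algebra.subset_adjoin hi⟩) :
    f = g := by
  ext ⟨x, hx⟩
  induction hx using Algebra.adjoin_induction with
  | mem x hx => exact h x hx
  | algebraMap r =>
    exact RingHom.congr_fun (Subsingleton.elim
      (f.comp (algebraMap (ZMod p) (Algebra.adjoin (ZMod p) S)))
      (g.comp (algebraMap (ZMod p) (Algebra.adjoin (ZMod p) S)))) r
  | add x y hx hy h1 h2 =>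
    exact (map_add f ⟨x, hx⟩ ⟨y, hy⟩).trans (by rw [h1, h2, ← map_add])
  | mul x y hx hy h1 h2 =>
    exact (map_mul f ⟨x, hx⟩ ⟨y, hy⟩).trans (by rw [h1, h2, ← map_mul])

theorem adjoin_zmod_le_subring {p : ℕ} {L : Type*} [CommRing L] [Algebra (ZMod p) L] {S : Set L}
    {B : Subring L} (h : S ⊆ B) {x : L} (hx : x ∈ Algebra.adjoin (ZMod p) S) : x ∈ B := by
  induction hx using Algebra.adjoin_induction with
  | mem x hx => exact h hx
  | algebraMap r =>
    obtain ⟨n, rfl⟩ := ZMod.intCast_surjective r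
    rw [map_intCast]
    exact intCast_mem B n
  | add x y _ _ h1 h2 => exact B.add_mem h1 h2
  | mul x y _ _ h1 h2 => exact B.mul_mem h1 h2

variable {L Ω M : Type*} [Field L] [Field Ω] [Field M] [Algebra (PowerSeries Ω) M]
  [IsFractionRing (PowerSeries Ω) M]

/-- The valuation ring and place of `L` attached to a formal arc. -/
theorem exists_valuationSubring_of_arc (ι : L →+* M) :
    ∃ (w : ValuationSubring L) (ev : w →+* Ω),
      (∀ z, z ∈ w ↔ ∃ h, ι z = algebraMap (PowerSeries Ω) M h) ∧
      ∀ z (hz : z ∈ w) h, ι z = algebraMap (PowerSeries Ω) M h →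
        ev ⟨z, hz⟩ = PowerSeries.constantCoeff h := by
  have hinj := IsFractionRing.injective (PowerSeries Ω) M
  let e : PowerSeries Ω ≃+* (algebraMap (PowerSeries Ω) M).range :=
    RingEquiv.ofBijective (algebraMap (PowerSeries Ω) M).rangeRestrict
      ⟨fun a b hab => hinj (congrArg Subtype.val hab), RingHom.rangeRestrict_surjective _⟩
  let w : ValuationSubring L :=
    { (algebraMap (PowerSeries Ω) M).range.comap ι with
      mem_or_inv_mem' := fun x => by
        change ι x ∈ (algebraMap (PowerSeries Ω) M).range ∨
          ι x⁻¹ ∈ (algebraMap (PowerSeries Ω) M).range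
        rw [map_inv₀]
        exact ValuationRing.isInteger_or_isInteger (PowerSeries Ω) (ι x) }
  have hw : ∀ z, z ∈ w ↔ ∃ h, ι z = algebraMap (PowerSeries Ω) M h := fun z =>
    ⟨fun ⟨h, hh⟩ => ⟨h, hh.symm⟩, fun ⟨h, hh⟩ => ⟨h, hh.symm⟩⟩
  let i : w →+* (algebraMap (PowerSeries Ω) M).range :=
    (ι.comp w.subtype).codRestrict _ fun z => z.2
  refine ⟨w, (PowerSeries.constantCoeff (R := Ω)).comp ((e.symm : _ →+* _).comp i), hw,
    fun z hz h hh => ?_⟩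
  change PowerSeries.constantCoeff (e.symm (i ⟨z, hz⟩)) = _
  have h1 : i ⟨z, hz⟩ = e h := Subtype.ext hh
  rw [h1, RingEquiv.symm_apply_apply]

theorem mem_nonunits_of_arc {ι : L →+* M} {w : ValuationSubring L} {ev : w →+* Ω}
    (hw : ∀ z, z ∈ w ↔ ∃ h, ι z = algebraMap (PowerSeries Ω) M h)
    (hev : ∀ z (hz : z ∈ w) h, ι z = algebraMap (PowerSeries Ω) M h →
      ev ⟨z, hz⟩ = PowerSeries.constantCoeff h) (z : w) :
    ev z = 0 ↔ (z : L) ∈ w.nonunits := by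
  have hinj := IsFractionRing.injective (PowerSeries Ω) M
  obtain ⟨z, hz⟩ := z
  rw [ValuationSubring.mem_nonunits_iff_or]
  rcases eq_or_ne z 0 with rfl | hz0
  · exact ⟨fun _ => Or.inl rfl, fun _ => map_zero ev⟩
  obtain ⟨h, hh⟩ := (hw z).1 hz
  rw [hev z hz h hh]
  refine ⟨fun h0 => Or.inr fun hz' => ?_, fun hz' => ?_⟩
  · have h1 : ev ⟨z, hz⟩ * ev ⟨z⁻¹, hz'⟩ = 1 := by
      rw [← map_mul, ← map_one ev]
      exact congrArg ev (Subtype.ext (mul_inv_cancel₀ hz0))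
    rw [hev z hz h hh, h0, zero_mul] at h1
    exact zero_ne_one h1
  · by_contra h0
    refine hz'.resolve_left hz0 ?_
    have hu : IsUnit h := by
      rw [PowerSeries.isUnit_iff_constantCoeff]
      exact isUnit_iff_ne_zero.2 h0
    obtain ⟨d, hd⟩ := hu.exists_right_inv
    refine (hw _).2 ⟨d, ?_⟩
    rw [map_inv₀, hh]
    exact inv_eq_of_mul_eq_one_right (by rw [← map_mul, hd, map_one])

theorem exists_valuation_eq_zpow_of_arc {ι : L →+* M} {w : ValuationSubring L}
    (hw : ∀ z, z ∈ w ↔ ∃ h, ι z = algebraMap (PowerSeries Ω) M h) {π : L} {ϖ : PowerSeries Ω}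
    (hϖ : Irreducible ϖ) (hπ : ι π = algebraMap _ M ϖ) {z : L} (hz : z ≠ 0) :
    ∃ n : ℤ, w.valuation z = w.valuation π ^ n := by
  have hinj := IsFractionRing.injective (PowerSeries Ω) M
  have hunit : ∀ u : (PowerSeries Ω)ˣ, ∀ y : L, ι y = algebraMap _ M (u : PowerSeries Ω) →
      w.valuation y = 1 := by
    intro u y hy
    refine le_antisymm ((w.valuation_le_one_iff _).2 ((hw _).2 ⟨_, hy⟩)) ?_
    have h1 : y⁻¹ ∈ w := (hw _).2 ⟨((u⁻¹ : (PowerSeries Ω)ˣ) : PowerSeries Ω), by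
      rw [map_inv₀, hy]
      exact inv_eq_of_mul_eq_one_right (by rw [← map_mul, u.mul_inv, map_one])⟩
    have hy0 : y ≠ 0 := by
      rintro rfl
      rw [map_zero] at hy
      exact u.ne_zero (hinj (by rw [← hy, map_zero]))
    rw [← w.valuation_le_one_iff, map_inv₀] at h1
    exact (inv_le_one₀ (zero_lt_iff.2 ((Valuation.ne_zero_iff _).2 hy0))).1 h1
  have hϖM : algebraMap _ M ϖ ≠ 0 := fun h => hϖ.ne_zero (hinj (by rw [h, map_zero]))
  have hπ0 : π ≠ 0 := by
    rintro rfl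
    exact hϖM (by rw [← hπ, map_zero])
  have key : ∀ y : L, y ≠ 0 → y ∈ w → ∃ n : ℕ, w.valuation y = w.valuation π ^ n := by
    intro y hy hyw
    obtain ⟨h, hh⟩ := (hw y).1 hyw
    have hh0 : h ≠ 0 := by
      rintro rfl
      rw [map_zero, map_eq_zero] at hh
      exact hy hh
    obtain ⟨n, u, hu⟩ := IsDiscreteValuationRing.eq_unit_mul_pow_irreducible hh0 hϖ
    refine ⟨n, ?_⟩
    have h1 := hunit u (y / π ^ n) (by
      rw [map_div₀, map_pow, hπ, hh, hu, map_mul, map_pow,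
        mul_div_cancel_right₀ _ (pow_ne_zero _ hϖM)])
    rw [map_div₀, map_pow] at h1
    exact eq_of_div_eq_one h1
  rcases w.mem_or_inv_mem z with h | h
  · obtain ⟨n, hn⟩ := key z hz h
    exact ⟨n, by rw [hn, zpow_natCast]⟩
  · obtain ⟨n, hn⟩ := key _ (inv_ne_zero hz) h
    refine ⟨-n, ?_⟩
    rw [zpow_neg, zpow_natCast, ← hn, map_inv₀, inv_inv]

theorem irreducible_pow_sub_self (p r : ℕ) [Fact p.Prime] [CharP Ω p] (hr : 0 < r)
    {T : PowerSeries Ω} (h0 : PowerSeries.constantCoeff T ^ p ^ r = PowerSeries.constantCoeff T)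
    (h1 : PowerSeries.coeff 1 T = 1) : Irreducible (T ^ p ^ r - T) := by
  have : CharP (PowerSeries Ω) p := charP_of_injective_algebraMap
    (algebraMap Ω (PowerSeries Ω)).injective p
  have hp := Fact.out (p := p.Prime)
  obtain ⟨V, hV⟩ := PowerSeries.X_dvd_iff.2
    (show PowerSeries.constantCoeff (T - PowerSeries.C (PowerSeries.constantCoeff T)) = 0 by simp)
  have hT : T = PowerSeries.C (PowerSeries.constantCoeff T) + PowerSeries.X * V := by
    rw [← hV]; ring
  have hV1 : PowerSeries.constantCoeff V = 1 := by
    rw [hT, map_add, show (1 : ℕ) = 0 + 1 from rfl, PowerSeries.coeff_succ_X_mul] at h1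
    simpa [PowerSeries.coeff_C] using h1
  obtain ⟨m, hm⟩ : ∃ m, p ^ r = m + 2 := by
    have : 2 ≤ p ^ r := hp.two_le.trans (Nat.le_self_pow hr.ne' p)
    exact ⟨p ^ r - 2, by omega⟩
  have h2 : T ^ p ^ r - T =
      PowerSeries.X * (PowerSeries.X * (PowerSeries.X ^ m * V ^ p ^ r) - V) := by
    have h3 : T ^ p ^ r = PowerSeries.C (PowerSeries.constantCoeff T) +
        PowerSeries.X ^ p ^ r * V ^ p ^ r := by
      conv_lhs => rw [hT]
      rw [add_pow_char_pow, ← map_pow, h0, mul_pow]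
    rw [h3]
    conv_lhs => rw [hT]
    simp only [map_add, map_mul, PowerSeries.constantCoeff_C, PowerSeries.constantCoeff_X, zero_mul,
      add_zero]
    generalize V ^ p ^ r = W
    rw [hm]
    ring
  rw [h2]
  have hu : IsUnit (PowerSeries.X * (PowerSeries.X ^ m * V ^ p ^ r) - V) := by
    rw [PowerSeries.isUnit_iff_constantCoeff]
    simp [hV1]
  obtain ⟨u, hu⟩ := hu
  rw [← hu]
  exact (irreducible_mul_units u).2 PowerSeries.X_irreducible
end Arc

section Place

theorem IntermediateField.isAlgebraic_adjoin_image {F L U : Type*} [Field F] [Field L] [Field U]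
    [Algebra F L] [Algebra F U] (f : L →ₐ[F] U) {S : Set L} {x : L}
    (hx : IsAlgebraic (IntermediateField.adjoin F S) x) :
    IsAlgebraic (IntermediateField.adjoin F (f '' S)) (f x) := by
  let φ : IntermediateField.adjoin F S →+* IntermediateField.adjoin F (f '' S) :=
    (f.toRingHom.comp (algebraMap (IntermediateField.adjoin F S) L)).codRestrict _ fun x => by
      rw [← IntermediateField.adjoin_map]
      exact ⟨x, x.2, rfl⟩
  exact (hx.isIntegral.map_of_comp_eq φ f.toRingHom rfl).isAlgebraic

open scoped IntermediateField.algebraAdjoinAdjoin in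
/-- A finite extension of a rational function field over `ZMod p`, together with an automorphism
fixing the variables, has a discrete place on whose residue field the automorphism acts as a
prescribed power of Frobenius. -/
theorem exists_place (p : ℕ) [Fact p.Prime] {L Ω : Type*} [Field L] [Field Ω] [Algebra (ZMod p) L]
    [CharP Ω p] [IsAlgClosed Ω] {t : L} {s : Finset L} (ht : t ∉ s)
    (hS : AlgebraicIndepOn (ZMod p) id (insert t (s : Set L)))
    [FiniteDimensional (IntermediateField.adjoin (ZMod p) (insert t (s : Set L))) L]
    [Algebra.IsSeparable (IntermediateField.adjoin (ZMod p) (insert t (s : Set L))) L]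
    (σ : L ≃+* L) (hσ : ∀ x ∈ insert t (s : Set L), σ x = x) (G : Finset L) :
    ∃ (r : ℕ) (w : ValuationSubring L) (ev : w →+* Ω) (ht : t ∈ w), 0 < r ∧ (∀ x ∈ G, x ∈ w) ∧
      (∀ z : w, ev z = 0 ↔ (z : L) ∈ w.nonunits) ∧
      (∀ z (hz : z ∈ w), ∃ h : σ z ∈ w, ev ⟨σ z, h⟩ = ev ⟨z, hz⟩ ^ p ^ r) ∧
      (∀ m, 0 < m → ev ⟨t, ht⟩ ^ p ^ m = ev ⟨t, ht⟩ → r ≤ m) ∧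
      t ^ p ^ r - t ≠ 0 ∧ t ^ p ^ r - t ∈ w.nonunits ∧
      ∀ z, z ≠ 0 → ∃ n : ℤ, w.valuation z = w.valuation (t ^ p ^ r - t) ^ n := by
  classical
  let _ : Algebra (ZMod p) Ω := ZMod.algebra Ω p
  let U := AlgebraicClosure L
  let f : L →ₐ[ZMod p] U := IsScalarTower.toAlgHom (ZMod p) L U
  have : CharP U p := charP_of_injective_algebraMap (algebraMap (ZMod p) U).injective p
  let M := FractionRing (PowerSeries Ω)
  let R₀ := Algebra.adjoin (ZMod p) (insert t (s : Set L))
  let k₀ := IntermediateField.adjoin (ZMod p) (insert t (s : Set L))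
  have hic : IsIntegrallyClosed R₀ := hS.isIntegrallyClosed_adjoin
  have hσR : ∀ b : R₀, σ b = b := fun b =>
    RingHom.congr_fun (adjoin_zmod_ringHom_ext (f := σ.toRingHom.comp (algebraMap R₀ L))
      (g := algebraMap R₀ L) hσ) b
  let σR : L →ₐ[R₀] L := { σ.toRingHom with commutes' := hσR }
  obtain ⟨X₀, hX₀⟩ := exists_powerSeries_embedding (R₀ := R₀) (k₀ := k₀) (Ω := Ω) (M := M) p σR G
  let σU : U ≃+* U := IsAlgClosure.equivOfEquiv U U σ
  have hσU : ∀ x, σU (f x) = f (σ x) := IsAlgClosure.equivOfEquiv_algebraMap U U σ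
  have himg : insert (f t) ((s.image f : Finset U) : Set U) = f '' insert t (s : Set L) := by
    rw [Set.image_insert_eq, Finset.coe_image]
  obtain ⟨r, B, φ, hB, htB, hr, hφ, hφt, hφm⟩ := exists_frobenius_point p (Ω := Ω) (σU : U →+* U)
    (s.image f) (t := f t) (fun h => by
      obtain ⟨y, hy, hyt⟩ := Finset.mem_image.1 h
      exact ht (f.injective hyt ▸ hy))
    (by rw [himg]; exact hS.image_algHom f f.injective)
    ((hσU t).trans (congrArg f (hσ t (Set.mem_insert _ _))))
    (by
      intro x hx
      obtain ⟨y, hy, rfl⟩ := Finset.mem_image.1 hx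
      exact (hσU y).trans (congrArg f (hσ y (Set.mem_insert_of_mem _ hy))))
    ((X₀ ∪ insert t s).image f)
    (by
      intro x hx
      obtain ⟨y, -, rfl⟩ := Finset.mem_image.1 hx
      rw [himg]
      exact IntermediateField.isAlgebraic_adjoin_image f (Algebra.IsAlgebraic.isAlgebraic y))
  have hX : ∀ x ∈ X₀ ∪ insert t s, f x ∈ B := fun x hx => hB _ (Finset.mem_image_of_mem f hx)
  have hφ' : ∀ x ∈ X₀ ∪ insert t s, σ x ∈ X₀ ∪ insert t s → ∀ (h : f (σ x) ∈ B) (h' : f x ∈ B),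
      φ ⟨f (σ x), h⟩ = φ ⟨f x, h'⟩ ^ p ^ r := by
    intro x hx hx' h h'
    have h1 := hφ (f x) (Finset.mem_image_of_mem f hx)
      (by change σU (f x) ∈ _; rw [hσU]; exact Finset.mem_image_of_mem f hx')
    rw [← h1]
    exact congrArg φ (Subtype.ext (hσU x).symm)
  let B' : Subring L := B.comap f.toRingHom
  let φ' : B' →+* Ω := φ.comp ((f.toRingHom.comp B'.subtype).codRestrict B fun z => z.2)
  have hSB : insert t (s : Set L) ⊆ B' := fun x hx => hX x (Finset.mem_union_right _ (by
    rw [← Finset.mem_coe, Finset.coe_insert]; exact hx))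
  have hR : ∀ b : R₀, algebraMap R₀ L b ∈ B' := fun b => adjoin_zmod_le_subring hSB b.2
  have hSφ : ∀ x (hx : x ∈ insert t (s : Set L)), φ' ⟨x, hSB hx⟩ ^ p ^ r = φ' ⟨x, hSB hx⟩ := by
    intro x hx
    have hx' : x ∈ X₀ ∪ insert t s := Finset.mem_union_right _ (by
      rw [← Finset.mem_coe, Finset.coe_insert]; exact hx)
    refine (hφ' x hx' (by rwa [hσ x hx]) (by rw [hσ x hx]; exact hSB hx) (hSB hx)).symm.trans ?_
    exact congrArg φ (Subtype.ext (congrArg f (hσ x hx)))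
  let a : L → Ω := fun x => if hx : x ∈ B' then φ' ⟨x, hx⟩ else 0
  have ha : ∀ x (hx : x ∈ insert t (s : Set L)), a x = φ' ⟨x, hSB hx⟩ := fun x hx =>
    dif_pos (hSB hx)
  obtain ⟨τ, hτ, hτS⟩ := PowerSeries.exists_algebraicIndepOn p r a (insert t s) (by
    intro x hx
    rw [← Finset.mem_coe, Finset.coe_insert] at hx
    rw [ha x hx, hSφ x hx])
  rw [Finset.coe_insert] at hτS
  obtain ⟨j, hj, hjτ⟩ := hS.exists_adjoin_hom hτS
  have hmem : ∀ x ∈ insert t (s : Set L), x ∈ insert t s := fun x hx => by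
    rwa [← Finset.mem_coe, Finset.coe_insert]
  have hjc : ∀ b : R₀, PowerSeries.constantCoeff (j b) = φ' ⟨algebraMap R₀ L b, hR b⟩ :=
    RingHom.congr_fun (adjoin_zmod_ringHom_ext
      (f := (PowerSeries.constantCoeff (R := Ω)).comp j.toRingHom)
      (g := φ'.comp ((algebraMap R₀ L).codRestrict B' hR)) fun x hx => by
        change PowerSeries.constantCoeff (j ⟨x, _⟩) = φ' ⟨x, hSB hx⟩
        rw [hjτ x hx, (hτ x (hmem x hx)).1, ha x hx])
  have hjF : ∀ b : R₀, PowerSeries.map (iterateFrobenius Ω p r) (j b) = j b :=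
    RingHom.congr_fun (adjoin_zmod_ringHom_ext
      (f := (PowerSeries.map (iterateFrobenius Ω p r)).comp j.toRingHom)
      (g := j.toRingHom) fun x hx => by
        change PowerSeries.map (iterateFrobenius Ω p r) (j ⟨x, _⟩) = j ⟨x, _⟩
        rw [hjτ x hx, (hτ x (hmem x hx)).2.2])
  let Fr : M →+* M := IsFractionRing.map (A := PowerSeries Ω) (B := PowerSeries Ω)
    (j := PowerSeries.map (iterateFrobenius Ω p r))
    (PowerSeries.map_injective _ (iterateFrobenius Ω p r).injective)
  have hFr : ∀ h, Fr (algebraMap _ M h) =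
      algebraMap _ M (PowerSeries.map (iterateFrobenius Ω p r) h) := fun h =>
    IsLocalization.map_eq _ h
  obtain ⟨ι, hι, hισ, hιG⟩ := hX₀ r B' φ' hR (fun x hx => hX x (Finset.mem_union_left _ hx))
    (fun x hx hx' => hφ' x (Finset.mem_union_left _ hx) (Finset.mem_union_left _ hx') _ _)
    j.toRingHom hj hjc hjF Fr hFr
  obtain ⟨w, ev, hw, hev⟩ := exists_valuationSubring_of_arc (Ω := Ω) ι
  have htS : t ∈ insert t (s : Set L) := Set.mem_insert _ _
  have hιt : ι t = algebraMap _ M (τ t) := by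
    rw [← hjτ t htS]
    exact hι ⟨t, Algebra.subset_adjoin htS⟩
  have htw : t ∈ w := (hw t).2 ⟨_, hιt⟩
  have hτt := hτ t (hmem t htS)
  have hevt : ev ⟨t, htw⟩ = φ ⟨f t, htB⟩ := by
    rw [hev t htw _ hιt, hτt.1, ha t htS]
    rfl
  have hϖ : Irreducible (τ t ^ p ^ r - τ t) := irreducible_pow_sub_self p r hr (by
    rw [hτt.1, ha t htS, hSφ t htS]) hτt.2.1
  have hπ : ι (t ^ p ^ r - t) = algebraMap _ M (τ t ^ p ^ r - τ t) := by
    rw [map_sub, map_pow, hιt, map_sub, map_pow]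
  refine ⟨r, w, ev, htw, hr, fun x hx => (hw x).2 (hιG x hx), mem_nonunits_of_arc hw hev,
    fun z hz => ?_, fun m hm h => ?_, ?_, ?_, fun z hz =>
      exists_valuation_eq_zpow_of_arc hw hϖ hπ hz⟩
  · obtain ⟨h, hh⟩ := (hw z).1 hz
    have h1 : ι (σ z) = algebraMap _ M (PowerSeries.map (iterateFrobenius Ω p r) h) := by
      rw [← hFr, ← hh]
      exact hισ z
    refine ⟨(hw _).2 ⟨_, h1⟩, ?_⟩
    rw [hev _ _ _ h1, hev z hz h hh, ← PowerSeries.coeff_zero_eq_constantCoeff_apply,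
      PowerSeries.coeff_map, PowerSeries.coeff_zero_eq_constantCoeff_apply, iterateFrobenius_def]
  · rw [hevt] at h
    exact hφm m hm h
  · intro h
    rw [h, map_zero] at hπ
    exact hϖ.ne_zero (IsFractionRing.injective (PowerSeries Ω) M (by rw [← hπ, map_zero]))
  · have h1 : t ^ p ^ r - t ∈ w := sub_mem (pow_mem htw _) htw
    rw [← mem_nonunits_of_arc hw hev ⟨_, h1⟩, hev _ h1 _ hπ, map_sub, map_pow, hτt.1, ha t htS,
      hSφ t htS, sub_self]

end Place

section SeparatingBasis

theorem Subfield.closure_le_intermediateField {p : ℕ} [Fact p.Prime] {K : Type*} [Field K]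
    [Algebra (ZMod p) K] {s : Set K} :
    Subfield.closure s ≤ (IntermediateField.adjoin (ZMod p) s).toSubfield :=
  Subfield.closure_le.2 (IntermediateField.subset_adjoin _ _)

/-- A finitely generated infinite field of characteristic `p`, together with a finite separable
extension, is finite separable over a rational function field in at least one variable. -/
theorem exists_separating_transcendence_basis {p : ℕ} [Fact p.Prime] {K L : Type*} [Field K]
    [Field L] [Algebra K L] [Infinite K] [Algebra (ZMod p) K] [Algebra (ZMod p) L]
    [IsScalarTower (ZMod p) K L] (hK : ∃ s : Finset K, Subfield.closure (s : Set K) = ⊤)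
    [FiniteDimensional K L] [Algebra.IsSeparable K L] :
    ∃ (t : K) (s : Finset L), algebraMap K L t ∉ s ∧
      insert (algebraMap K L t) (s : Set L) ⊆ Set.range (algebraMap K L) ∧
      AlgebraicIndepOn (ZMod p) id (insert (algebraMap K L t) (s : Set L)) ∧
      FiniteDimensional (IntermediateField.adjoin (ZMod p)
        (insert (algebraMap K L t) (s : Set L))) L ∧
      Algebra.IsSeparable (IntermediateField.adjoin (ZMod p)
        (insert (algebraMap K L t) (s : Set L))) L := by
  classical
  have hess : Algebra.EssFiniteType (ZMod p) K := by
    obtain ⟨s, hs⟩ := hK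
    refine IntermediateField.fg_top_iff.1 ⟨s, top_le_iff.1 fun x _ => ?_⟩
    exact Subfield.closure_le_intermediateField (hs.symm ▸ Subfield.mem_top x)
  obtain ⟨s₀, hs₀, hsep⟩ := exists_isTranscendenceBasis_and_isSeparable_of_perfectField (ZMod p) K
  let k₀ := IntermediateField.adjoin (ZMod p) (s₀ : Set K)
  have : Algebra.EssFiniteType k₀ K := .of_comp (ZMod p) k₀ K
  have hfin : FiniteDimensional k₀ K := Algebra.finite_of_essFiniteType_of_isAlgebraic
  have hne : s₀.Nonempty := by
    by_contra h
    rw [Finset.not_nonempty_iff_eq_empty] at h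
    have hk₀ : k₀ = ⊥ := by
      change IntermediateField.adjoin (ZMod p) (s₀ : Set K) = ⊥
      rw [h, Finset.coe_empty, IntermediateField.adjoin_empty]
    have h1 : Finite k₀ := by
      rw [hk₀]
      exact Finite.of_equiv _ (IntermediateField.botEquiv (ZMod p) K).symm.toEquiv
    have h2 : Finite K := Module.finite_of_finite k₀
    exact not_finite K
  obtain ⟨t, ht⟩ := hne
  let f : K →ₐ[ZMod p] L := IsScalarTower.toAlgHom (ZMod p) K L
  have hfinL : FiniteDimensional k₀ L := .trans k₀ K L
  have hsepL : Algebra.IsSeparable k₀ L := .trans k₀ K L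
  have key : ∀ T, f '' (s₀ : Set K) = T → AlgebraicIndepOn (ZMod p) id T ∧
      FiniteDimensional (IntermediateField.adjoin (ZMod p) T) L ∧
      Algebra.IsSeparable (IntermediateField.adjoin (ZMod p) T) L := by
    rintro _ rfl
    rw [← IntermediateField.adjoin_map]
    have hcomp : (algebraMap (k₀.map f) L).comp
        ((IntermediateField.equivMap k₀ f : k₀ ≃+* k₀.map f) : k₀ →+* k₀.map f) =
        ((RingEquiv.refl L : L ≃+* L) : L →+* L).comp (algebraMap k₀ L) := RingHom.ext fun x => rfl
    exact ⟨AlgebraicIndepOn.image_algHom hs₀.1 f f.injective,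
      Module.Finite.of_equiv_equiv _ _ hcomp, Algebra.IsSeparable.of_equiv_equiv _ _ hcomp⟩
  have himg : f '' (s₀ : Set K) =
      insert (algebraMap K L t) (((s₀.erase t).image f : Finset L) : Set L) := by
    rw [Finset.coe_image, show algebraMap K L t = f t from rfl, ← Set.image_insert_eq,
      ← Finset.coe_insert, Finset.insert_erase ht]
  refine ⟨t, (s₀.erase t).image f, fun h => ?_, ?_, key _ himg⟩
  · obtain ⟨y, hy, hyt⟩ := Finset.mem_image.1 h
    exact (Finset.mem_erase.1 hy).1 (f.injective hyt)
  · rw [← himg]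
    rintro _ ⟨y, -, rfl⟩
    exact ⟨y, rfl⟩

theorem exists_one_lt_pow_eq_self (p : ℕ) [Fact p.Prime] {Ω : Type*} [Field Ω] [Algebra (ZMod p) Ω]
    [Algebra.IsAlgebraic (ZMod p) Ω] (c : Ω) : ∃ n, 1 < n ∧ c ^ n = c := by
  let E := IntermediateField.adjoin (ZMod p) {c}
  have : FiniteDimensional (ZMod p) E :=
    IntermediateField.adjoin.finiteDimensional (Algebra.IsIntegral.isIntegral c)
  have : Finite E := Module.finite_of_finite (ZMod p)
  have := Fintype.ofFinite E
  refine ⟨Fintype.card E, Fintype.one_lt_card, ?_⟩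
  exact congrArg Subtype.val
    (FiniteField.pow_card (⟨c, IntermediateField.mem_adjoin_simple_self _ c⟩ : E))

end SeparatingBasis

/-- **Chebotarev's density theorem for finitely generated fields of positive characteristic**
(Prasad–Rapinchuk, Proposition 4.1). Let `K` be an infinite finitely generated field of
characteristic `p > 0`, `R ⊆ K` a finitely generated subring, `L/K` a finite Galois extension
and `𝒞` a conjugacy class of `Gal(L/K)`. Then there is a nontrivial discrete valuation `v` of
`K` whose completion is locally compact (equivalently: `v` is discrete with finite residue
field), whose valuation ring contains `R`, and such that every extension `w` of `v` to `L` is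
unramified with Frobenius automorphism in `𝒞`. -/
theorem chebotarev_finitely_generated_positive_char
    {K L : Type} [Field K] [Field L] [Algebra K L] [Infinite K]
    (p : ℕ) (hp : p.Prime) [CharP K p]
    (hKfg : ∃ s : Finset K, Subfield.closure (s : Set K) = ⊤)
    (R : Subring K) (hRfg : ∃ s : Finset K, Subring.closure (s : Set K) = R)
    [FiniteDimensional K L] [IsGalois K L]
    (𝒞 : ConjClasses (L ≃ₐ[K] L)) :
    ∃ v : ValuationSubring K, v ≠ ⊤ ∧ IsDiscreteValuationRing ↥v ∧
      Finite (IsLocalRing.ResidueField ↥v) ∧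
      (∀ x ∈ R, x ∈ v) ∧
      ∀ (w : ValuationSubring L) (hw : w.comap (algebraMap K L) = v),
        ValuationSubring.IsUnramifiedExtension v w hw ∧
        ∃ σ ∈ 𝒞.carrier, ValuationSubring.IsFrobeniusAt v w σ := by
  classical
  have : Fact p.Prime := ⟨hp⟩
  have : CharP L p := charP_of_injective_algebraMap (algebraMap K L).injective p
  let _ : Algebra (ZMod p) K := ZMod.algebra K p
  let _ : Algebra (ZMod p) L := ZMod.algebra L p
  have : IsScalarTower (ZMod p) K L := .of_algebraMap_eq' (Subsingleton.elim _ _)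
  let Ω := AlgebraicClosure (ZMod p)
  have : CharP Ω p := charP_of_injective_algebraMap (algebraMap (ZMod p) Ω).injective p
  obtain ⟨t, s, ht, hsK, hs, _, _⟩ := exists_separating_transcendence_basis (p := p) (L := L) hKfg
  obtain ⟨G, rfl⟩ := hRfg
  obtain ⟨σ, rfl⟩ := 𝒞.exists_rep
  obtain ⟨r, w, ev, htw, hr, hG, hev, hσ, hmin, hπ0, hπ, hval⟩ := exists_place p (Ω := Ω) ht hs
    (σ : L ≃+* L) (fun x hx => by
      obtain ⟨y, rfl⟩ := hsK hx
      exact σ.commutes y) (G.image (algebraMap K L))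
  have hπK : algebraMap K L (t ^ p ^ r - t) = algebraMap K L t ^ p ^ r - algebraMap K L t := by
    rw [map_sub, map_pow]
  obtain ⟨h1, h2, h3, h4⟩ := ValuationSubring.of_place p r hr
    (exists_one_lt_pow_eq_self p (Ω := Ω)) w ev hev (π := t ^ p ^ r - t)
    (fun h => hπ0 (by rw [← hπK, h, map_zero])) (by rwa [hπK])
    (fun z hz => by rw [hπK]; exact hval z hz) σ hσ t htw hmin _ rfl
  refine ⟨w.comap (algebraMap K L), h1, h2, h3, fun x hx => ?_, fun w' hw' => ?_⟩
  · exact Subring.closure_le (t := (w.comap (algebraMap K L)).toSubring).2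
      (fun y hy => hG _ (Finset.mem_image_of_mem _ hy)) hx
  · obtain ⟨h5, σ', hσ', h6⟩ := h4 w' hw'
    exact ⟨h5, σ', ConjClasses.mem_carrier_iff_mk_eq.2 (ConjClasses.mk_eq_mk_iff_isConj.2 hσ'.symm),
      h6⟩
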